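/- arXiv:2504.03851 — 3 statements merged into one kernel-verified Lean document; each statement's English description precedes it below -/
import Mathlib

section
/- Let n ≥ 2 be an integer and p a prime. Then there exist constants c₁, …, c₆ > 0 depending only on n and p such that for all sufficiently large Q there are at least c₁ Q^{2/n} irreducible polynomials P ∈ ℤ[X] of degree n with c₂ Q ≤ H(P) ≤ c₃ Q whose discriminant has almost prime power form of maximal size: c₄ Q^{2n−2} ≤ |D(P)| ≤ c₅ Q^{2n−2}, and D(P) = p^k · C for some k ∈ ℕ and C ∈ ℤ with |C| ≤ c₆. -/
open Polynomial

/-- The height of an integer polynomial: the maximum of the absolute values of its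
coefficients. -/
def polyHeight (P : Polynomial ℤ) : ℕ :=
  (Finset.range (P.natDegree + 1)).sup fun i => (P.coeff i).natAbs

/-- `IsDiscriminant P D` asserts that `D ∈ ℤ` is the discriminant of the integer polynomial
`P` of degree `n = P.natDegree`, i.e. `D = a_n^{2n−2} ∏_{i<j} (α_i − α_j)²` where
`α_1, …, α_n` are the roots of `P` (with multiplicity) in an algebraic closure of `ℚ` and
`a_n` is the leading coefficient. -/
def IsDiscriminant (P : Polynomial ℤ) (D : ℤ) : Prop :=
  ∃ α : Fin P.natDegree → AlgebraicClosure ℚ,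
    P.map (algebraMap ℤ (AlgebraicClosure ℚ)) =
      Polynomial.C (algebraMap ℤ (AlgebraicClosure ℚ) P.leadingCoeff) *
        ∏ i : Fin P.natDegree, (Polynomial.X - Polynomial.C (α i)) ∧
    algebraMap ℤ (AlgebraicClosure ℚ) D =
      algebraMap ℤ (AlgebraicClosure ℚ) P.leadingCoeff ^ (2 * P.natDegree - 2) *
        ∏ q ∈ Finset.univ.filter
            (fun q : Fin P.natDegree × Fin P.natDegree => q.1 < q.2),
          (α q.1 - α q.2) ^ 2

/-- The pullback of the form `x ^ n + p y ^ n` under the matrix `(a b; c d)`, dehomogenised. -/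
noncomputable def pulledForm (p n a b c d : ℕ) : ℕ[X] :=
  (C a * X + C b) ^ n + C p * (C c * X + C d) ^ n

theorem pulledForm_natDegree_le (p n a b c d : ℕ) : (pulledForm p n a b c d).natDegree ≤ n := by
  unfold pulledForm
  refine (natDegree_add_le _ _).trans (max_le ?_ ?_)
  · exact (natDegree_pow_le_of_le n (natDegree_linear_le)).trans (by simp)
  · refine (natDegree_C_mul_le _ _).trans ?_
    exact (natDegree_pow_le_of_le n (natDegree_linear_le)).trans (by simp)

theorem coeff_linear_pow {R : Type*} [CommSemiring R] (a b : R) (n : ℕ) :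
    ((C a * X + C b) ^ n).coeff n = a ^ n := by
  have h := coeff_pow_of_natDegree_le (p := C a * X + C b) (m := n) (n := 1) natDegree_linear_le
  simpa using h

theorem pulledForm_coeff (p n a b c d : ℕ) :
    (pulledForm p n a b c d).coeff n = a ^ n + p * c ^ n := by
  rw [pulledForm, coeff_add, coeff_C_mul, coeff_linear_pow, coeff_linear_pow]

theorem pulledForm_coeff_zero (p n a b c d : ℕ) :
    (pulledForm p n a b c d).coeff 0 = b ^ n + p * d ^ n := by
  simp [pulledForm, coeff_zero_eq_eval_zero]

theorem pulledForm_natDegree {p n a b c d : ℕ} (ha : 0 < a) :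
    (pulledForm p n a b c d).natDegree = n := by
  refine natDegree_eq_of_le_of_coeff_ne_zero (pulledForm_natDegree_le ..) ?_
  rw [pulledForm_coeff]
  positivity

theorem Polynomial.coeff_le_eval_one (N : ℕ[X]) (i : ℕ) : N.coeff i ≤ N.eval 1 := by
  rw [eval_eq_sum_range]
  simp only [one_pow, mul_one]
  by_cases h : i ≤ N.natDegree
  · exact Finset.single_le_sum (f := fun i => N.coeff i) (fun _ _ => Nat.zero_le _)
      (Finset.mem_range.2 (by omega))
  · rw [coeff_eq_zero_of_natDegree_lt (by omega)]
    exact Nat.zero_le _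

/-- Integer points where `x ^ n + p y ^ n` is highly divisible by `p` are themselves divisible. -/
theorem dvd_of_pow_dvd_pow_add_mul_pow {p n : ℕ} (hp : p.Prime) (hn : 2 ≤ n) (k : ℕ) (x y : ℤ)
    (h : (p : ℤ) ^ (n * k) ∣ x ^ n + p * y ^ n) : (p : ℤ) ^ k ∣ x := by
  have hp' : Prime (p : ℤ) := Nat.prime_iff_prime_int.1 hp
  have hp0 : (p : ℤ) ≠ 0 := hp'.ne_zero
  induction k generalizing x y with
  | zero => simp
  | succ k ih =>
    have h1 : (p : ℤ) ^ n ∣ x ^ n + p * y ^ n := (pow_dvd_pow _ (by nlinarith)).trans h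
    have hx : (p : ℤ) ∣ x := by
      have h2 : (p : ℤ) ∣ x ^ n + p * y ^ n := (dvd_pow_self _ (by omega)).trans h1
      exact hp'.dvd_of_dvd_pow ((dvd_add_left (dvd_mul_right _ _)).1 h2)
    obtain ⟨x, rfl⟩ := hx
    have hy : (p : ℤ) ∣ y := by
      have h2 : (p : ℤ) ^ n ∣ p * y ^ n := by
        refine (dvd_add_right ?_).1 h1
        rw [mul_pow]
        exact dvd_mul_right _ _
      have h3 : (p : ℤ) * p ∣ p * y ^ n := by
        refine dvd_trans ?_ h2
        rw [← sq]
        exact pow_dvd_pow _ hn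
      exact hp'.dvd_of_dvd_pow ((mul_dvd_mul_iff_left hp0).1 h3)
    obtain ⟨y, rfl⟩ := hy
    rw [pow_succ']
    refine mul_dvd_mul_left _ (ih x y ?_)
    have e : ((p : ℤ) * x) ^ n + p * (p * y) ^ n = p ^ n * (x ^ n + p * y ^ n) := by ring
    rw [e, mul_add, mul_one, add_comm, pow_add] at h
    exact (mul_dvd_mul_iff_left (pow_ne_zero _ hp0)).1 h

/-- The integer version of `pulledForm`. -/
noncomputable def pulledFormInt (p n a b c d : ℕ) : ℤ[X] :=
  (pulledForm p n a b c d).map (Nat.castRingHom ℤ)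

theorem aeval_pulledFormInt {K : Type*} [Field K] [Algebra ℤ K] (p n a b c d : ℕ) (x : K) :
    aeval x (pulledFormInt p n a b c d) = (a * x + b) ^ n + p * (c * x + d) ^ n := by
  simp [pulledFormInt, pulledForm]

theorem pow_mul_aeval_pulledFormInt (p n a b c d a' b' : ℕ) (ha : 0 < a') :
    (a' : ℚ) ^ n * aeval (-(b' : ℚ) / a') (pulledFormInt p n a b c d) =
      (((a' : ℤ) * b - a * b' : ℤ) ^ n + p * (a' * d - c * b' : ℤ) ^ n : ℤ) := by
  have h : (a' : ℚ) ≠ 0 := by positivity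
  rw [aeval_pulledFormInt, mul_add, mul_left_comm, ← mul_pow, ← mul_pow]
  push_cast
  congr 2
  · field_simp; ring
  · congr 1; field_simp; ring

theorem exists_int_pow_mul_aeval (G : ℤ[X]) {n : ℕ} (hG : G.natDegree ≤ n) (a b : ℤ) (ha : a ≠ 0) :
    ∃ z : ℤ, (a : ℚ) ^ n * aeval (-(b : ℚ) / a) G = z := by
  refine ⟨∑ i ∈ Finset.range (n + 1), G.coeff i * ((-b) ^ i * a ^ (n - i)), ?_⟩
  rw [aeval_eq_sum_range' (Nat.lt_succ_of_le hG), Finset.mul_sum]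
  push_cast
  refine Finset.sum_congr rfl fun i hi => ?_
  have : (a : ℚ) ≠ 0 := by exact_mod_cast ha
  have e : (a : ℚ) ^ n = a ^ i * a ^ (n - i) := by
    rw [← pow_add]; congr 1; have := Finset.mem_range.1 hi; omega
  rw [e, zsmul_eq_mul, div_pow]
  field_simp

theorem pulledFormInt_coeff (p n a b c d i : ℕ) :
    (pulledFormInt p n a b c d).coeff i = (pulledForm p n a b c d).coeff i := by
  simp [pulledFormInt]

theorem pulledFormInt_natDegree {p n a b c d : ℕ} (ha : 0 < a) :
    (pulledFormInt p n a b c d).natDegree = n := by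
  rw [pulledFormInt, natDegree_map_eq_of_injective (by simpa using Nat.cast_injective),
    pulledForm_natDegree ha]

theorem pulledFormInt_isPrimitive {p n a b c d k : ℕ} (hp : p.Prime) (hn : 2 ≤ n) (ha : 0 < a)
    (hab : a.Coprime b) (h : a * d = b * c + p ^ k) :
    (pulledFormInt p n a b c d).IsPrimitive := by
  have hp' : Prime (p : ℤ) := Nat.prime_iff_prime_int.1 hp
  intro r hr
  have hcoeff : ∀ i, r ∣ (pulledForm p n a b c d).coeff i := fun i => by
    rw [← pulledFormInt_coeff]
    exact C_dvd_iff_dvd_coeff _ _ |>.1 hr i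
  have hpow : r ∣ (p : ℤ) ^ (k * n + 1) := by
    obtain ⟨G, hG⟩ := hr
    have hr0 : r ≠ 0 := by
      rintro rfl
      have := pulledFormInt_natDegree (p := p) (n := n) (b := b) (c := c) (d := d) ha
      rw [hG] at this
      simp at this
      omega
    have hGn : G.natDegree ≤ n := by
      rw [← pulledFormInt_natDegree (p := p) (n := n) (b := b) (c := c) (d := d) ha, hG,
        natDegree_C_mul hr0]
    obtain ⟨z, hz⟩ := exists_int_pow_mul_aeval G hGn a b (by exact_mod_cast ha.ne')
    have key := pow_mul_aeval_pulledFormInt p n a b c d a b ha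
    rw [hG, map_mul, aeval_C, mul_left_comm, eq_intCast] at key
    push_cast at hz
    rw [hz] at key
    have key' : r * z =
      (((a : ℤ) * b - a * b : ℤ) ^ n + p * (a * d - c * b : ℤ) ^ n : ℤ) := by exact_mod_cast key
    have e : (a * d - c * b : ℤ) = p ^ k := by
      have : (a * d : ℤ) = b * c + p ^ k := by exact_mod_cast h
      rw [this]; ring
    rw [e, sub_self, zero_pow (by omega), zero_add, ← pow_mul, ← pow_succ'] at key'
    exact ⟨z, key'.symm⟩
  by_contra hu
  have hpr : (p : ℤ) ∣ r := by
    have h1 : r.natAbs ∣ p ^ (k * n + 1) := by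
      have := Int.natAbs_dvd_natAbs.2 hpow
      simpa [Int.natAbs_pow] using this
    obtain ⟨j, -, hj⟩ := (Nat.dvd_prime_pow hp).1 h1
    rcases j with _ | j
    · exact absurd (Int.isUnit_iff_natAbs_eq.2 (by simpa using hj)) hu
    · rw [← Int.dvd_natAbs, hj]
      exact_mod_cast dvd_pow_self p (by omega)
  have hpa : p ∣ a := by
    have h1 := hpr.trans (hcoeff n)
    rw [pulledForm_coeff] at h1
    have h2 : p ∣ a ^ n + p * c ^ n := by exact_mod_cast h1
    exact hp.dvd_of_dvd_pow ((Nat.dvd_add_left (dvd_mul_right _ _)).1 h2)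
  have hpb : p ∣ b := by
    have h1 := hpr.trans (hcoeff 0)
    rw [pulledForm_coeff_zero] at h1
    have h2 : p ∣ b ^ n + p * d ^ n := by exact_mod_cast h1
    exact hp.dvd_of_dvd_pow ((Nat.dvd_add_left (dvd_mul_right _ _)).1 h2)
  exact hp.one_lt.ne' (Nat.eq_one_of_dvd_coprimes hab hpa hpb)

/-- Distinct small primitive vectors give distinct pulled back forms. -/
theorem pulledFormInt_inj {p n a b c d a' b' c' d' k : ℕ} (hp : p.Prime) (hn : 2 ≤ n)
    (ha : 0 < a) (hb : 0 < b) (ha' : 0 < a') (hb' : 0 < b')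
    (hab : a.Coprime b) (hab' : a'.Coprime b') (h : a * d = b * c + p ^ k)
    (h1 : a * b' ≤ p ^ k) (h2 : a' * b ≤ p ^ k)
    (heq : pulledFormInt p n a b c d = pulledFormInt p n a' b' c' d') : a = a' ∧ b = b' := by
  have e1 := pow_mul_aeval_pulledFormInt p n a b c d a b ha
  rw [heq, pow_mul_aeval_pulledFormInt _ _ _ _ _ _ _ _ ha] at e1
  have e1' := Int.cast_injective e1
  have e : (a * d - c * b : ℤ) = p ^ k := by
    have : (a * d : ℤ) = b * c + p ^ k := by exact_mod_cast h
    rw [this]; ring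
  rw [e, sub_self, zero_pow (by omega), zero_add, ← pow_mul] at e1'
  have hd := dvd_of_pow_dvd_pow_add_mul_pow hp hn k _ _
    (by rw [e1', mul_comm n k]; exact dvd_mul_left _ _)
  have hz : (a : ℤ) * b' - a' * b = 0 := by
    refine Int.eq_zero_of_abs_lt_dvd hd ?_
    have g1 : (a * b' : ℤ) ≤ p ^ k := by exact_mod_cast h1
    have g2 : (a' * b : ℤ) ≤ p ^ k := by exact_mod_cast h2
    have g3 : (0 : ℤ) < a * b' := by positivity
    have g4 : (0 : ℤ) < a' * b := by positivity
    rw [abs_lt]; constructor <;> linarith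
  have hz' : a * b' = a' * b := by
    have : (a * b' : ℤ) = a' * b := by linarith
    exact_mod_cast this
  have haa : a = a' := Nat.dvd_antisymm
    (hab.dvd_of_dvd_mul_right (Dvd.intro _ hz')) (hab'.dvd_of_dvd_mul_right (Dvd.intro _ hz'.symm))
  subst haa
  exact ⟨rfl, (Nat.eq_of_mul_eq_mul_left ha hz').symm⟩

theorem exists_lt_mul_eq_mul_add {a b : ℕ} (ha : 0 < a) (hab : a.Coprime b) (t : ℕ) :
    ∃ c d : ℕ, c < a ∧ a * d = b * c + t := by
  obtain ⟨u, v, huv⟩ := Nat.isCoprime_iff_coprime.2 hab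
  have ha' : (0 : ℤ) < a := by exact_mod_cast ha
  obtain ⟨c, hc⟩ := Int.eq_ofNat_of_zero_le (Int.emod_nonneg (-(t * v)) ha'.ne')
  have hlt := Int.emod_lt_of_pos (-(t * v)) ha'
  have hdvd : (a : ℤ) ∣ b * c + t := by
    have h1 : (a : ℤ) ∣ c + t * v := by
      have := Int.dvd_self_sub_of_emod_eq hc
      have h2 : (a : ℤ) ∣ -(-(t * v) - c) := (dvd_neg (α := ℤ)).2 this
      convert h2 using 1
      ring
    have e : (b * c + t : ℤ) = b * (c + t * v) + a * (u * t) := by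
      linear_combination (-(t : ℤ)) * huv
    rw [e]
    exact dvd_add (h1.mul_left _) (dvd_mul_right _ _)
  have hdvd' : a ∣ b * c + t := by exact_mod_cast hdvd
  obtain ⟨d, hd⟩ := hdvd'
  exact ⟨c, d, by omega, hd.symm⟩

theorem sum_inv_sq_le (T : ℕ) :
    ∑ q ∈ Finset.Icc 2 T, (1 : ℝ) / (q : ℝ) ^ 2 ≤ 3 / 4 := by
  have key : ∀ m : ℕ, ∑ q ∈ Finset.Icc 2 (m + 2), (1 : ℝ) / (q : ℝ) ^ 2 ≤ 3 / 4 - 1 / (m + 2) := by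
    intro m
    induction m with
    | zero => norm_num
    | succ m ih =>
      rw [show m + 1 + 2 = (m + 2) + 1 by ring, Finset.sum_Icc_succ_top (by omega)]
      have : (1 : ℝ) / ((m + 2 + 1 : ℕ) : ℝ) ^ 2 ≤ 1 / (m + 2) - 1 / ((m + 1 : ℕ) + 2) := by
        push_cast
        rw [div_sub_div _ _ (by positivity) (by positivity),
          div_le_div_iff₀ (by positivity) (by positivity)]
        nlinarith
      linarith
  rcases lt_or_ge T 2 with h | h
  · rw [Finset.Icc_eq_empty (by omega)]; norm_num
  · obtain ⟨m, rfl⟩ := Nat.exists_eq_add_of_le' h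
    exact (key m).trans (by have : (0 : ℝ) ≤ 1 / (m + 2) := by positivity
                            linarith)

/-- Coprime pairs in a square, with the first coordinate not too small. -/
def coprimePairs (T : ℕ) : Finset (ℕ × ℕ) :=
  (Finset.Icc 1 T ×ˢ Finset.Icc 1 T).filter fun x => x.1.Coprime x.2 ∧ T ≤ 8 * x.1

theorem sq_le_card_coprimePairs (T : ℕ) : (T : ℝ) ^ 2 / 8 ≤ (coprimePairs T).card := by
  classical
  let S := Finset.Icc 1 T ×ˢ Finset.Icc 1 T
  let M := fun q : ℕ => (Finset.Icc 1 T).filter (q ∣ ·)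
  let B := (Finset.Icc 2 T).biUnion fun q => M q ×ˢ M q
  let E := Finset.Icc 1 (T / 8) ×ˢ Finset.Icc 1 T
  have hsub : S ⊆ coprimePairs T ∪ (B ∪ E) := by
    rintro ⟨a, b⟩ h
    simp only [S, Finset.mem_product, Finset.mem_Icc] at h
    simp only [Finset.mem_union, coprimePairs, Finset.mem_filter, Finset.mem_product,
      Finset.mem_Icc, B, E, M, Finset.mem_biUnion]
    by_cases h8 : T ≤ 8 * a
    · by_cases hc : a.Coprime b
      · exact Or.inl ⟨h, hc, h8⟩
      · refine Or.inr (Or.inl ⟨a.gcd b, ⟨?_, ?_⟩, ⟨h.1, Nat.gcd_dvd_left _ _⟩,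
          ⟨h.2, Nat.gcd_dvd_right _ _⟩⟩)
        · have := Nat.gcd_pos_of_pos_left b (show 0 < a by omega)
          have : a.gcd b ≠ 1 := hc
          omega
        · exact (Nat.gcd_le_left b (by omega)).trans h.1.2
    · exact Or.inr (Or.inr ⟨⟨by omega, by omega⟩, h.2⟩)
  have hM : ∀ q, (M q).card = T / q := fun q => by
    have := Nat.Ioc_filter_dvd_card_eq_div T q
    rw [← this]; rfl
  have hB : (B.card : ℝ) ≤ 3 / 4 * (T : ℝ) ^ 2 := by
    calc (B.card : ℝ) ≤ ∑ q ∈ Finset.Icc 2 T, ((M q ×ˢ M q).card : ℝ) := by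
          exact_mod_cast Finset.card_biUnion_le
      _ ≤ ∑ q ∈ Finset.Icc 2 T, (1 : ℝ) / (q : ℝ) ^ 2 * (T : ℝ) ^ 2 := by
          refine Finset.sum_le_sum fun q _ => ?_
          rw [Finset.card_product, hM]
          have h1 : ((T / q : ℕ) : ℝ) ≤ T / q := Nat.cast_div_le
          push_cast
          calc ((T / q : ℕ) : ℝ) * (T / q : ℕ) ≤ (T / q) * (T / q) := by gcongr
            _ = _ := by ring
      _ ≤ _ := by
          rw [← Finset.sum_mul]
          gcongr
          exact sum_inv_sq_le T
  have hE : (E.card : ℝ) ≤ (T : ℝ) ^ 2 / 8 := by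
    have h1 : ((T / 8 : ℕ) : ℝ) ≤ T / (8 : ℕ) := Nat.cast_div_le
    simp only [E, Finset.card_product, Nat.card_Icc, Nat.add_sub_cancel]
    push_cast at h1 ⊢
    nlinarith [(Nat.cast_nonneg T : (0 : ℝ) ≤ T)]
  have hS : (S.card : ℝ) = (T : ℝ) ^ 2 := by simp [S, sq]
  have hcard : (S.card : ℝ) ≤ (coprimePairs T).card + (B.card + E.card) := by
    have := (Finset.card_le_card hsub).trans
      ((Finset.card_union_le _ _).trans (Nat.add_le_add_left (Finset.card_union_le _ _) _))
    exact_mod_cast this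
  linarith

theorem Finset.prod_lt_mul_swap {M : Type*} [CommMonoid M] {n : ℕ} (f : Fin n × Fin n → M) :
    ∏ q ∈ Finset.univ.filter (fun q : Fin n × Fin n => q.1 < q.2), (f q * f q.swap) =
      ∏ i, ∏ j ∈ Finset.univ.erase i, f (i, j) := by
  have h1 : ∏ q ∈ Finset.univ.filter (fun q : Fin n × Fin n => q.1 < q.2), f q.swap =
      ∏ q ∈ Finset.univ.filter (fun q : Fin n × Fin n => q.2 < q.1), f q :=
    Finset.prod_nbij' Prod.swap Prod.swap (by simp) (by simp) (by simp) (by simp) (by simp)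
  rw [Finset.prod_mul_distrib, h1, ← Finset.prod_union]
  · rw [Finset.prod_sigma']
    refine Finset.prod_nbij' (fun q => ⟨q.1, q.2⟩) (fun q => (q.1, q.2)) ?_ ?_ ?_ ?_ ?_
    · intro q hq; simp at hq ⊢; omega
    · intro q hq; simp at hq ⊢; omega
    all_goals simp
  · rw [Finset.disjoint_filter]
    intro q _ h; omega

theorem finite_setOf_natAbs_coeff_le (n B : ℕ) :
    {P : ℤ[X] | P.natDegree = n ∧ ∀ i, (P.coeff i).natAbs ≤ B}.Finite := by
  refine Set.Finite.of_finite_image (f := fun P (i : Fin (n + 1)) => P.coeff i) ?_ ?_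
  · refine (Set.Finite.pi' (t := fun _ : Fin (n + 1) => Set.Icc (-(B : ℤ)) B)
      fun _ => Set.finite_Icc _ _).subset ?_
    rintro _ ⟨P, hP, rfl⟩ i
    have := hP.2 i
    simp only [Set.mem_Icc]
    omega
  · intro P hP P' hP' h
    ext i
    by_cases hi : i < n + 1
    · exact congrFun h ⟨i, hi⟩
    · rw [coeff_eq_zero_of_natDegree_lt (by rw [hP.1]; omega),
        coeff_eq_zero_of_natDegree_lt (by rw [hP'.1]; omega)]

theorem X_pow_add_C_prime_irreducible {p n : ℕ} (hp : p.Prime) (hn : 2 ≤ n) :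
    Irreducible (X ^ n + C (p : ℤ)) := by
  have hp' : Prime (p : ℤ) := Nat.prime_iff_prime_int.1 hp
  have hm : (X ^ n + C (p : ℤ)).Monic := monic_X_pow_add_C _ (by omega)
  have hdeg : (X ^ n + C (p : ℤ)).natDegree = n := natDegree_X_pow_add_C
  have hprime : (Ideal.span {(p : ℤ)}).IsPrime :=
    (Ideal.span_singleton_prime hp'.ne_zero).2 hp'
  refine IsEisensteinAt.irreducible (𝓟 := Ideal.span {(p : ℤ)}) ⟨?_, ?_, ?_⟩ hprime
    hm.isPrimitive (by omega)
  · rw [hm.leadingCoeff, Ideal.mem_span_singleton]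
    exact hp'.not_dvd_one
  · intro i hi
    rw [hdeg] at hi
    rw [Ideal.mem_span_singleton, coeff_add, coeff_X_pow, if_neg hi.ne, zero_add, coeff_C]
    split_ifs <;> simp
  · rw [coeff_add, coeff_X_pow, if_neg (by omega), zero_add, coeff_C_zero,
      Ideal.span_singleton_pow, Ideal.mem_span_singleton, sq]
    intro h
    have := (mul_dvd_mul_iff_left hp'.ne_zero).1 (h.trans (mul_one _).symm.dvd)
    exact hp'.not_dvd_one this

theorem natDegree_minpoly_of_pow_eq_neg_prime {K : Type*} [Field K] [Algebra ℚ K] {p n : ℕ}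
    (hp : p.Prime) (hn : 2 ≤ n) {θ : K} (h : θ ^ n = -p) : (minpoly ℚ θ).natDegree = n := by
  have hm : (X ^ n + C (p : ℤ)).Monic := monic_X_pow_add_C _ (by omega)
  have hirr := (IsPrimitive.Int.irreducible_iff_irreducible_map_cast hm.isPrimitive).1
    (X_pow_add_C_prime_irreducible hp hn)
  have := minpoly.eq_of_irreducible_of_monic hirr (x := θ) (by simp [h])
    (hm.map (Int.castRingHom ℚ))
  rw [← this, hm.natDegree_map, natDegree_X_pow_add_C]

theorem pulledFormInt_irreducible {p n a b c d k : ℕ} (hp : p.Prime) (hn : 2 ≤ n) (ha : 0 < a)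
    (hab : a.Coprime b) (h : a * d = b * c + p ^ k) :
    Irreducible (pulledFormInt p n a b c d) := by
  rw [IsPrimitive.Int.irreducible_iff_irreducible_map_cast
    (pulledFormInt_isPrimitive hp hn ha hab h)]
  set P := (pulledFormInt p n a b c d).map (Int.castRingHom ℚ) with hP
  have hdeg : P.natDegree = n := by
    rw [hP, natDegree_map_eq_of_injective (RingHom.injective_int _), pulledFormInt_natDegree ha]
  have hP0 : P ≠ 0 := by rintro h0; rw [h0] at hdeg; simp at hdeg; omega
  obtain ⟨β, hβ⟩ := IsAlgClosed.exists_aeval_eq_zero (AlgebraicClosure ℚ) P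
    (by rw [degree_eq_natDegree hP0, hdeg]; exact_mod_cast (by omega))
  have hβ' : (a * β + b) ^ n + p * (c * β + d) ^ n = 0 := by
    rw [← aeval_pulledFormInt, ← hβ, hP, aeval_def, aeval_def, eval₂_map]
    congr 1
  have hdet : (a * d - b * c : AlgebraicClosure ℚ) = p ^ k := by
    have : (a * d : AlgebraicClosure ℚ) = b * c + p ^ k := by exact_mod_cast congrArg Nat.cast h
    rw [this]; ring
  have hp0 : (p : AlgebraicClosure ℚ) ≠ 0 := by exact_mod_cast hp.ne_zero
  have hden : c * β + d ≠ 0 := by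
    intro h0
    rw [h0, zero_pow (by omega), mul_zero, add_zero] at hβ'
    have h1 := pow_eq_zero_iff (by omega) |>.1 hβ'
    apply pow_ne_zero k hp0
    rw [← hdet]
    linear_combination (a : AlgebraicClosure ℚ) * h0 - c * h1
  have hθ : ((a * β + b) / (c * β + d)) ^ n = -p := by
    rw [div_pow, div_eq_iff (pow_ne_zero _ hden)]
    linear_combination hβ'
  have hint : IsIntegral ℚ β := IsAlgebraic.isIntegral ⟨P, hP0, hβ⟩
  have hmem : (a * β + b) / (c * β + d) ∈ IntermediateField.adjoin ℚ {β} := by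
    have h1 := IntermediateField.mem_adjoin_simple_self ℚ β
    exact div_mem (add_mem (mul_mem (natCast_mem _ _) h1) (natCast_mem _ _))
      (add_mem (mul_mem (natCast_mem _ _) h1) (natCast_mem _ _))
  have hle : n ≤ (minpoly ℚ β).natDegree := by
    have hfd := IntermediateField.adjoin.finiteDimensional hint
    have h1 := minpoly.natDegree_le (A := ℚ)
      (⟨_, hmem⟩ : IntermediateField.adjoin ℚ {β})
    rw [IntermediateField.adjoin.finrank hint,
      ← minpoly.algebraMap_eq (algebraMap (IntermediateField.adjoin ℚ {β})
        (AlgebraicClosure ℚ)).injective] at h1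
    exact (natDegree_minpoly_of_pow_eq_neg_prime hp hn hθ).symm.le.trans h1
  have hassoc : Associated (minpoly ℚ β) P :=
    associated_of_dvd_of_natDegree_le (minpoly.dvd ℚ β hβ) hP0 (by rw [hdeg]; exact hle)
  exact hassoc.irreducible (minpoly.irreducible hint)

theorem exists_eq_prod_X_sub_C {K : Type*} [Field K] [IsAlgClosed K] {f : K[X]} (hf : f.Monic)
    {n : ℕ} (hn : f.natDegree = n) : ∃ θ : Fin n → K, f = ∏ i, (X - C (θ i)) := by
  have hs := IsAlgClosed.splits f
  have hlen : f.roots.toList.length = n := by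
    rw [Multiset.length_toList, ← hs.natDegree_eq_card_roots, hn]
  subst hlen
  refine ⟨f.roots.toList.get, ?_⟩
  conv_lhs => rw [hs.eq_prod_roots_of_monic hf, ← Multiset.coe_toList f.roots]
  rw [Multiset.map_coe, Multiset.prod_coe, ← List.prod_ofFn]
  congr 1
  apply List.ext_get <;> simp

theorem exists_int_eq_prod_sub_sq {K : Type*} [Field K] {p n : ℕ} {θ : Fin n → K} (hp : p ≠ 0)
    (hn : 2 ≤ n) (h : (X ^ n + C (p : K)) = ∏ i, (X - C (θ i))) :
    ∃ D : ℤ, D ≠ 0 ∧ (D : K) = ∏ q ∈ Finset.univ.filter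
      (fun q : Fin n × Fin n => q.1 < q.2), (θ q.1 - θ q.2) ^ 2 := by
  have hprod : ∏ i, θ i = (-1) ^ n * p := by
    have h0 := congrArg (eval 0) h
    simp only [eval_add, eval_pow, eval_X, eval_C, eval_prod, eval_sub, zero_sub] at h0
    rw [zero_pow (by omega), zero_add, Finset.prod_neg, Finset.card_univ, Fintype.card_fin] at h0
    rw [h0, ← mul_assoc, ← mul_pow]
    simp
  have hder : ∀ i, ∏ j ∈ Finset.univ.erase i, (θ i - θ j) = n * θ i ^ (n - 1) := fun i => by
    have h0 := congrArg (fun f => eval (θ i) (derivative f)) h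
    simp only [derivative_prod_finset, eval_finsetSum, derivative_add, derivative_X_pow,
      derivative_C, derivative_X_sub_C, mul_one, eval_prod, eval_sub, eval_X, eval_C, eval_mul,
      eval_pow, add_zero] at h0
    rw [h0, Finset.sum_eq_single i (fun j _ hj => ?_) (fun hi => absurd (Finset.mem_univ i) hi)]
    exact Finset.prod_eq_zero (Finset.mem_erase.2 ⟨hj.symm, Finset.mem_univ i⟩) (sub_self _)
  let N := (Finset.univ.filter (fun q : Fin n × Fin n => q.1 < q.2)).card
  refine ⟨(-1) ^ N * (n ^ n * ((-1) ^ n * p) ^ (n - 1)), ?_, ?_⟩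
  · have : (n : ℤ) ≠ 0 := by omega
    have : (p : ℤ) ≠ 0 := by exact_mod_cast hp
    simp_all
  · have e := Finset.prod_lt_mul_swap fun q : Fin n × Fin n => θ q.1 - θ q.2
    simp only [hder, Prod.fst_swap, Prod.snd_swap, Finset.prod_mul_distrib, Finset.prod_pow,
      hprod, Finset.prod_const, Finset.card_univ, Fintype.card_fin] at e
    push_cast
    rw [← e, ← Finset.prod_mul_distrib, ← Finset.prod_neg]
    exact Finset.prod_congr rfl fun q _ => by ring

theorem prod_lt_mul_eq_prod_pow {M : Type*} [CommMonoid M] {n : ℕ} (w : Fin n → M) :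
    ∏ q ∈ Finset.univ.filter (fun q : Fin n × Fin n => q.1 < q.2), (w q.1 * w q.2) =
      (∏ i, w i) ^ (n - 1) := by
  have e := Finset.prod_lt_mul_swap fun q : Fin n × Fin n => w q.1
  simpa [Finset.prod_pow] using e

theorem prod_homogeneous {K : Type*} [Field K] {p n : ℕ} {θ : Fin n → K} (hn : 2 ≤ n)
    (h : (X ^ n + C (p : K)) = ∏ i, (X - C (θ i))) (u v : K) :
    ∏ i, (u - θ i * v) = u ^ n + p * v ^ n := by
  by_cases hv : v = 0
  · simp [hv, zero_pow (show n ≠ 0 by omega)]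
  · have h0 := congrArg (eval (u / v)) h
    simp only [eval_add, eval_pow, eval_X, eval_C, eval_prod, eval_sub] at h0
    have e : ∀ i, u - θ i * v = v * (u / v - θ i) := fun i => by field_simp
    simp only [e, Finset.prod_mul_distrib, ← h0, Finset.prod_const, Finset.card_univ,
      Fintype.card_fin, div_pow]
    field_simp

theorem isDiscriminant_of_natDegree_eq {P : ℤ[X]} {n : ℕ} (hn : P.natDegree = n) {D : ℤ}
    (α : Fin n → AlgebraicClosure ℚ)
    (h : P.map (algebraMap ℤ (AlgebraicClosure ℚ)) =
      C (algebraMap ℤ (AlgebraicClosure ℚ) P.leadingCoeff) * ∏ i, (X - C (α i)))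
    (hD : algebraMap ℤ (AlgebraicClosure ℚ) D =
      algebraMap ℤ (AlgebraicClosure ℚ) P.leadingCoeff ^ (2 * n - 2) *
        ∏ q ∈ Finset.univ.filter (fun q : Fin n × Fin n => q.1 < q.2),
          (α q.1 - α q.2) ^ 2) : IsDiscriminant P D := by
  subst hn
  exact ⟨α, h, hD⟩

theorem exists_isDiscriminant_pulledFormInt {p n : ℕ} (hp : p ≠ 0) (hn : 2 ≤ n) :
    ∃ D₀ : ℤ, D₀ ≠ 0 ∧ ∀ a b c d k : ℕ, 0 < a → a * d = b * c + p ^ k →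
      IsDiscriminant (pulledFormInt p n a b c d) (p ^ (k * (n * (n - 1))) * D₀) := by
  obtain ⟨θ, hθ⟩ := exists_eq_prod_X_sub_C (K := AlgebraicClosure ℚ)
    (f := X ^ n + C (p : AlgebraicClosure ℚ)) (monic_X_pow_add_C _ (by omega))
    natDegree_X_pow_add_C
  obtain ⟨D₀, hD₀, hD⟩ := exists_int_eq_prod_sub_sq hp hn hθ
  refine ⟨D₀, hD₀, fun a b c d k ha h => ?_⟩
  have hhom := prod_homogeneous hn hθ
  have hlead : (pulledFormInt p n a b c d).leadingCoeff = a ^ n + p * c ^ n := by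
    rw [leadingCoeff, pulledFormInt_natDegree ha, pulledFormInt_coeff, pulledForm_coeff]
    push_cast; rfl
  set w : Fin n → AlgebraicClosure ℚ := fun i => a - θ i * c with hw
  have hwprod : algebraMap ℤ (AlgebraicClosure ℚ) (pulledFormInt p n a b c d).leadingCoeff =
      ∏ i, w i := by
    rw [hw, hhom, hlead]; simp
  have hw0 : ∀ i, w i ≠ 0 := by
    have : ∏ i, w i ≠ 0 := by
      rw [hw, hhom]
      have : a ^ n + p * c ^ n ≠ 0 := by positivity
      exact_mod_cast this
    exact fun i => Finset.prod_ne_zero_iff.1 this i (Finset.mem_univ i)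
  refine isDiscriminant_of_natDegree_eq (pulledFormInt_natDegree ha)
    (fun i => -(b - θ i * d) / w i) ?_ ?_
  · refine Polynomial.funext fun x => ?_
    rw [eval_map_algebraMap, aeval_pulledFormInt, ← hhom, hwprod, eval_mul,
      eval_C, eval_prod, ← Finset.prod_mul_distrib]
    refine Finset.prod_congr rfl fun i _ => ?_
    have := hw0 i
    simp only [eval_sub, eval_X, eval_C]
    field_simp
    simp only [hw]
    ring
  · have hdet : (a * d - b * c : AlgebraicClosure ℚ) = p ^ k := by
      have : (a * d : AlgebraicClosure ℚ) = b * c + p ^ k := by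
        exact_mod_cast congrArg Nat.cast h
      rw [this]; ring
    rw [hwprod, show 2 * n - 2 = (n - 1) * 2 by omega, pow_mul (∏ i, w i),
      ← prod_lt_mul_eq_prod_pow w,
      ← Finset.prod_pow, ← Finset.prod_mul_distrib]
    have e : ∀ q : Fin n × Fin n, (w q.1 * w q.2) ^ 2 *
        (-(b - θ q.1 * d) / w q.1 - -(b - θ q.2 * d) / w q.2) ^ 2 =
        (p ^ k * p ^ k) * (θ q.1 - θ q.2) ^ 2 := fun q => by
      have h1 := hw0 q.1
      have h2 := hw0 q.2
      rw [← mul_pow, ← hdet]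
      have : w q.1 * w q.2 * (-(b - θ q.1 * d) / w q.1 - -(b - θ q.2 * d) / w q.2) =
          (a * d - b * c) * (θ q.1 - θ q.2) := by
        field_simp
        simp only [hw]
        ring
      rw [this]; ring
    simp only [e]
    rw [Finset.prod_mul_distrib, ← hD,
      prod_lt_mul_eq_prod_pow (fun _ => (p : AlgebraicClosure ℚ) ^ k)]
    simp
    left
    ring

theorem polyHeight_le_iff {P : ℤ[X]} {B : ℕ} :
    polyHeight P ≤ B ↔ ∀ i, (P.coeff i).natAbs ≤ B := by
  rw [polyHeight, Finset.sup_le_iff]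
  refine ⟨fun h i => ?_, fun h i _ => h i⟩
  by_cases hi : i < P.natDegree + 1
  · exact h i (Finset.mem_range.2 hi)
  · rw [coeff_eq_zero_of_natDegree_lt (by omega)]
    simp

theorem finite_setOf_polyHeight_le (n : ℕ) (B : ℝ) :
    {P : ℤ[X] | P.natDegree = n ∧ (polyHeight P : ℝ) ≤ B}.Finite := by
  refine (finite_setOf_natAbs_coeff_le n ⌊B⌋₊).subset fun P hP => ⟨hP.1, ?_⟩
  exact polyHeight_le_iff.1 (Nat.le_floor hP.2)

theorem pow_le_polyHeight_pulledFormInt (p n a b c d : ℕ) :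
    a ^ n ≤ polyHeight (pulledFormInt p n a b c d) := by
  have h := polyHeight_le_iff.1 (le_refl (polyHeight (pulledFormInt p n a b c d))) n
  rw [pulledFormInt_coeff, Int.natAbs_natCast, pulledForm_coeff] at h
  exact (Nat.le_add_right _ _).trans h

theorem polyHeight_pulledFormInt_le (p n a b c d : ℕ) :
    polyHeight (pulledFormInt p n a b c d) ≤ (a + b) ^ n + p * (c + d) ^ n := by
  refine polyHeight_le_iff.2 fun i => ?_
  rw [pulledFormInt_coeff, Int.natAbs_natCast]
  refine (Polynomial.coeff_le_eval_one _ i).trans ?_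
  simp [pulledForm]

/-- **Almost prime power discriminants.** Let `n ≥ 2` and `p` a prime. There
are constants `c₁, …, c₆ > 0` depending only on `n` and `p` such that for all sufficiently
large `Q` there are at least `c₁ Q^{2/n}` irreducible `P ∈ ℤ[X]` of degree `n` with
`c₂ Q ≤ H(P) ≤ c₃ Q`, `c₄ Q^{2n−2} ≤ |D(P)| ≤ c₅ Q^{2n−2}`, and `D(P) = p^k · C` for some
`k ∈ ℕ` and `C ∈ ℤ` with `|C| ≤ c₆`. -/
theorem stmt5 (p : ℕ) [Fact p.Prime] (n : ℕ) (hn : 2 ≤ n) :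
    ∃ c₁ c₂ c₃ c₄ c₅ c₆ : ℝ,
      0 < c₁ ∧ 0 < c₂ ∧ 0 < c₃ ∧ 0 < c₄ ∧ 0 < c₅ ∧ 0 < c₆ ∧
      ∃ Q₀ : ℝ, ∀ Q : ℝ, Q₀ ≤ Q →
        c₁ * Q ^ (2 / (n : ℝ)) ≤
          (({P : Polynomial ℤ | Irreducible P ∧ P.natDegree = n ∧
              c₂ * Q ≤ (polyHeight P : ℝ) ∧ (polyHeight P : ℝ) ≤ c₃ * Q ∧
              ∃ D : ℤ, IsDiscriminant P D ∧
                c₄ * Q ^ (2 * (n : ℝ) - 2) ≤ (|D| : ℝ) ∧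
                (|D| : ℝ) ≤ c₅ * Q ^ (2 * (n : ℝ) - 2) ∧
                ∃ (k : ℕ) (C : ℤ), D = (p : ℤ) ^ k * C ∧ (|C| : ℝ) ≤ c₆}).ncard : ℝ) := by
  have hp : p.Prime := Fact.out
  have hp0 : (0 : ℝ) < p := by exact_mod_cast hp.pos
  have hp1 : (1 : ℝ) < p := by exact_mod_cast hp.one_lt
  obtain ⟨D₀, hD₀, hdisc⟩ := exists_isDiscriminant_pulledFormInt hp.ne_zero hn
  have hD₀' : (0 : ℝ) < |(D₀ : ℝ)| := abs_pos.2 (by exact_mod_cast hD₀)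
  refine ⟨1 / (8 * (p : ℝ) ^ 2), 1 / (8 * (p : ℝ)) ^ n, 2 ^ n + p * 10 ^ n,
    |(D₀ : ℝ)| / ((p : ℝ) ^ n) ^ (2 * n - 2), |(D₀ : ℝ)|, |(D₀ : ℝ)|, by positivity, by positivity,
    by positivity, by positivity, hD₀', hD₀', 1, fun Q hQ => ?_⟩
  have hQ0 : 0 < Q := by linarith
  have hn0 : (n : ℝ) ≠ 0 := by exact_mod_cast (by omega)
  -- `R = Q ^ (1 / n)` is the natural size of the matrix entries.
  set R : ℝ := Q ^ (1 / (n : ℝ)) with hR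
  have hR1 : 1 ≤ R := Real.one_le_rpow hQ (by positivity)
  have hRn : R ^ n = Q := by
    rw [hR, ← Real.rpow_natCast, ← Real.rpow_mul hQ0.le, one_div_mul_cancel hn0, Real.rpow_one]
  have hR2 : Q ^ (2 / (n : ℝ)) = R ^ 2 := by
    rw [hR, ← Real.rpow_natCast, ← Real.rpow_mul hQ0.le]
    congr 1; push_cast; ring
  have hQpow : Q ^ (2 * (n : ℝ) - 2) = Q ^ (2 * n - 2) := by
    rw [← Real.rpow_natCast, Nat.cast_sub (by omega)]
    push_cast; rfl
  obtain ⟨m, hm, hm'⟩ := exists_nat_pow_near hR1 hp1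
  set T : ℕ := p ^ m with hT
  have hTR : (T : ℝ) ≤ R := by simpa [hT] using hm
  have hRT : R ≤ p * T := by
    rw [hT]; push_cast; rw [← pow_succ']; exact hm'.le
  have hT0 : 0 < T := pow_pos hp.pos m
  have hTT : T * T = p ^ (2 * m) := by rw [hT]; ring
  have hTQ : (T : ℝ) ^ n ≤ Q := by rw [← hRn]; gcongr
  have hQT : Q ≤ (p : ℝ) ^ n * T ^ n := by rw [← hRn, ← mul_pow]; gcongr
  have hex : ∀ x : ℕ × ℕ, ∃ y : ℕ × ℕ, x ∈ coprimePairs T →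
      y.1 < x.1 ∧ x.1 * y.2 = x.2 * y.1 + p ^ (2 * m) := fun x => by
    by_cases hx : x ∈ coprimePairs T
    · simp only [coprimePairs, Finset.mem_filter, Finset.mem_product, Finset.mem_Icc] at hx
      obtain ⟨c, d, h⟩ := exists_lt_mul_eq_mul_add hx.1.1.1 hx.2.1 (p ^ (2 * m))
      exact ⟨(c, d), fun _ => h⟩
    · exact ⟨(0, 0), fun h => absurd h hx⟩
  choose y hy using hex
  let F : ℕ × ℕ → ℤ[X] := fun x => pulledFormInt p n x.1 x.2 (y x).1 (y x).2
  have hinj : Set.InjOn F (coprimePairs T) := by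
    intro x hx x' hx' h
    have hy' := (hy x hx).2
    simp only [coprimePairs, Finset.coe_filter, Finset.mem_product, Finset.mem_Icc,
      Set.mem_ofPred_eq] at hx hx'
    have := pulledFormInt_inj hp hn (by omega) (by omega) (by omega) (by omega) hx.2.1 hx'.2.1 hy'
      (by rw [← hTT]; exact Nat.mul_le_mul hx.1.1.2 hx'.1.2.2)
      (by rw [← hTT]; exact Nat.mul_le_mul hx'.1.1.2 hx.1.2.2) h
    exact Prod.ext this.1 this.2
  have hcount : ((coprimePairs T).card : ℝ) = (F '' (coprimePairs T)).ncard := by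
    rw [hinj.ncard_image, Set.ncard_coe_finset]
  refine (?_ : _ ≤ ((coprimePairs T).card : ℝ)).trans (hcount.le.trans ?_)
  · refine le_trans ?_ (sq_le_card_coprimePairs T)
    have : R ^ 2 ≤ (p * T) ^ 2 := by gcongr
    rw [hR2, div_mul_eq_mul_div, one_mul, div_le_div_iff₀ (by positivity) (by positivity)]
    nlinarith
  · refine Nat.cast_le.2 (Set.ncard_le_ncard ?_
      ((finite_setOf_polyHeight_le n _).subset fun P hP => ⟨hP.2.1, hP.2.2.2.1⟩))
    rintro _ ⟨⟨a, b⟩, hx, rfl⟩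
    obtain ⟨hca, hdet⟩ := hy _ hx
    simp only [coprimePairs, Finset.coe_filter, Finset.mem_product, Finset.mem_Icc,
      Set.mem_ofPred_eq] at hx
    obtain ⟨⟨⟨ha0, haT⟩, hb0, hbT⟩, hab, hTa⟩ := hx
    simp only [F]
    generalize (y (a, b)).1 = c at *
    generalize (y (a, b)).2 = d at *
    simp only at hca hdet
    have hdT : d ≤ 9 * T := by
      have h1 : a * d ≤ a * (9 * T) := by
        rw [hdet, ← hTT]
        have h2 : b * c ≤ T * a := Nat.mul_le_mul hbT hca.le
        have h3 : T * T ≤ T * (8 * a) := Nat.mul_le_mul le_rfl hTa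
        nlinarith
      exact Nat.le_of_mul_le_mul_left h1 ha0
    refine ⟨pulledFormInt_irreducible hp hn ha0 hab hdet, pulledFormInt_natDegree ha0, ?_, ?_,
      _, hdisc a b c d (2 * m) ha0 hdet, ?_, ?_, _, D₀, rfl, le_rfl⟩
    · have h1 : ((a ^ n : ℕ) : ℝ) ≤ polyHeight (pulledFormInt p n a b c d) :=
        Nat.cast_le.2 (pow_le_polyHeight_pulledFormInt p n a b c d)
      refine le_trans ?_ h1
      rw [div_mul_eq_mul_div, one_mul, div_le_iff₀ (by positivity)]
      push_cast
      refine hQT.trans ?_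
      have : (T : ℝ) ≤ 8 * a := by exact_mod_cast hTa
      calc (p : ℝ) ^ n * T ^ n ≤ p ^ n * (8 * a) ^ n := by gcongr
        _ = _ := by rw [← mul_pow, ← mul_pow]; ring
    · have h1 : polyHeight (pulledFormInt p n a b c d) ≤ (2 * T) ^ n + p * (10 * T) ^ n := by
        refine (polyHeight_pulledFormInt_le p n a b c d).trans ?_
        gcongr <;> omega
      have h2 : (polyHeight (pulledFormInt p n a b c d) : ℝ) ≤
          (2 * T) ^ n + p * (10 * T) ^ n := by exact_mod_cast h1
      refine h2.trans ?_
      calc ((2 : ℝ) * T) ^ n + p * (10 * T) ^ n = (2 ^ n + p * 10 ^ n) * T ^ n := by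
            rw [mul_pow, mul_pow]; ring
        _ ≤ _ := by gcongr
    all_goals
      have habs : |(((p : ℤ) ^ (2 * m * (n * (n - 1))) * D₀ : ℤ) : ℝ)| =
          |(D₀ : ℝ)| * ((T : ℝ) ^ n) ^ (2 * n - 2) := by
        push_cast
        rw [abs_mul, abs_of_pos (by positivity), mul_comm, hT, ← pow_mul]
        push_cast
        rw [← pow_mul, show 2 * n - 2 = 2 * (n - 1) by omega]
        congr 2; ring
      rw [hQpow, habs]
    · rw [div_mul_eq_mul_div, div_le_iff₀ (by positivity), mul_assoc, ← mul_pow,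
        mul_comm ((T : ℝ) ^ n)]
      gcongr
    · gcongr
end

section
/- (Key Lemma) Let n ≥ 2 be an integer, p a prime, v > 0 and 0 < κ < 1. Then there exist positive constants δ₀, C₁, C₂ depending only on n, p and κ such that: for every ball B = B(x₀, r) ⊆ ℤ_p (x₀ ∈ ℤ_p, 0 ≤ r ≤ 1) there exists Q₀ = Q₀(B, n, p, v, κ) such that for every Q ≥ Q₀ and all parameters 0 < ξ₀ ≤ ξ₁ ≤ ⋯ ≤ ξ_{n−1} ≤ ξ_n = 1 satisfying ∏_{i=0}^{n} ξ_i = Q^{−(n+1)} and ξ₀ ≤ Q^{−1−v}, there exists a measurable set G_B ⊆ B with μ(G_B) ≥ κ μ(B) such that for every x ∈ G_B there exist n+1 polynomials P₀, …, P_n ∈ ℤ[X], each primitive and irreducible over ℚ, of degree n, with C₁ Q ≤ H(P_l) ≤ C₂ Q, whose coefficient vectors are linearly independent over ℚ, and which satisfy δ₀ ξ_i ≤ |(1/i!) P_l^{(i)}(x)|_p ≤ ξ_i for all 0 ≤ i ≤ n and all 0 ≤ l ≤ n. -/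
open Polynomial MeasureTheory

noncomputable instance (p : ℕ) [Fact p.Prime] : MeasurableSpace ℚ_[p] := borel _
instance (p : ℕ) [Fact p.Prime] : BorelSpace ℚ_[p] := ⟨rfl⟩

section Balls

variable {p : ℕ} [Fact p.Prime]

/-- The closed ball in `ℚ_p` with centre `a` and radius `p ^ (-m)`. -/
def padicBall (a : ℚ_[p]) (m : ℤ) : Set ℚ_[p] := Metric.closedBall a ((p : ℝ) ^ (-m))

lemma one_lt_prime_cast : (1 : ℝ) < p := by exact_mod_cast (Fact.out : p.Prime).one_lt

lemma prime_cast_pos : (0 : ℝ) < p := one_lt_prime_cast.trans' one_pos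

lemma mem_padicBall {a x : ℚ_[p]} {m : ℤ} : x ∈ padicBall a m ↔ ‖x - a‖ ≤ (p : ℝ) ^ (-m) := by
  rw [padicBall, mem_closedBall_iff_norm]

lemma mem_padicBall_self (a : ℚ_[p]) (m : ℤ) : a ∈ padicBall a m := by
  rw [mem_padicBall, sub_self, norm_zero]
  exact (zpow_pos prime_cast_pos _).le

lemma padicBall_eq_of_mem {a x : ℚ_[p]} {m : ℤ} (h : x ∈ padicBall a m) :
    padicBall a m = padicBall x m :=
  IsUltrametricDist.closedBall_eq_of_mem h

lemma padicBall_subset (a : ℚ_[p]) {m k : ℤ} (h : m ≤ k) : padicBall a k ⊆ padicBall a m :=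
  Metric.closedBall_subset_closedBall
    (zpow_le_zpow_right₀ one_lt_prime_cast.le (neg_le_neg h))

lemma isOpen_padicBall (a : ℚ_[p]) (m : ℤ) : IsOpen (padicBall a m) :=
  IsUltrametricDist.isOpen_closedBall _ (zpow_pos prime_cast_pos _).ne'

lemma exists_padicBall_subset_of_isOpen {U : Set ℚ_[p]} (hU : IsOpen U) {x : ℚ_[p]} (hx : x ∈ U)
    (m : ℤ) : ∃ j : ℕ, padicBall x (m + j) ⊆ U := by
  obtain ⟨ε, hε, h⟩ := Metric.isOpen_iff.1 hU x hx
  obtain ⟨j, hj⟩ := exists_pow_lt_of_lt_one (y := (p : ℝ)⁻¹)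
    (mul_pos hε (zpow_pos (prime_cast_pos (p := p)) m)) (inv_lt_one_of_one_lt₀ one_lt_prime_cast)
  refine ⟨j, fun y hy => h ?_⟩
  rw [Metric.mem_ball, dist_eq_norm]
  refine (mem_padicBall.1 hy).trans_lt ?_
  have hp : (0 : ℝ) < (p : ℝ) ^ m := zpow_pos prime_cast_pos m
  rw [neg_add, zpow_add₀ prime_cast_pos.ne', zpow_neg, zpow_neg, zpow_natCast, ← inv_pow,
    inv_mul_lt_iff₀ hp]
  linarith

lemma measure_padicBall_eq_zero (μ : Measure ℚ_[p]) [μ.IsAddHaarMeasure] (a : ℚ_[p]) (m : ℤ) :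
    μ (padicBall a m) = μ (padicBall 0 m) := by
  have : padicBall a m = (fun x => -a + x) ⁻¹' padicBall 0 m := by
    ext x
    simp only [Set.mem_preimage, mem_padicBall, sub_zero, neg_add_eq_sub]
  rw [this, measure_preimage_add]

lemma measure_padicBall_succ (μ : Measure ℚ_[p]) [μ.IsAddHaarMeasure] (a : ℚ_[p]) (m : ℤ) :
    μ (padicBall a m) = p * μ (padicBall a (m + 1)) := by
  have hp0 : (p : ℚ_[p]) ≠ 0 := by exact_mod_cast (Fact.out : p.Prime).ne_zero
  have hcover : padicBall a m =
      ⋃ i ∈ Finset.range p, padicBall (a + (i : ℚ_[p]) * (p : ℚ_[p]) ^ m) (m + 1) := by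
    ext x
    simp only [Set.mem_iUnion, exists_prop, Finset.mem_range]
    constructor
    · intro hx
      have hy : ‖(x - a) * (p : ℚ_[p]) ^ (-m)‖ ≤ 1 := by
        rw [norm_mul, Padic.norm_p_zpow, neg_neg]
        calc ‖x - a‖ * (p : ℝ) ^ m ≤ (p : ℝ) ^ (-m) * (p : ℝ) ^ m := by
              gcongr
              · exact (mem_padicBall.1 hx)
          _ = 1 := by rw [← zpow_add₀ prime_cast_pos.ne', neg_add_cancel, zpow_zero]
      obtain ⟨i, hi, hm⟩ := PadicInt.exists_mem_range (⟨_, hy⟩ : ℤ_[p])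
      refine ⟨i, hi, mem_padicBall.2 ?_⟩
      rw [PadicInt.maximalIdeal_eq_span_p, ← pow_one (p : ℤ_[p]),
        ← PadicInt.norm_le_pow_iff_mem_span_pow, PadicInt.norm_def] at hm
      push_cast at hm
      have : x - (a + (i : ℚ_[p]) * (p : ℚ_[p]) ^ m)
          = ((x - a) * (p : ℚ_[p]) ^ (-m) - i) * (p : ℚ_[p]) ^ m := by
        rw [sub_mul, mul_assoc, ← zpow_add₀ hp0, neg_add_cancel, zpow_zero]
        ring
      rw [this, norm_mul, Padic.norm_p_zpow, neg_add, add_comm, zpow_add₀ prime_cast_pos.ne']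
      gcongr
      exact hm
    · rintro ⟨i, -, hi⟩
      rw [mem_padicBall] at hi ⊢
      have h1 : ‖(i : ℚ_[p]) * (p : ℚ_[p]) ^ m‖ ≤ (p : ℝ) ^ (-m) := by
        rw [norm_mul, Padic.norm_p_zpow]
        exact mul_le_of_le_one_left (zpow_pos prime_cast_pos _).le
          (by exact_mod_cast Padic.norm_int_le_one (p := p) (i : ℤ))
      have h2 : (p : ℝ) ^ (-(m + 1)) ≤ (p : ℝ) ^ (-m) :=
        zpow_le_zpow_right₀ one_lt_prime_cast.le (by lia)
      have : x - a = (x - (a + (i : ℚ_[p]) * (p : ℚ_[p]) ^ m)) + i * (p : ℚ_[p]) ^ m := by ring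
      rw [this]
      exact (Padic.nonarchimedean _ _).trans (max_le (hi.trans h2) h1)
  have hdisj : (↑(Finset.range p) : Set ℕ).PairwiseDisjoint
      (fun i => padicBall (a + (i : ℚ_[p]) * (p : ℚ_[p]) ^ m) (m + 1)) := by
    intro i hi j hj hij
    rw [Function.onFun, Set.disjoint_left]
    intro x hx hx'
    apply hij
    rw [mem_padicBall] at hx hx'
    have h3 : ‖((i : ℤ) - (j : ℤ) : ℤ)  * (p : ℚ_[p]) ^ m‖ ≤ (p : ℝ) ^ (-(m + 1)) := by
      have : (((i : ℤ) - (j : ℤ) : ℤ) : ℚ_[p]) * (p : ℚ_[p]) ^ m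
        = (x - (a + (j : ℚ_[p]) * (p : ℚ_[p]) ^ m))
          - (x - (a + (i : ℚ_[p]) * (p : ℚ_[p]) ^ m)) := by push_cast; ring
      rw [this, sub_eq_add_neg]
      exact (Padic.nonarchimedean _ _).trans (max_le hx' (by rwa [norm_neg]))
    rw [norm_mul, Padic.norm_p_zpow, neg_add, add_comm, zpow_add₀ prime_cast_pos.ne'] at h3
    have h4 := le_of_mul_le_mul_right h3 (zpow_pos prime_cast_pos _)
    have h5 := (Padic.norm_int_le_pow_iff_dvd (p := p) ((i : ℤ) - (j : ℤ)) 1).1 (by simpa using h4)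
    rw [pow_one] at h5
    have hi' := Finset.mem_range.1 (Finset.mem_coe.1 hi)
    have hj' := Finset.mem_range.1 (Finset.mem_coe.1 hj)
    have := Int.eq_zero_of_abs_lt_dvd h5 (by rw [abs_lt]; constructor <;> lia)
    lia
  rw [hcover, measure_biUnion_finset hdisj (fun i _ => (isOpen_padicBall _ _).measurableSet),
    measure_padicBall_eq_zero μ a]
  simp only [measure_padicBall_eq_zero μ (_ + _)]
  simp

lemma measure_padicBall_add (μ : Measure ℚ_[p]) [μ.IsAddHaarMeasure] (a : ℚ_[p]) (m : ℤ) (j : ℕ) :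
    μ (padicBall a m) = (p : ENNReal) ^ j * μ (padicBall a (m + j)) := by
  induction j with
  | zero => simp
  | succ j ih =>
    rw [ih, measure_padicBall_succ μ a (m + j), ← mul_assoc, pow_succ]
    push_cast
    rw [add_assoc]

lemma measure_padicBall_lt_top (μ : Measure ℚ_[p]) [μ.IsAddHaarMeasure] (a : ℚ_[p]) (m : ℤ) :
    μ (padicBall a m) < ⊤ :=
  measure_closedBall_lt_top

/-- A set which is small in some ball around each of its points is small. -/
lemma measure_le_of_forall_exists_padicBall (μ : Measure ℚ_[p]) {F : Set ℚ_[p]} {c : ENNReal}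
    {a : ℚ_[p]} {M : ℤ}
    (hF : ∀ x ∈ F, x ∈ padicBall a M ∧
      ∃ j : ℕ, μ (F ∩ padicBall x (M + j)) ≤ c * μ (padicBall x (M + j))) :
    μ F ≤ c * μ (padicBall a M) := by
  classical
  let J : ℚ_[p] → ℕ := fun x =>
    if h : ∃ j : ℕ, μ (F ∩ padicBall x (M + j)) ≤ c * μ (padicBall x (M + j)) then Nat.find h else 0
  have hJ : ∀ x ∈ F, μ (F ∩ padicBall x (M + J x)) ≤ c * μ (padicBall x (M + J x)) := by
    intro x hx
    simp only [J]
    rw [dif_pos (hF x hx).2]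
    exact Nat.find_spec (hF x hx).2
  have hmin : ∀ x (j : ℕ), μ (F ∩ padicBall x (M + j)) ≤ c * μ (padicBall x (M + j)) →
      J x ≤ j := by
    intro x j hj
    have h : ∃ j : ℕ, μ (F ∩ padicBall x (M + j)) ≤ c * μ (padicBall x (M + j)) := ⟨j, hj⟩
    simp only [J]
    rw [dif_pos h]
    exact Nat.find_min' h hj
  let D : ℚ_[p] → Set ℚ_[p] := fun x => padicBall x (M + J x)
  have key : ∀ x ∈ F, ∀ y ∈ F, D y ⊆ D x → D y = D x := by
    intro x hx y hy hyx
    have h1 : padicBall x (M + J x) = padicBall y (M + J x) :=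
      padicBall_eq_of_mem (hyx (mem_padicBall_self _ _))
    have h2 : J y ≤ J x := hmin y _ (by rw [← h1]; exact hJ x hx)
    refine hyx.antisymm ?_
    simp only [D]
    rw [h1]
    exact padicBall_subset _ (by lia)
  have hdisj : (D '' F).PairwiseDisjoint id := by
    rintro _ ⟨x, hx, rfl⟩ _ ⟨y, hy, rfl⟩ hne
    rcases IsUltrametricDist.closedBall_subset_trichotomy x y
      ((p : ℝ) ^ (-(M + J x))) ((p : ℝ) ^ (-(M + J y))) with h | h | h
    · exact absurd (key y hy x hx h) hne
    · exact absurd (key x hx y hy h).symm hne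
    · exact h
  have hcount : (D '' F).Countable := by
    refine hdisj.countable_of_isOpen ?_ ?_
    · rintro _ ⟨x, -, rfl⟩
      exact isOpen_padicBall _ _
    · rintro _ ⟨x, -, rfl⟩
      exact ⟨x, mem_padicBall_self _ _⟩
  have hsub : F ⊆ ⋃ E ∈ D '' F, F ∩ E := by
    intro x hx
    simp only [Set.mem_iUnion]
    exact ⟨D x, ⟨x, hx, rfl⟩, hx, mem_padicBall_self _ _⟩
  calc μ F ≤ μ (⋃ E ∈ D '' F, F ∩ E) := measure_mono hsub
    _ ≤ ∑' E : D '' F, μ (F ∩ E) := measure_biUnion_le μ hcount _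
    _ ≤ ∑' E : D '' F, c * μ E := by
        refine ENNReal.tsum_le_tsum ?_
        rintro ⟨_, x, hx, rfl⟩
        exact hJ x hx
    _ = c * ∑' E : D '' F, μ E := ENNReal.tsum_mul_left
    _ = c * μ (⋃ E ∈ D '' F, E) := by
        congr 1
        refine (measure_biUnion (f := id) hcount hdisj ?_).symm
        rintro _ ⟨x, -, rfl⟩
        exact (isOpen_padicBall _ _).measurableSet
    _ ≤ c * μ (padicBall a M) := by
        gcongr
        refine Set.iUnion₂_subset ?_
        rintro _ ⟨x, hx, rfl⟩
        rw [padicBall_eq_of_mem (hF x hx).1]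
        exact padicBall_subset _ (by lia)

end Balls

section Nondivergence

variable {p : ℕ} [Fact p.Prime] {T : Type*} [PartialOrder T]

/-- The point `x` is marked by a chain in `S` on which `ψ` is less than `1` at `x`, while `ψ` is at
least `ε` at `x` on all elements of `S` that are comparable with the chain. -/
def IsMarked (ψ : T → ℚ_[p] → ℝ) (ε : ℝ) (S : Set T) (x : ℚ_[p]) : Prop :=
  ∃ F ⊆ S, IsChain (· ≤ ·) F ∧ (∀ s ∈ F, ψ s x < 1) ∧
    ∀ t ∈ S, (∀ s ∈ F, s ≤ t ∨ t ≤ s) → ε ≤ ψ t x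

lemma IsMarked.of_comparable {ψ : T → ℚ_[p] → ℝ} {ε : ℝ} {S : Set T} {x : ℚ_[p]} {s : T}
    (hs : s ∈ S) (h : IsMarked ψ ε {t ∈ S | t ≠ s ∧ (s ≤ t ∨ t ≤ s)} x)
    (h1 : ψ s x < 1) (h2 : ε ≤ ψ s x) : IsMarked ψ ε S x := by
  obtain ⟨F, hFS, hF, hF1, hFε⟩ := h
  refine ⟨insert s F, ?_, ?_, ?_, ?_⟩
  · exact Set.insert_subset hs (hFS.trans (Set.sep_subset _ _))
  · exact hF.insert fun t ht _ => (hFS ht).2.2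
  · rintro t (rfl | ht)
    exacts [h1, hF1 t ht]
  · intro t ht hcomp
    by_cases hts : t = s
    · rwa [hts]
    · exact hFε t ⟨ht, hts, hcomp s (Set.mem_insert _ _)⟩
        fun u hu => hcomp u (Set.mem_insert_of_mem _ hu)

/-- The constant in the quantitative nondivergence estimate for posets of rank `k`. -/
noncomputable def nondivergenceConst (p : ℕ) : ℕ → ENNReal
  | 0 => 0
  | k + 1 => p * (1 + nondivergenceConst p k)

lemma nondivergenceConst_ne_top (p k : ℕ) : nondivergenceConst p k ≠ ⊤ := by
  induction k with
  | zero => simp [nondivergenceConst]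
  | succ k ih =>
    exact ENNReal.mul_ne_top (ENNReal.natCast_ne_top p) (ENNReal.add_ne_top.2 ⟨by simp, ih⟩)

/-- Quantitative nondivergence for a family of functions on `ℚ_p` indexed by a poset, after
Kleinbock and Margulis. -/
theorem measure_not_isMarked_le (μ : Measure ℚ_[p]) [μ.IsAddHaarMeasure]
    {rk : T → ℕ} (hrk : StrictMono rk) {ψ : T → ℚ_[p] → ℝ} (hcont : ∀ s, Continuous (ψ s))
    {ε : ℝ} (hε : ε ≤ 1) {η : ENNReal}
    (hgood : ∀ s a m, (∃ y ∈ padicBall a m, 1 ≤ ψ s y) →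
      μ {x ∈ padicBall a m | ψ s x < ε} ≤ η * μ (padicBall a m))
    (k : ℕ) : ∀ (S : Set T) (R : Finset ℕ), R.card = k → (∀ s ∈ S, rk s ∈ R) →
      ∀ (a : ℚ_[p]) (m : ℤ), (∀ s ∈ S, ∃ y ∈ padicBall a m, 1 ≤ ψ s y) →
      μ {x ∈ padicBall a m | ¬ IsMarked ψ ε S x}
        ≤ nondivergenceConst p k * η * μ (padicBall a m) := by
  classical
  have hempty : ∀ (S : Set T) (x : ℚ_[p]), (∀ s ∈ S, 1 ≤ ψ s x) → IsMarked ψ ε S x :=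
    fun S x h => ⟨∅, Set.empty_subset _, IsChain.empty, by simp, fun t ht _ => hε.trans (h t ht)⟩
  induction k with
  | zero =>
    intro S R hR hS a m _
    rw [Finset.card_eq_zero] at hR
    have : {x ∈ padicBall a m | ¬ IsMarked ψ ε S x} = ∅ := by
      ext x
      simp only [Set.mem_ofPred_eq, Set.mem_empty_iff_false, iff_false, not_and, not_not]
      refine fun _ => hempty S x fun s hs => ?_
      simpa [hR] using hS s hs
    rw [this]
    simp
  | succ k ih =>
    intro S R hR hS a m hsup
    refine measure_le_of_forall_exists_padicBall μ ?_
    rintro x ⟨hxa, hx⟩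
    refine ⟨hxa, ?_⟩
    have hex : ∃ j : ℕ, ∃ s ∈ S, ∀ y ∈ padicBall x (m + j), ψ s y < 1 := by
      by_contra! hcon
      refine hx (hempty S x fun s hs => ?_)
      by_contra! hlt
      obtain ⟨j, hj⟩ := exists_padicBall_subset_of_isOpen
        (isOpen_lt (hcont s) continuous_const) (show x ∈ {y | ψ s y < 1} from hlt) m
      obtain ⟨y, hy, hy1⟩ := hcon j s hs
      exact absurd (hj hy) (not_lt.2 hy1)
    obtain ⟨s, hs, hlt⟩ := Nat.find_spec hex
    obtain ⟨i, hi⟩ : ∃ i, Nat.find hex = i + 1 := by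
      refine Nat.exists_eq_succ_of_ne_zero fun h0 => ?_
      obtain ⟨y, hy, hy1⟩ := hsup s hs
      refine absurd (hlt y ?_) (not_lt.2 hy1)
      rw [h0]
      simpa [← padicBall_eq_of_mem hxa] using hy
    have hsup' : ∀ t ∈ S, ∃ y ∈ padicBall x (m + i), 1 ≤ ψ t y := by
      intro t ht
      have := Nat.find_min hex (m := i) (by lia)
      push Not at this
      exact this t ht
    rw [hi] at hlt
    refine ⟨i + 1, ?_⟩
    set S' := {t ∈ S | t ≠ s ∧ (s ≤ t ∨ t ≤ s)}
    have hS' : ∀ t ∈ S', rk t ∈ R.erase (rk s) := by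
      rintro t ⟨ht, hne, hcomp⟩
      refine Finset.mem_erase.2 ⟨?_, hS t ht⟩
      rcases hcomp with h | h
      · exact (hrk (lt_of_le_of_ne h hne.symm)).ne'
      · exact (hrk (lt_of_le_of_ne h hne)).ne
    have hIH := ih S' (R.erase (rk s)) (by rw [Finset.card_erase_of_mem (hS s hs), hR]; rfl) hS' x
      (m + i) fun t ht => hsup' t ht.1
    have hsub : {x ∈ padicBall a m | ¬ IsMarked ψ ε S x} ∩ padicBall x (m + (i + 1 : ℕ)) ⊆
        {y ∈ padicBall x (m + i) | ψ s y < ε} ∪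
          {y ∈ padicBall x (m + i) | ¬ IsMarked ψ ε S' y} := by
      rintro y ⟨⟨-, hy⟩, hyx⟩
      have hyx' := padicBall_subset x (show m + i ≤ m + (i + 1 : ℕ) by push_cast; lia) hyx
      by_cases hys : ψ s y < ε
      · exact Or.inl ⟨hyx', hys⟩
      · exact Or.inr ⟨hyx', fun hm => hy (hm.of_comparable hs (hlt y hyx) (not_lt.1 hys))⟩
    calc μ ({x ∈ padicBall a m | ¬ IsMarked ψ ε S x} ∩ padicBall x (m + (i + 1 : ℕ)))
        ≤ η * μ (padicBall x (m + i)) + nondivergenceConst p k * η * μ (padicBall x (m + i)) :=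
          (measure_mono hsub).trans ((measure_union_le _ _).trans
            (add_le_add (hgood s x _ (hsup' s hs)) hIH))
      _ = nondivergenceConst p (k + 1) * η * μ (padicBall x (m + (i + 1 : ℕ))) := by
          rw [measure_padicBall_succ μ x (m + i), nondivergenceConst]
          push_cast
          rw [add_assoc]
          ring

end Nondivergence

section Good

variable {p : ℕ} [Fact p.Prime]

/-- A set not covered by `d` small balls contains `d + 1` separated points. -/
lemma exists_separated_finset (μ : Measure ℚ_[p]) [μ.IsAddHaarMeasure] {A : Set ℚ_[p]}
    {b : ENNReal} {m : ℤ} (hb : ∀ x, μ (padicBall x m) ≤ b) (d : ℕ) (hA : d * b < μ A) :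
    ∃ s : Finset ℚ_[p], s.card = d + 1 ∧ ↑s ⊆ A ∧
      ∀ x ∈ s, ∀ y ∈ s, x ≠ y → (p : ℝ) ^ (-m) < ‖x - y‖ := by
  classical
  have : ∀ j ≤ d + 1, ∃ s : Finset ℚ_[p], s.card = j ∧ ↑s ⊆ A ∧
      ∀ x ∈ s, ∀ y ∈ s, x ≠ y → (p : ℝ) ^ (-m) < ‖x - y‖ := by
    intro j
    induction j with
    | zero => exact fun _ => ⟨∅, by simp⟩
    | succ j ih =>
      intro hj
      obtain ⟨s, hsc, hsA, hs⟩ := ih (by lia)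
      obtain ⟨x, hxA, hx⟩ : ∃ x ∈ A, ∀ y ∈ s, x ∉ padicBall y m := by
        by_contra! hcon
        refine absurd hA (not_lt.2 ?_)
        calc μ A ≤ μ (⋃ y ∈ s, padicBall y m) := measure_mono fun x hx => by
              obtain ⟨y, hy, hxy⟩ := hcon x hx
              exact Set.mem_biUnion hy hxy
          _ ≤ ∑ y ∈ s, μ (padicBall y m) := measure_biUnion_finset_le _ _
          _ ≤ ∑ y ∈ s, b := Finset.sum_le_sum fun y _ => hb y
          _ = j * b := by rw [Finset.sum_const, hsc, nsmul_eq_mul]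
          _ ≤ d * b := by gcongr; lia
      have hsep : ∀ y ∈ s, (p : ℝ) ^ (-m) < ‖x - y‖ := fun y hy =>
        not_le.1 fun h => hx y hy (mem_padicBall.2 h)
      refine ⟨insert x s, ?_, ?_, ?_⟩
      · rw [Finset.card_insert_of_notMem fun h => hx x h (mem_padicBall_self _ _), hsc]
      · rw [Finset.coe_insert]
        exact Set.insert_subset hxA hsA
      · intro y hy z hz hyz
        rw [Finset.mem_insert] at hy hz
        rcases hy with rfl | hy <;> rcases hz with rfl | hz
        · exact absurd rfl hyz
        · exact hsep z hz
        · rw [norm_sub_rev]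
          exact hsep y hy
        · exact hs y hy z hz hyz
  exact this (d + 1) le_rfl

lemma norm_eval_lagrangeBasis_le {K : Type*} [NormedField K] [DecidableEq K] {s : Finset K} {i : K}
    (hi : i ∈ s) {y : K} {ρ r : ℝ} (hρ : 0 < ρ) (hsep : ∀ l ∈ s, l ≠ i → ρ < ‖i - l‖)
    (hy : ∀ l ∈ s, ‖y - l‖ ≤ r) :
    ‖eval y (Lagrange.basis s id i)‖ ≤ (r / ρ) ^ (s.card - 1) := by
  rw [Lagrange.basis, eval_prod, norm_prod, ← Finset.card_erase_of_mem hi, ← Finset.prod_const]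
  refine Finset.prod_le_prod (fun _ _ => norm_nonneg _) fun l hl => ?_
  obtain ⟨hli, hl⟩ := Finset.mem_erase.1 hl
  simp only [Lagrange.basisDivisor, id, eval_mul, eval_C, eval_sub, eval_X, norm_mul, norm_inv]
  rw [inv_mul_eq_div]
  exact div_le_div₀ ((norm_nonneg _).trans (hy l hl)) (hy l hl) hρ (hsep l hl hli).le

/-- Polynomials of bounded degree on `ℚ_p` are good functions. -/
lemma measure_eval_lt_le (μ : Measure ℚ_[p]) [μ.IsAddHaarMeasure] {f : ℚ_[p][X]} {d : ℕ}
    (hf : f.natDegree ≤ d) (a : ℚ_[p]) (m : ℤ) (j : ℕ) {y : ℚ_[p]} (hy : y ∈ padicBall a m)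
    {M : ℝ} (hM : M ≤ ‖f.eval y‖) :
    μ {x ∈ padicBall a m | ‖f.eval x‖ < (p : ℝ) ^ (-(j * d : ℤ)) * M} ≤
      d * (p : ENNReal)⁻¹ ^ j * μ (padicBall a m) := by
  classical
  by_contra! hcon
  have hp0 : (p : ENNReal) ^ j ≠ 0 :=
    pow_ne_zero _ (by exact_mod_cast (Fact.out : p.Prime).ne_zero)
  have hpt : (p : ENNReal) ^ j ≠ ⊤ := ENNReal.pow_ne_top (ENNReal.natCast_ne_top p)
  have hb : ∀ x, μ (padicBall x (m + j)) ≤ (p : ENNReal)⁻¹ ^ j * μ (padicBall a m) := by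
    intro x
    rw [measure_padicBall_eq_zero μ a, ← measure_padicBall_eq_zero μ x,
      measure_padicBall_add μ x m j, ← mul_assoc, ← ENNReal.inv_pow, ENNReal.inv_mul_cancel hp0 hpt,
      one_mul]
  rw [mul_assoc] at hcon
  obtain ⟨s, hsc, hsA, hs⟩ := exists_separated_finset μ hb d hcon
  have hdeg : f.degree < s.card :=
    (degree_le_of_natDegree_le hf).trans_lt (by rw [hsc]; exact_mod_cast Nat.lt_succ_self d)
  have heq := Lagrange.eq_interpolate (v := id) (Function.injective_id.injOn) hdeg
  have hM0 : 0 < (p : ℝ) ^ (-(j * d : ℤ)) * M := by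
    obtain ⟨z, hz⟩ := Finset.card_pos.1 (by rw [hsc]; exact Nat.succ_pos d)
    exact (norm_nonneg _).trans_lt (hsA hz).2
  refine absurd hM (not_le.2 ?_)
  have hne : s.Nonempty := Finset.card_pos.1 (by rw [hsc]; exact Nat.succ_pos d)
  obtain ⟨i, hi, hle⟩ := IsUltrametricDist.exists_norm_finsetSum_le_of_nonempty hne
    (fun i => eval y (C (eval i f) * Lagrange.basis s id i))
  have hsum : eval y f = ∑ i ∈ s, eval y (C (eval i f) * Lagrange.basis s id i) := by
    nth_rewrite 1 [heq]
    rw [Lagrange.interpolate_apply, eval_finsetSum]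
    rfl
  rw [hsum]
  refine hle.trans_lt ?_
  rw [eval_mul, eval_C, norm_mul]
  have hbasis : ‖eval y (Lagrange.basis s id i)‖ ≤ (p : ℝ) ^ (j * d : ℤ) := by
    have := norm_eval_lagrangeBasis_le hi (zpow_pos prime_cast_pos _)
      (fun l hl hil => hs i hi l hl hil.symm) (r := (p : ℝ) ^ (-m)) (y := y) fun l hl => by
        rw [← mem_padicBall, ← padicBall_eq_of_mem (hsA hl).1]
        exact hy
    rwa [← zpow_sub₀ prime_cast_pos.ne', hsc, Nat.add_sub_cancel, ← zpow_natCast, ← zpow_mul,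
      show -m - -(m + (j : ℤ)) = j by ring] at this
  calc ‖eval i f‖ * ‖eval y (Lagrange.basis s id i)‖
      ≤ ‖eval i f‖ * (p : ℝ) ^ (j * d : ℤ) := by gcongr
    _ < (p : ℝ) ^ (-(j * d : ℤ)) * M * (p : ℝ) ^ (j * d : ℤ) :=
        mul_lt_mul_of_pos_right (hsA hi).2 (zpow_pos prime_cast_pos _)
    _ = M := by
        rw [mul_right_comm, ← zpow_add₀ prime_cast_pos.ne', neg_add_cancel, zpow_zero, one_mul]

/-- A polynomial of bounded degree takes a value on a given ball which is comparable to its largest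
coefficient. -/
lemma exists_mul_norm_coeff_le_norm_eval (a : ℚ_[p]) (m : ℤ) (d : ℕ) :
    ∃ c : ℝ, 0 < c ∧ ∀ f : ℚ_[p][X], f.natDegree ≤ d → ∀ i,
      ∃ y ∈ padicBall a m, c * ‖f.coeff i‖ ≤ ‖f.eval y‖ := by
  classical
  have hinf : (padicBall a m).Infinite :=
    infinite_of_mem_nhds a ((isOpen_padicBall a m).mem_nhds (mem_padicBall_self a m))
  obtain ⟨s, hsA, hsc⟩ := hinf.exists_subset_card_eq (d + 1)
  have hne : s.Nonempty := Finset.card_pos.1 (by rw [hsc]; exact Nat.succ_pos d)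
  let K : ℝ := 1 + ∑ x ∈ s, ∑ i ∈ Finset.range (d + 1), ‖(Lagrange.basis s id x).coeff i‖
  have hK : 0 < K := add_pos_of_pos_of_nonneg one_pos
    (Finset.sum_nonneg fun _ _ => Finset.sum_nonneg fun _ _ => norm_nonneg _)
  refine ⟨K⁻¹, inv_pos.2 hK, fun f hf i => ?_⟩
  by_cases hi : d < i
  · refine ⟨a, mem_padicBall_self a m, ?_⟩
    rw [coeff_eq_zero_of_natDegree_lt (hf.trans_lt hi)]
    simp
  have hdeg : f.degree < s.card :=
    (degree_le_of_natDegree_le hf).trans_lt (by rw [hsc]; exact_mod_cast Nat.lt_succ_self d)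
  have heq := Lagrange.eq_interpolate (v := id) (Function.injective_id.injOn) hdeg
  obtain ⟨y, hy, hle⟩ := IsUltrametricDist.exists_norm_finsetSum_le_of_nonempty hne
      (fun x => (C (eval (id x) f) * Lagrange.basis s id x).coeff i)
  refine ⟨y, hsA hy, ?_⟩
  rw [inv_mul_le_iff₀ hK]
  nth_rewrite 1 [heq]
  rw [Lagrange.interpolate_apply, finsetSum_coeff]
  refine hle.trans ?_
  rw [coeff_C_mul, norm_mul, mul_comm]
  refine mul_le_mul_of_nonneg_right ?_ (norm_nonneg _)
  refine le_add_of_nonneg_of_le zero_le_one ?_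
  calc ‖(Lagrange.basis s id y).coeff i‖
      ≤ ∑ i ∈ Finset.range (d + 1), ‖(Lagrange.basis s id y).coeff i‖ :=
        Finset.single_le_sum (f := fun i => ‖(Lagrange.basis s id y).coeff i‖)
          (fun _ _ => norm_nonneg _) (Finset.mem_range.2 (by lia))
    _ ≤ _ := Finset.single_le_sum
        (f := fun x => ∑ i ∈ Finset.range (d + 1), ‖(Lagrange.basis s id x).coeff i‖)
        (fun _ _ => Finset.sum_nonneg fun _ _ => norm_nonneg _) hy

end Good

section Wronskian

variable {K : Type*} [Field K] [CharZero K]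

/-- The Wronskian matrix of a family of polynomials, formed with Hasse derivatives. -/
noncomputable def wronskianMatrix {R : Type*} [Semiring R] {k : ℕ} (P : Fin k → R[X]) :
    Matrix (Fin k) (Fin k) R[X] :=
  Matrix.of fun a i => hasseDeriv (i : ℕ) (P a)

lemma coeff_prod_of_forall_natDegree_le {R ι : Type*} [CommSemiring R] (s : Finset ι)
    (f : ι → R[X]) (d : ι → ℕ) (h : ∀ i ∈ s, (f i).natDegree ≤ d i) :
    (∏ i ∈ s, f i).coeff (∑ i ∈ s, d i) = ∏ i ∈ s, (f i).coeff (d i) := by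
  classical
  induction s using Finset.induction_on with
  | empty => simp
  | insert a s ha ih =>
    rw [Finset.prod_insert ha, Finset.sum_insert ha, Finset.prod_insert ha,
      coeff_mul_add_eq_of_natDegree_le (h a (Finset.mem_insert_self _ _)),
      ih fun i hi => h i (Finset.mem_insert_of_mem hi)]
    exact (natDegree_prod_le _ _).trans
      (Finset.sum_le_sum fun i hi => h i (Finset.mem_insert_of_mem hi))

lemma coeff_det_of_forall_natDegree_le {R : Type*} [CommRing R] {k : ℕ}
    (M : Matrix (Fin k) (Fin k) R[X]) (d : Fin k → ℕ) (h : ∀ a i, (M a i).natDegree ≤ d a) :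
    M.det.coeff (∑ a, d a) = (Matrix.of fun a i => (M a i).coeff (d a)).det := by
  rw [Matrix.det_apply, Matrix.det_apply, finsetSum_coeff]
  refine Finset.sum_congr rfl fun σ _ => ?_
  rw [Units.smul_def, Units.smul_def, coeff_smul, ← Equiv.sum_comp σ d,
    coeff_prod_of_forall_natDegree_le _ _ _ fun i _ => h (σ i) i]
  rfl

lemma det_choose_ne_zero {k : ℕ} {d : Fin k → ℕ} (hd : Function.Injective d) :
    (Matrix.of fun a i : Fin k => ((d a).choose i : K)).det ≠ 0 := by
  have h := Matrix.det_eval_matrixOfPolynomials_eq_det_vandermonde (fun a => (d a : K))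
    (fun i : Fin k => descPochhammer K i) (fun i => descPochhammer_natDegree K i)
    (fun i => monic_descPochhammer K i)
  have hv : (Matrix.vandermonde fun a => (d a : K)).det ≠ 0 :=
    Matrix.det_vandermonde_ne_zero_iff.2 (Nat.cast_injective.comp hd)
  rw [h] at hv
  simp only [descPochhammer_eval_eq_descFactorial, Nat.descFactorial_eq_factorial_mul_choose,
    Nat.cast_mul] at hv
  have := Matrix.det_mul_row (fun i : Fin k => ((i : ℕ).factorial : K))
    (Matrix.of fun a i : Fin k => ((d a).choose i : K))
  simp only [Matrix.of_apply] at this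
  rw [this] at hv
  exact right_ne_zero_of_mul hv

lemma det_wronskianMatrix_ne_zero_of_injective {k : ℕ} {P : Fin k → K[X]} (hP : ∀ a, P a ≠ 0)
    (hinj : Function.Injective fun a => (P a).natDegree) : (wronskianMatrix P).det ≠ 0 := by
  have h1 := Matrix.det_mul_row (fun i : Fin k => (X : K[X]) ^ (i : ℕ)) (wronskianMatrix P)
  have hdeg : ∀ a i : Fin k,
      (X ^ (i : ℕ) * wronskianMatrix P a i).natDegree ≤ (P a).natDegree := by
    intro a i
    rw [wronskianMatrix, Matrix.of_apply]
    rcases lt_or_ge (P a).natDegree i with h | h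
    · rw [hasseDeriv_eq_zero_of_lt_natDegree _ _ h]
      simp
    · refine natDegree_mul_le.trans ?_
      rw [natDegree_X_pow]
      have := natDegree_hasseDeriv_le (P a) i
      lia
  have hcoeff : ∀ a i : Fin k, (X ^ (i : ℕ) * wronskianMatrix P a i).coeff (P a).natDegree =
      (P a).leadingCoeff * ((P a).natDegree.choose i : K) := by
    intro a i
    rw [wronskianMatrix, Matrix.of_apply, coeff_X_pow_mul', hasseDeriv_coeff]
    split_ifs with h
    · rw [Nat.sub_add_cancel h, mul_comm]
      rfl
    · rw [Nat.choose_eq_zero_of_lt (not_le.1 h)]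
      simp
  have h2 := coeff_det_of_forall_natDegree_le
    (Matrix.of fun a i : Fin k => X ^ (i : ℕ) * wronskianMatrix P a i) (fun a => (P a).natDegree)
    hdeg
  simp only [Matrix.of_apply, hcoeff] at h2
  have h3 := Matrix.det_mul_column (fun a => (P a).leadingCoeff)
    (Matrix.of fun a i : Fin k => ((P a).natDegree.choose i : K))
  simp only [Matrix.of_apply] at h3
  rw [h3, h1] at h2
  intro h0
  rw [h0, mul_zero, coeff_zero] at h2
  exact mul_ne_zero (Finset.prod_ne_zero_iff.2 fun a _ => leadingCoeff_ne_zero.2 (hP a))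
    (det_choose_ne_zero hinj) h2.symm

/-- The Wronskian of linearly independent polynomials in characteristic zero does not vanish. -/
theorem det_wronskianMatrix_ne_zero {k : ℕ} (P : Fin k → K[X]) (hP : LinearIndependent K P) :
    (wronskianMatrix P).det ≠ 0 := by
  induction hN : ∑ a, (P a).natDegree using Nat.strong_induction_on generalizing P with
  | _ N ih =>
  subst hN
  by_cases hinj : Function.Injective fun a => (P a).natDegree
  · exact det_wronskianMatrix_ne_zero_of_injective (fun a => hP.ne_zero a) hinj
  obtain ⟨a, b, hab, hne⟩ : ∃ a b, (P a).natDegree = (P b).natDegree ∧ a ≠ b := by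
    simpa [Function.Injective] using hinj
  have ha := hP.ne_zero a
  have hb := hP.ne_zero b
  set r : K := (P a).leadingCoeff / (P b).leadingCoeff with hr
  have hr0 : r ≠ 0 := div_ne_zero (leadingCoeff_ne_zero.2 ha) (leadingCoeff_ne_zero.2 hb)
  set c : Fin k → K := Pi.single a (-r) with hc
  have hcb : c b = 0 := Pi.single_eq_of_ne hne.symm _
  have hli : LinearIndependent K (P + fun i => c i • P b) :=
    (linearIndependent_add_smul_iff hcb).2 hP
  have hother : ∀ i, i ≠ a → (P + fun i => c i • P b) i = P i := by
    intro i hi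
    simp [hc, Pi.single_eq_of_ne hi]
  have hself : (P + fun i => c i • P b) a = P a - C r * P b := by
    simp [hc, smul_eq_C_mul, sub_eq_add_neg]
  have hlt : (P a - C r * P b).natDegree < (P a).natDegree := by
    refine natDegree_lt_natDegree (hself ▸ hli.ne_zero a) (degree_sub_lt_left ?_ ha ?_)
    · rw [degree_C_mul hr0, degree_eq_natDegree ha, degree_eq_natDegree hb, hab]
    · rw [leadingCoeff_mul, leadingCoeff_C, hr, div_mul_cancel₀ _ (leadingCoeff_ne_zero.2 hb)]
  have hdet : (wronskianMatrix (P + fun i => c i • P b)).det = (wronskianMatrix P).det := by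
    refine Matrix.det_eq_of_forall_row_eq_smul_add_const (fun i => C (c i)) b (by simp [hcb]) ?_
    intro i j
    simp [wronskianMatrix, ← smul_eq_C_mul]
  rw [← hdet]
  refine ih _ ?_ _ hli rfl
  refine Finset.sum_lt_sum (fun i _ => ?_) ⟨a, Finset.mem_univ a, by rw [hself]; exact hlt⟩
  by_cases hi : i = a
  · rw [hi, hself]
    exact hlt.le
  · rw [hother i hi]

end Wronskian

section Minors

/-- The largest norm of a maximal minor of a matrix. -/
noncomputable def minorNorm {K ι : Type*} [NormedField K] [Fintype ι] {k : ℕ}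
    (A : Matrix (Fin k) ι K) : ℝ :=
  ‖fun J : Fin k → ι => (A.submatrix id J).det‖

variable {K ι : Type*} [NormedField K] [Fintype ι] {k : ℕ}

lemma minorNorm_nonneg (A : Matrix (Fin k) ι K) : 0 ≤ minorNorm A := norm_nonneg _

lemma norm_det_submatrix_le_minorNorm (A : Matrix (Fin k) ι K) (J : Fin k → ι) :
    ‖(A.submatrix id J).det‖ ≤ minorNorm A :=
  norm_le_pi_norm (fun J : Fin k → ι => (A.submatrix id J).det) J

lemma minorNorm_mul (M : Matrix (Fin k) (Fin k) K) (A : Matrix (Fin k) ι K) :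
    minorNorm (M * A) = ‖M.det‖ * minorNorm A := by
  rw [minorNorm, minorNorm, ← norm_smul]
  congr 1
  ext J
  rw [Pi.smul_apply, smul_eq_mul, ← Matrix.det_mul]
  rfl

lemma minorNorm_fin_zero (A : Matrix (Fin 0) ι K) : minorNorm A = 1 := by
  simp [minorNorm, Pi.norm_def]

lemma minorNorm_vecCons_le (v : ι → K) (A : Matrix (Fin k) ι K) :
    minorNorm (Matrix.of (Matrix.vecCons v A)) ≤ (k + 1) * ‖v‖ * minorNorm A := by
  have h0 : 0 ≤ ‖v‖ * minorNorm A := mul_nonneg (norm_nonneg _) (minorNorm_nonneg _)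
  refine (pi_norm_le_iff_of_nonneg (by rw [mul_assoc]; positivity)).2 fun J => ?_
  rw [Matrix.det_succ_row_zero]
  calc _ ≤ ∑ j : Fin (k + 1), ‖v‖ * minorNorm A := by
        refine norm_sum_le_of_le _ fun j _ => ?_
        rw [norm_mul, norm_mul, norm_pow, norm_neg, norm_one, one_pow, one_mul]
        exact mul_le_mul (norm_le_pi_norm v (J j))
          (norm_det_submatrix_le_minorNorm A fun l => J (j.succAbove l)) (norm_nonneg _)
          (norm_nonneg _)
    _ = (k + 1) * ‖v‖ * minorNorm A := by
        rw [Finset.sum_const, Finset.card_univ, Fintype.card_fin, nsmul_eq_mul, mul_assoc]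
        push_cast
        rfl

/-- A form of the Cauchy–Binet formula with a sum over all functions. -/
lemma det_mul_submatrix_eq_sum {R κ : Type*} [CommRing R] [DecidableEq ι]
    (A : Matrix (Fin k) ι R) (E : Matrix ι κ R) (I : Fin k → κ) :
    ((A * E).submatrix id I).det =
      ∑ J : Fin k → ι, (∏ b, E (J b) (I b)) * (A.submatrix id J).det := by
  rw [← Matrix.det_transpose]
  have h : ((A * E).submatrix id I).transpose = fun b => ∑ c : ι, E c (I b) • fun a => A a c := by
    ext b a
    simp [Matrix.mul_apply, mul_comm]
  rw [h]
  change Matrix.detRowAlternating.toMultilinearMap (fun b => ∑ c : ι, E c (I b) • fun a => A a c) = _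
  rw [MultilinearMap.map_sum]
  refine Finset.sum_congr rfl fun J _ => ?_
  rw [MultilinearMap.map_smul_univ, smul_eq_mul, ← Matrix.det_transpose (A.submatrix id J)]
  rfl

end Minors

section HasseMatrix

variable {n k : ℕ}

/-- The integer polynomial with the given vector of coefficients. -/
noncomputable def polyOfCoeffs (v : Fin (n + 1) → ℤ) : ℤ[X] := ∑ c, C (v c) * X ^ (c : ℕ)

lemma coeff_polyOfCoeffs (v : Fin (n + 1) → ℤ) (c : Fin (n + 1)) :
    (polyOfCoeffs v).coeff c = v c := by
  simp [polyOfCoeffs, finsetSum_coeff, coeff_X_pow, Fin.val_inj]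

lemma natDegree_polyOfCoeffs_le (v : Fin (n + 1) → ℤ) : (polyOfCoeffs v).natDegree ≤ n :=
  natDegree_sum_le_of_forall_le _ _ fun c _ => (natDegree_C_mul_X_pow_le _ _).trans c.is_le

/-- The matrix of Hasse derivatives of the monomials. -/
noncomputable def hasseMatrix (n : ℕ) : Matrix (Fin (n + 1)) (Fin (n + 1)) ℤ[X] :=
  Matrix.of fun c i => C (((c : ℕ).choose i : ℕ) : ℤ) * X ^ ((c : ℕ) - i)

lemma hasseDeriv_polyOfCoeffs (v : Fin (n + 1) → ℤ) (i : Fin (n + 1)) :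
    hasseDeriv (i : ℕ) (polyOfCoeffs v) = ∑ c, C (v c) * hasseMatrix n c i := by
  rw [polyOfCoeffs, map_sum]
  refine Finset.sum_congr rfl fun c _ => ?_
  rw [C_mul_X_pow_eq_monomial, hasseDeriv_monomial, hasseMatrix, Matrix.of_apply, ← mul_assoc,
    ← C_mul, C_mul_X_pow_eq_monomial, mul_comm]

/-- The polynomials giving the maximal minors of the matrix of Hasse derivatives of the
polynomials with coefficient vectors the rows of `A`. -/
noncomputable def minorPoly (A : Matrix (Fin k) (Fin (n + 1)) ℤ) (I : Fin k → Fin (n + 1)) :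
    ℤ[X] :=
  ((A.map (C : ℤ → ℤ[X]) * hasseMatrix n).submatrix id I).det

lemma minorPoly_eq_sum (A : Matrix (Fin k) (Fin (n + 1)) ℤ) (I : Fin k → Fin (n + 1)) :
    minorPoly A I = ∑ J : Fin k → Fin (n + 1),
      C ((A.submatrix id J).det * ∏ b, (((J b : ℕ).choose (I b) : ℕ) : ℤ)) *
        X ^ (∑ b, ((J b : ℕ) - I b)) := by
  rw [minorPoly, det_mul_submatrix_eq_sum]
  refine Finset.sum_congr rfl fun J _ => ?_
  have h : ((A.map (C : ℤ → ℤ[X])).submatrix id J).det = C (A.submatrix id J).det := by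
    rw [RingHom.map_det]
    rfl
  rw [h, C_mul, map_prod, ← Finset.prod_pow_eq_pow_sum, mul_comm, mul_assoc,
    ← Finset.prod_mul_distrib]
  rfl

lemma natDegree_minorPoly_le (A : Matrix (Fin k) (Fin (n + 1)) ℤ) (I : Fin k → Fin (n + 1)) :
    (minorPoly A I).natDegree ≤ k * n := by
  rw [minorPoly_eq_sum]
  refine natDegree_sum_le_of_forall_le _ _ fun J _ => (natDegree_C_mul_X_pow_le _ _).trans ?_
  calc ∑ b, ((J b : ℕ) - I b) ≤ ∑ b : Fin k, n := Finset.sum_le_sum fun b _ => by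
        have := (J b).is_le
        lia
    _ = k * n := by simp

lemma abs_coeff_minorPoly_le (A : Matrix (Fin k) (Fin (n + 1)) ℤ) (I : Fin k → Fin (n + 1))
    (j : ℕ) : |((minorPoly A I).coeff j : ℝ)| ≤
      ((n + 1) ^ k * (2 ^ n) ^ k : ℕ) * minorNorm (A.map (Int.cast : ℤ → ℝ)) := by
  rw [minorPoly_eq_sum, finsetSum_coeff, Int.cast_sum]
  calc _ ≤ ∑ J : Fin k → Fin (n + 1),
        minorNorm (A.map (Int.cast : ℤ → ℝ)) * ((2 ^ n) ^ k : ℕ) := by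
        refine (Finset.abs_sum_le_sum_abs _ _).trans (Finset.sum_le_sum fun J _ => ?_)
        rw [coeff_C_mul, coeff_X_pow]
        have h1 : |((A.submatrix id J).det : ℝ)| ≤ minorNorm (A.map (Int.cast : ℤ → ℝ)) := by
          refine le_trans (le_of_eq ?_) (norm_det_submatrix_le_minorNorm _ J)
          rw [Real.norm_eq_abs, Int.cast_det]
          rfl
        have h2 : ∏ b, (J b : ℕ).choose (I b) ≤ (2 ^ n) ^ k := by
          calc ∏ b, (J b : ℕ).choose (I b) ≤ ∏ b : Fin k, 2 ^ n :=
                Finset.prod_le_prod' fun b _ => (Nat.choose_le_two_pow _ _).trans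
                  (Nat.pow_le_pow_right two_pos (J b).is_le)
            _ = (2 ^ n) ^ k := by simp
        have h3 : |((∏ b, (((J b : ℕ).choose (I b) : ℕ) : ℤ) : ℤ) : ℝ)| ≤ ((2 ^ n) ^ k : ℕ) := by
          rw [← Nat.cast_prod, Int.cast_natCast, abs_of_nonneg (Nat.cast_nonneg _)]
          exact_mod_cast h2
        split_ifs
        · rw [mul_one, Int.cast_mul, abs_mul]
          exact mul_le_mul h1 h3 (abs_nonneg _) (minorNorm_nonneg _)
        · rw [mul_zero, Int.cast_zero, abs_zero]
          exact mul_nonneg (minorNorm_nonneg _) (Nat.cast_nonneg _)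
    _ = _ := by
        rw [Finset.sum_const, Finset.card_univ, Fintype.card_fun, Fintype.card_fin,
          Fintype.card_fin, nsmul_eq_mul]
        push_cast
        ring

lemma minorPoly_castLE_ne_zero (A : Matrix (Fin k) (Fin (n + 1)) ℤ) (hk : k ≤ n + 1)
    (hA : LinearIndependent ℚ fun a => fun c => (A a c : ℚ)) :
    minorPoly A (Fin.castLE hk) ≠ 0 := by
  have hW : minorPoly A (Fin.castLE hk) = (wronskianMatrix fun a => polyOfCoeffs (A a)).det := by
    rw [minorPoly]
    congr 1
    ext1 a i
    exact (hasseDeriv_polyOfCoeffs (A a) (Fin.castLE hk i)).symm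
  have hli : LinearIndependent ℚ fun a => (polyOfCoeffs (A a)).map (Int.castRingHom ℚ) := by
    rw [Fintype.linearIndependent_iff] at hA ⊢
    intro g hg
    refine hA g (funext fun c => ?_)
    have := congrArg (fun f : ℚ[X] => f.coeff c) hg
    simpa [finsetSum_coeff, coeff_polyOfCoeffs] using this
  have h := det_wronskianMatrix_ne_zero _ hli
  have hmap : (wronskianMatrix fun a => (polyOfCoeffs (A a)).map (Int.castRingHom ℚ)).det =
      (wronskianMatrix fun a => polyOfCoeffs (A a)).det.map (Int.castRingHom ℚ) := by
    rw [← coe_mapRingHom, RingHom.map_det]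
    congr 1
    ext1 a i
    ext j
    simp [wronskianMatrix, hasseDeriv_coeff]
  rw [hW]
  intro h0
  rw [hmap, h0, Polynomial.map_zero] at h
  exact h rfl

end HasseMatrix

section Covolume

variable {p : ℕ} [Fact p.Prime] {n k : ℕ}

lemma one_le_abs_mul_norm_intCast {d : ℤ} (hd : d ≠ 0) : 1 ≤ |(d : ℝ)| * ‖(d : ℚ_[p])‖ := by
  have hp : (0 : ℝ) < p := prime_cast_pos
  have hd' : (d : ℚ_[p]) ≠ 0 := Int.cast_ne_zero.2 hd
  have hv : ‖(d : ℚ_[p])‖ = (p : ℝ) ^ (-((padicValInt p d : ℕ) : ℤ)) := by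
    rw [Padic.norm_eq_zpow_neg_valuation hd', Padic.valuation_intCast]
  have hdvd : ((p ^ padicValInt p d : ℕ) : ℤ) ∣ d :=
    (Padic.norm_int_le_pow_iff_dvd d _).1 hv.le
  have hle : ((p : ℝ) ^ padicValInt p d) ≤ |(d : ℝ)| := by
    have := Int.le_of_dvd (abs_pos.2 hd) ((dvd_abs _ _).2 hdvd)
    exact_mod_cast this
  rw [hv, zpow_neg, zpow_natCast, ← div_eq_mul_inv, one_le_div (by positivity)]
  exact hle

/-- The matrix of Hasse derivatives of the monomials at `x`, with the `i`-th column multiplied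
by `p ^ (-m i)`. -/
noncomputable def scaledHasse (m : Fin (n + 1) → ℕ) (x : ℚ_[p]) :
    Matrix (Fin (n + 1)) (Fin (n + 1)) ℚ_[p] :=
  Matrix.of fun c i => (p : ℚ_[p]) ^ (-(m i : ℤ)) * aeval x (hasseMatrix n c i)

/-- The Hasse derivatives at `x` of the polynomial with coefficient vector `v`, the `i`-th one
being multiplied by `p ^ (-m i)`. -/
noncomputable def scaledEval (m : Fin (n + 1) → ℕ) (x : ℚ_[p]) (v : Fin (n + 1) → ℤ) :
    Fin (n + 1) → ℚ_[p] :=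
  Matrix.vecMul (fun c => (v c : ℚ_[p])) (scaledHasse m x)

lemma scaledEval_apply (m : Fin (n + 1) → ℕ) (x : ℚ_[p]) (v : Fin (n + 1) → ℤ)
    (i : Fin (n + 1)) : scaledEval m x v i =
      (p : ℚ_[p]) ^ (-(m i : ℤ)) * aeval x (hasseDeriv (i : ℕ) (polyOfCoeffs v)) := by
  rw [hasseDeriv_polyOfCoeffs, map_sum, Finset.mul_sum, scaledEval, Matrix.vecMul, dotProduct]
  refine Finset.sum_congr rfl fun c _ => ?_
  rw [scaledHasse, Matrix.of_apply, map_mul, aeval_C, algebraMap_int_eq, eq_intCast, mul_left_comm]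

lemma det_mul_scaledHasse_submatrix (m : Fin (n + 1) → ℕ) (x : ℚ_[p])
    (A : Matrix (Fin k) (Fin (n + 1)) ℤ) (I : Fin k → Fin (n + 1)) :
    ((A.map (Int.cast : ℤ → ℚ_[p]) * scaledHasse m x).submatrix id I).det =
      (∏ b, (p : ℚ_[p]) ^ (-(m (I b) : ℤ))) * aeval x (minorPoly A I) := by
  rw [minorPoly, AlgHom.map_det, ← Matrix.det_mul_row]
  congr 1
  ext a b
  simp only [Matrix.submatrix_apply, Matrix.mul_apply, Matrix.map_apply, scaledHasse,
    Matrix.of_apply, AlgHom.mapMatrix_apply, id_eq, map_sum, map_mul, Finset.mul_sum]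
  refine Finset.sum_congr rfl fun c _ => ?_
  rw [mul_left_comm, aeval_C, algebraMap_int_eq, eq_intCast]

/-- The normalized covolume of the discrete subgroup spanned by the rows of `A` embedded in
`ℝ ^ (n + 1) × ℚ_p ^ (n + 1)`. -/
noncomputable def covol (Q : ℝ) (m : Fin (n + 1) → ℕ) (A : Matrix (Fin k) (Fin (n + 1)) ℤ)
    (x : ℚ_[p]) : ℝ :=
  (Q ^ k)⁻¹ * minorNorm (A.map (Int.cast : ℤ → ℝ)) *
    minorNorm (A.map (Int.cast : ℤ → ℚ_[p]) * scaledHasse m x)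

variable {Q : ℝ} {m : Fin (n + 1) → ℕ}

lemma covol_fin_zero (A : Matrix (Fin 0) (Fin (n + 1)) ℤ) (x : ℚ_[p]) : covol Q m A x = 1 := by
  simp [covol, minorNorm_fin_zero]

lemma covol_nonneg (hQ : 0 ≤ Q) (A : Matrix (Fin k) (Fin (n + 1)) ℤ) (x : ℚ_[p]) :
    0 ≤ covol Q m A x :=
  mul_nonneg (mul_nonneg (by positivity) (minorNorm_nonneg _)) (minorNorm_nonneg _)

lemma covol_le_covol_mul (hQ : 0 ≤ Q) (A : Matrix (Fin k) (Fin (n + 1)) ℤ)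
    {M : Matrix (Fin k) (Fin k) ℤ} (hM : M.det ≠ 0) (x : ℚ_[p]) :
    covol Q m A x ≤ covol Q m (M * A) x := by
  have hR : ((M * A).map (Int.cast : ℤ → ℝ)) =
      M.map (Int.cast : ℤ → ℝ) * A.map (Int.cast : ℤ → ℝ) := Matrix.map_mul (f := Int.castRingHom ℝ)
  have hp : ((M * A).map (Int.cast : ℤ → ℚ_[p])) =
      M.map (Int.cast : ℤ → ℚ_[p]) * A.map (Int.cast : ℤ → ℚ_[p]) := Matrix.map_mul (f := Int.castRingHom ℚ_[p])
  have h := mul_le_mul_of_nonneg_left (one_le_abs_mul_norm_intCast (p := p) hM)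
    (covol_nonneg (m := m) hQ A x)
  rw [mul_one] at h
  refine h.trans_eq ?_
  rw [covol, covol, hR, hp, Matrix.mul_assoc, minorNorm_mul, minorNorm_mul, Real.norm_eq_abs,
    Int.cast_det, Int.cast_det]
  simp only [Matrix.map]
  ring

lemma covol_vecCons_le (hQ : 0 < Q) (A : Matrix (Fin k) (Fin (n + 1)) ℤ) (v : Fin (n + 1) → ℤ)
    (x : ℚ_[p]) : covol Q m (Matrix.of (Matrix.vecCons v A)) x ≤
      (k + 1) ^ 2 * Q⁻¹ * ‖v‖ * ‖scaledEval m x v‖ * covol Q m A x := by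
  have hcast {K : Type} [NormedField K] :
      (Matrix.of (Matrix.vecCons v A)).map (Int.cast : ℤ → K) =
        Matrix.of (Matrix.vecCons (fun c => (v c : K)) (A.map (Int.cast : ℤ → K))) := by
    ext a c
    refine Fin.cases ?_ (fun a => ?_) a <;> rfl
  have hR := minorNorm_vecCons_le (fun c => (v c : ℝ)) (A.map (Int.cast : ℤ → ℝ))
  have hp := minorNorm_vecCons_le (scaledEval m x v)
    (A.map (Int.cast : ℤ → ℚ_[p]) * scaledHasse m x)
  have hmul : Matrix.of (Matrix.vecCons (fun c => (v c : ℚ_[p])) (A.map Int.cast)) *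
      scaledHasse m x = Matrix.of (Matrix.vecCons (scaledEval m x v)
        (A.map Int.cast * scaledHasse m x)) := Matrix.cons_mul _ _ _
  have hv : ‖fun c => (v c : ℝ)‖ = ‖v‖ := by
    rw [Pi.norm_def, Pi.norm_def]
    rfl
  rw [hv] at hR
  rw [covol, hcast, hcast, hmul]
  calc _ ≤ (Q ^ (k + 1))⁻¹ * ((k + 1) * ‖v‖ * minorNorm (A.map (Int.cast : ℤ → ℝ))) *
        ((k + 1) * ‖scaledEval m x v‖ *
          minorNorm (A.map (Int.cast : ℤ → ℚ_[p]) * scaledHasse m x)) := by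
        have := minorNorm_nonneg (A.map (Int.cast : ℤ → ℝ))
        exact mul_le_mul (mul_le_mul_of_nonneg_left hR (by positivity)) hp (minorNorm_nonneg _)
          (by positivity)
    _ = _ := by
        rw [covol, pow_succ, mul_inv]
        ring

lemma continuous_covol (A : Matrix (Fin k) (Fin (n + 1)) ℤ) :
    Continuous fun x : ℚ_[p] => covol Q m A x := by
  refine continuous_const.mul (Continuous.norm (continuous_pi fun I => ?_))
  simp only [det_mul_scaledHasse_submatrix]
  exact continuous_const.mul (Polynomial.continuous_aeval _)

lemma exists_minorNorm_eq {K ι : Type*} [NormedField K] [Fintype ι] [Nonempty ι]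
    (A : Matrix (Fin k) ι K) : ∃ J, minorNorm A = ‖(A.submatrix id J).det‖ := by
  obtain ⟨J, hJ⟩ := Finite.exists_max fun J : Fin k → ι => ‖(A.submatrix id J).det‖
  exact ⟨J, le_antisymm ((pi_norm_le_iff_of_nonneg (norm_nonneg _)).2 hJ)
    (norm_det_submatrix_le_minorNorm A J)⟩

lemma measure_covol_lt_le (μ : Measure ℚ_[p]) [μ.IsAddHaarMeasure] (hQ : 0 < Q)
    (A : Matrix (Fin k) (Fin (n + 1)) ℤ) (hk : k ≤ n + 1) (a : ℚ_[p]) (l : ℤ) (j : ℕ)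
    {y : ℚ_[p]} (hy : y ∈ padicBall a l) (h : 1 ≤ covol Q m A y) :
    μ {x ∈ padicBall a l | covol Q m A x < (p : ℝ) ^ (-(j * ((n + 1) * n : ℕ) : ℤ))} ≤
      ((n + 1) * n : ℕ) * (p : ENNReal)⁻¹ ^ j * μ (padicBall a l) := by
  obtain ⟨I, hI⟩ := exists_minorNorm_eq (A.map (Int.cast : ℤ → ℚ_[p]) * scaledHasse m y)
  set f : ℚ_[p][X] := (minorPoly A I).map (Int.castRingHom ℚ_[p]) with hf
  have hfe (x : ℚ_[p]) : f.eval x = aeval x (minorPoly A I) := by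
    rw [hf, eval_map, aeval_def]
    rfl
  have hdeg : f.natDegree ≤ (n + 1) * n :=
    natDegree_map_le.trans ((natDegree_minorPoly_le A I).trans (Nat.mul_le_mul_right n hk))
  set c : ℝ := (Q ^ k)⁻¹ * minorNorm (A.map (Int.cast : ℤ → ℝ)) *
    ‖∏ b, (p : ℚ_[p]) ^ (-(m (I b) : ℤ))‖ with hc
  have hc0 : 0 ≤ c := mul_nonneg (mul_nonneg (by positivity) (minorNorm_nonneg _)) (norm_nonneg _)
  have hcy : 1 ≤ c * ‖f.eval y‖ := by
    rwa [covol, hI, det_mul_scaledHasse_submatrix, norm_mul, ← mul_assoc, ← hfe] at h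
  have hcpos : 0 < c := hc0.lt_of_ne fun h0 => by
    rw [← h0, zero_mul] at hcy
    linarith
  have hM : c⁻¹ ≤ ‖f.eval y‖ := by
    rwa [inv_le_iff_one_le_mul₀' hcpos]
  refine le_trans (measure_mono ?_) (measure_eval_lt_le μ hdeg a l j hy hM)
  intro x hx
  refine ⟨hx.1, ?_⟩
  rw [← div_eq_mul_inv, lt_div_iff₀' hcpos]
  refine lt_of_le_of_lt ?_ hx.2
  have := norm_det_submatrix_le_minorNorm (A.map (Int.cast : ℤ → ℚ_[p]) * scaledHasse m x) I
  rw [det_mul_scaledHasse_submatrix, norm_mul] at this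
  rw [hc, hfe, mul_assoc, covol]
  exact mul_le_mul_of_nonneg_left this (mul_nonneg (by positivity) (minorNorm_nonneg _))

end Covolume

section CovolumeLowerBound

variable {p : ℕ} [Fact p.Prime] {n k : ℕ} {Q : ℝ} {m : Fin (n + 1) → ℕ}

lemma prod_range_pow_le_prod_range_pow {ξ : ℕ → ℝ} (h0 : ∀ i, 0 ≤ ξ i) (h : Monotone ξ)
    {k n : ℕ} (hkn : k ≤ n) :
    (∏ i ∈ Finset.range k, ξ i) ^ n ≤ (∏ i ∈ Finset.range n, ξ i) ^ k := by
  induction n, hkn using Nat.le_induction with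
  | base => exact le_rfl
  | succ n hkn ih =>
    rw [pow_succ, Finset.prod_range_succ, mul_pow]
    refine mul_le_mul ih ?_ (Finset.prod_nonneg fun i _ => h0 i)
      (pow_nonneg (Finset.prod_nonneg fun i _ => h0 i) _)
    calc ∏ i ∈ Finset.range k, ξ i ≤ ∏ i ∈ Finset.range k, ξ n :=
          Finset.prod_le_prod (fun i _ => h0 i) fun i hi =>
            h ((Finset.mem_range.1 hi).le.trans hkn)
      _ = ξ n ^ k := by simp

lemma le_covol (hQ : 0 ≤ Q) (A : Matrix (Fin k) (Fin (n + 1)) ℤ) (I : Fin k → Fin (n + 1))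
    (x : ℚ_[p]) : (Q ^ k)⁻¹ * minorNorm (A.map (Int.cast : ℤ → ℝ)) *
      ((∏ b, (p : ℝ) ^ m (I b)) * ‖aeval x (minorPoly A I)‖) ≤ covol Q m A x := by
  have h := norm_det_submatrix_le_minorNorm (A.map (Int.cast : ℤ → ℚ_[p]) * scaledHasse m x) I
  rw [det_mul_scaledHasse_submatrix, norm_mul, norm_prod] at h
  simp only [Padic.norm_p_zpow, neg_neg, zpow_natCast] at h
  exact mul_le_mul_of_nonneg_left h (mul_nonneg (by positivity) (minorNorm_nonneg _))

lemma det_hasseMatrix (n : ℕ) : (hasseMatrix n).det = 1 := by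
  rw [Matrix.det_of_isLowerTriangular]
  · simp [hasseMatrix]
  · intro c i hci
    have : (c : ℕ) < i := hci
    simp [hasseMatrix, Nat.choose_eq_zero_of_lt this]

lemma one_le_covol_of_square (hQ : 0 < Q) (hm : Q ^ (n + 1) ≤ ∏ i, (p : ℝ) ^ m i)
    (A : Matrix (Fin (n + 1)) (Fin (n + 1)) ℤ) (hA : A.det ≠ 0) (x : ℚ_[p]) :
    1 ≤ covol Q m A x := by
  have hW : aeval x (minorPoly A id) = (A.det : ℚ_[p]) := by
    rw [minorPoly, Matrix.submatrix_id_id, Matrix.det_mul, det_hasseMatrix, mul_one,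
      ← RingHom.mapMatrix_apply, ← RingHom.map_det, aeval_C, algebraMap_int_eq, eq_intCast]
  have hN : |(A.det : ℝ)| ≤ minorNorm (A.map (Int.cast : ℤ → ℝ)) := by
    refine le_trans (le_of_eq ?_) (norm_det_submatrix_le_minorNorm _ id)
    rw [Real.norm_eq_abs, Int.cast_det]
    rfl
  refine le_trans ?_ (le_covol hQ.le A id x)
  rw [hW]
  calc (1 : ℝ) ≤ |(A.det : ℝ)| * ‖(A.det : ℚ_[p])‖ := one_le_abs_mul_norm_intCast hA
    _ = (Q ^ (n + 1))⁻¹ * |(A.det : ℝ)| * (Q ^ (n + 1) * ‖(A.det : ℚ_[p])‖) := by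
        field_simp
    _ ≤ _ := by
        have := minorNorm_nonneg (A.map (Int.cast : ℤ → ℝ))
        simp only [id_eq]
        gcongr

lemma exists_one_le_covol (a : ℚ_[p]) (l : ℤ) (hn : n ≠ 0) :
    ∃ Q₀ : ℝ, 1 ≤ Q₀ ∧ ∀ Q : ℝ, Q₀ ≤ Q → ∀ (ξ : ℕ → ℝ), (∀ i, 0 < ξ i) → Monotone ξ →
      ξ n = 1 → (∏ i ∈ Finset.range (n + 1), ξ i) = (Q ^ (n + 1))⁻¹ →
      ∀ m : Fin (n + 1) → ℕ, (∀ i, ((p : ℝ) ^ m i)⁻¹ ≤ ξ i) →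
      ∀ (k : ℕ) (A : Matrix (Fin k) (Fin (n + 1)) ℤ),
        (LinearIndependent ℚ fun a => fun c => (A a c : ℚ)) →
        ∃ y ∈ padicBall a l, 1 ≤ covol Q m A y := by
  have hp0 : (0 : ℝ) < p := prime_cast_pos
  obtain ⟨c, hc, hcoeff⟩ := exists_mul_norm_coeff_le_norm_eval a l ((n + 1) * n)
  set D : ℝ := (((n + 1) ^ (n + 1) * (2 ^ n) ^ (n + 1) : ℕ) : ℝ) with hD
  have hD0 : 0 < D := by rw [hD]; positivity
  refine ⟨max 1 ((c / D) ^ n)⁻¹, le_max_left _ _, ?_⟩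
  intro Q hQ ξ hξ0 hξ hξn hprod m hm k A hA
  have hQ1 : 1 ≤ Q := (le_max_left _ _).trans hQ
  have hQ0 : 0 < Q := one_pos.trans_le hQ1
  have hpm (i : Fin (n + 1)) : (ξ i)⁻¹ ≤ (p : ℝ) ^ m i := inv_le_of_inv_le₀ (by positivity) (hm i)
  have hk : k ≤ n + 1 := by simpa using hA.fintype_card_le_finrank
  rcases Nat.eq_zero_or_pos k with rfl | hk0
  · exact ⟨a, mem_padicBall_self a l, (covol_fin_zero A a).ge⟩
  rcases hk.eq_or_lt with rfl | hkn
  · refine ⟨a, mem_padicBall_self a l, one_le_covol_of_square hQ0 ?_ A ?_ a⟩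
    · rw [← inv_inv (Q ^ (n + 1)), ← hprod, Finset.prod_range, ← Finset.prod_inv_distrib]
      exact Finset.prod_le_prod (fun i _ => (inv_pos.2 (hξ0 i)).le) fun i _ => hpm i
    · have := (Matrix.linearIndependent_rows_iff_isUnit (A := A.map (Int.cast : ℤ → ℚ))).1 hA
      rw [Matrix.isUnit_iff_isUnit_det, isUnit_iff_ne_zero] at this
      intro h0
      refine this ?_
      have := Int.cast_det (R := ℚ) A
      rw [h0, Int.cast_zero] at this
      exact this.symm
  have hkn : k ≤ n := Nat.le_of_lt_succ hkn
  set X : ℝ := Q ^ k * ∏ i ∈ Finset.range k, ξ i with hX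
  have hX0 : 0 < X := mul_pos (by positivity) (Finset.prod_pos fun i _ => hξ0 i)
  have hXn : X ^ n ≤ Q⁻¹ := by
    rw [Finset.prod_range_succ, hξn, mul_one] at hprod
    calc X ^ n ≤ (Q ^ k) ^ n * (∏ i ∈ Finset.range n, ξ i) ^ k := by
          rw [hX, mul_pow]
          exact mul_le_mul_of_nonneg_left
            (prod_range_pow_le_prod_range_pow (fun i => (hξ0 i).le) hξ hkn) (by positivity)
      _ = (Q ^ k)⁻¹ := by
          have : (Q ^ (n + 1)) ^ k = (Q ^ k) ^ n * Q ^ k := by ring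
          rw [hprod, inv_pow, this]
          field_simp
      _ ≤ Q⁻¹ := inv_anti₀ hQ0 (le_self_pow₀ hQ1 hk0.ne')
  have hXD : X ≤ c / D := by
    refine (pow_le_pow_iff_left₀ hX0.le (by positivity) hn).1 (hXn.trans ?_)
    exact inv_le_of_inv_le₀ (by positivity) ((le_max_right _ _).trans hQ)
  set W := minorPoly A (Fin.castLE hk) with hW
  obtain ⟨i, hi⟩ : ∃ i, W.coeff i ≠ 0 := by
    by_contra! h0
    exact minorPoly_castLE_ne_zero A hk hA (Polynomial.ext fun i => by simpa using h0 i)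
  set N := minorNorm (A.map (Int.cast : ℤ → ℝ)) with hN
  have hwN : |(W.coeff i : ℝ)| ≤ D * N := by
    refine (abs_coeff_minorPoly_le A (Fin.castLE hk) i).trans ?_
    refine mul_le_mul_of_nonneg_right ?_ (minorNorm_nonneg _)
    rw [hD, Nat.cast_le]
    gcongr
    · lia
    · exact Nat.one_le_two_pow
  have hN0 : 0 < N := by
    have := (abs_pos.2 (Int.cast_ne_zero.2 hi)).trans_le hwN
    exact pos_of_mul_pos_right this hD0.le
  obtain ⟨y, hy, hWy⟩ := hcoeff (W.map (Int.castRingHom ℚ_[p]))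
    (natDegree_map_le.trans ((natDegree_minorPoly_le A _).trans (Nat.mul_le_mul_right n hk))) i
  refine ⟨y, hy, le_trans ?_ (le_covol hQ0.le A (Fin.castLE hk) y)⟩
  have hWy' : c / (D * N) ≤ ‖aeval y W‖ := by
    rw [eval_map, coeff_map, eq_intCast] at hWy
    refine le_trans ?_ hWy
    rw [div_le_iff₀ (by positivity), mul_assoc]
    refine le_mul_of_one_le_right hc.le ?_
    rw [mul_comm]
    exact (one_le_abs_mul_norm_intCast hi).trans
      (mul_le_mul_of_nonneg_right hwN (norm_nonneg _))
  have hprodm : (∏ i ∈ Finset.range k, ξ i)⁻¹ ≤ ∏ b : Fin k, (p : ℝ) ^ m (Fin.castLE hk b) := by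
    rw [Finset.prod_range, ← Finset.prod_inv_distrib]
    exact Finset.prod_le_prod (fun i _ => (inv_pos.2 (hξ0 i)).le) fun b _ =>
      hpm (Fin.castLE hk b)
  calc (1 : ℝ) ≤ X⁻¹ * (c / D) := by
        rwa [inv_mul_eq_div, one_le_div hX0]
    _ = (Q ^ k)⁻¹ * N * ((∏ i ∈ Finset.range k, ξ i)⁻¹ * (c / (D * N))) := by
        rw [hX]
        field_simp
    _ ≤ _ := by gcongr

end CovolumeLowerBound

section RationalSubspaces

variable {n : ℕ}

lemma exists_integer_basis (V : Submodule ℚ (Fin (n + 1) → ℚ)) :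
    ∃ A : Matrix (Fin (Module.finrank ℚ V)) (Fin (n + 1)) ℤ,
      (LinearIndependent ℚ fun a => fun c => (A a c : ℚ)) ∧
      (∀ a, (fun c => (A a c : ℚ)) ∈ V) ∧
      ∀ w : Fin (n + 1) → ℤ, (fun c => (w c : ℚ)) ∈ V → ∃ z, w = Matrix.vecMul z A := by
  let φ : (Fin (n + 1) → ℤ) →ₗ[ℤ] (Fin (n + 1) → ℚ) :=
    (Int.castAddHom ℚ).toIntLinearMap.compLeft (Fin (n + 1))
  have hφ : Function.Injective φ := fun v w h => funext fun c =>
    Int.cast_injective (α := ℚ) (congrFun h c)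
  obtain ⟨k, b⟩ := Submodule.basisOfPid (Pi.basisFun ℤ (Fin (n + 1)))
    ((V.restrictScalars ℤ).comap φ)
  have hli : LinearIndependent ℚ fun a => φ (b a) := by
    refine (LinearIndependent.iff_fractionRing ℤ ℚ).1 ?_
    exact (b.linearIndependent.map' (Submodule.subtype _) (Submodule.ker_subtype _)).map' φ
      (LinearMap.ker_eq_bot.2 hφ)
  have hmem (a : Fin k) : φ (b a) ∈ V := (b a).2
  have hspan : Submodule.span ℚ (Set.range fun a => φ (b a)) = V := by
    refine le_antisymm (Submodule.span_le.2 (Set.range_subset_iff.2 hmem)) fun v hv => ?_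
    obtain ⟨d, hd⟩ := IsLocalization.exist_integer_multiples_of_finite (nonZeroDivisors ℤ) v
    choose w hw using hd
    have hd0 : ((d : ℤ) : ℚ) ≠ 0 := Int.cast_ne_zero.2 (nonZeroDivisors.coe_ne_zero d)
    have hdw : ((d : ℤ) : ℚ) • v = φ w := by
      ext c
      have := hw c
      rw [zsmul_eq_mul] at this
      exact this.symm
    have hwV : φ w ∈ V := hdw ▸ V.smul_mem _ hv
    have hw' : φ w ∈ Submodule.span ℚ (Set.range fun a => φ (b a)) := by
      have h := b.sum_repr (⟨w, hwV⟩ : (V.restrictScalars ℤ).comap φ)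
      have h' := congrArg (fun u : (V.restrictScalars ℤ).comap φ => φ u) h
      simp only [Submodule.coe_sum, Submodule.coe_smul, map_sum, map_smul] at h'
      rw [← h']
      refine Submodule.sum_mem _ fun a _ => ?_
      rw [← Int.cast_smul_eq_zsmul ℚ]
      exact Submodule.smul_mem _ _ (Submodule.subset_span ⟨a, rfl⟩)
    rw [← hdw] at hw'
    exact (Submodule.smul_mem_iff _ hd0).1 hw'
  have hk : Module.finrank ℚ V = k := by
    rw [← hspan, finrank_span_eq_card hli, Fintype.card_fin]
  subst hk
  refine ⟨Matrix.of fun a => (b a : Fin (n + 1) → ℤ), hli, hmem, fun w hw => ?_⟩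
  refine ⟨b.repr ⟨w, hw⟩, ?_⟩
  have h := congrArg (fun u : (V.restrictScalars ℤ).comap φ => (u : Fin (n + 1) → ℤ))
    (b.sum_repr (⟨w, hw⟩ : (V.restrictScalars ℤ).comap φ))
  simp only [Submodule.coe_sum, Submodule.coe_smul] at h
  rw [Matrix.vecMul_eq_sum]
  exact h.symm

/-- A matrix whose rows form a basis of the group of integer points of `V`. -/
noncomputable def latticeBasis (V : Submodule ℚ (Fin (n + 1) → ℚ)) :
    Matrix (Fin (Module.finrank ℚ V)) (Fin (n + 1)) ℤ :=
  (exists_integer_basis V).choose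

lemma linearIndependent_latticeBasis (V : Submodule ℚ (Fin (n + 1) → ℚ)) :
    LinearIndependent ℚ fun a => fun c => (latticeBasis V a c : ℚ) :=
  (exists_integer_basis V).choose_spec.1

lemma latticeBasis_mem (V : Submodule ℚ (Fin (n + 1) → ℚ)) (a) :
    (fun c => (latticeBasis V a c : ℚ)) ∈ V :=
  (exists_integer_basis V).choose_spec.2.1 a

lemma exists_eq_vecMul_latticeBasis {V : Submodule ℚ (Fin (n + 1) → ℚ)} {w : Fin (n + 1) → ℤ}
    (hw : (fun c => (w c : ℚ)) ∈ V) : ∃ z, w = Matrix.vecMul z (latticeBasis V) :=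
  (exists_integer_basis V).choose_spec.2.2 w hw

variable {p : ℕ} [Fact p.Prime] {Q : ℝ} {m : Fin (n + 1) → ℕ}

lemma covol_latticeBasis_le (hQ : 0 ≤ Q) {V : Submodule ℚ (Fin (n + 1) → ℚ)} {k : ℕ}
    (hk : Module.finrank ℚ V = k) (B : Matrix (Fin k) (Fin (n + 1)) ℤ)
    (hli : LinearIndependent ℚ fun a => fun c => (B a c : ℚ))
    (hB : ∀ a, (fun c => (B a c : ℚ)) ∈ V) (x : ℚ_[p]) :
    covol Q m (latticeBasis V) x ≤ covol Q m B x := by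
  subst hk
  choose M hM using fun a => exists_eq_vecMul_latticeBasis (hB a)
  have hBM : B = Matrix.of M * latticeBasis V := by
    ext a c
    exact congrFun (hM a) c
  have hdet : (Matrix.of M).det ≠ 0 := by
    intro h0
    obtain ⟨w, hw0, hw⟩ := Matrix.exists_vecMul_eq_zero_iff.2 h0
    refine hw0 (funext fun a => ?_)
    have hwB : Matrix.vecMul w B = 0 := by
      rw [hBM, ← Matrix.vecMul_vecMul, hw, Matrix.zero_vecMul]
    have := Fintype.linearIndependent_iff.1 hli (fun a => (w a : ℚ)) (funext fun c => ?_) a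
    · exact_mod_cast this
    · have h := congrFun hwB c
      rw [Matrix.vecMul_eq_sum, Finset.sum_apply] at h
      simp only [Pi.smul_apply, smul_eq_mul, Pi.zero_apply, Finset.sum_apply] at h ⊢
      exact_mod_cast h
  rw [hBM]
  exact covol_le_covol_mul hQ _ hdet x

lemma mul_le_norm_of_isMarked (hQ : 0 < Q) {ε : ℝ} {x : ℚ_[p]}
    (hx : IsMarked (fun V x => covol Q m (latticeBasis V) x) ε Set.univ x)
    {v : Fin (n + 1) → ℤ} (hv0 : v ≠ 0) (hv : ‖scaledEval m x v‖ ≤ 1) :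
    ε / (n + 1) ^ 2 * Q ≤ ‖v‖ := by
  obtain ⟨F, -, hF, hlt, hge⟩ := hx
  set w : Fin (n + 1) → ℚ := fun c => (v c : ℚ) with hw
  have hw0 : w ≠ 0 := fun h => hv0 (funext fun c => by simpa [hw] using congrFun h c)
  obtain ⟨s, hws, hs1, hcomp⟩ : ∃ s : Submodule ℚ (Fin (n + 1) → ℚ), w ∉ s ∧
      covol Q m (latticeBasis s) x ≤ 1 ∧
      ∀ f ∈ F, f ≤ s ⊔ Submodule.span ℚ {w} ∨ s ⊔ Submodule.span ℚ {w} ≤ f := by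
    rcases ({s ∈ F | w ∉ s}).eq_empty_or_nonempty with hE | hE
    · refine ⟨⊥, by simpa using hw0, ?_, fun f hf => Or.inr ?_⟩
      · refine (covol_latticeBasis_le hQ.le (finrank_bot ℚ _) (Matrix.of fun a => a.elim0)
          linearIndependent_empty_type (fun a => a.elim0) x).trans ?_
        rw [covol_fin_zero]
      · rw [bot_sup_eq, Submodule.span_singleton_le_iff_mem]
        by_contra h
        exact (Set.eq_empty_iff_forall_notMem.1 hE f) ⟨hf, h⟩
    · obtain ⟨s, ⟨hsF, hws⟩, hmax⟩ := wellFounded_gt.has_min _ hE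
      refine ⟨s, hws, (hlt s hsF).le, fun f hf => ?_⟩
      by_cases hwf : w ∈ f
      · refine Or.inr (sup_le ?_ ((Submodule.span_singleton_le_iff_mem _ _).2 hwf))
        exact (hF.total hsF hf).resolve_right fun h => hws (h hwf)
      · refine Or.inl (le_trans ?_ le_sup_left)
        rcases hF.total hsF hf with h | h
        · by_contra hfs
          exact hmax f ⟨hf, hwf⟩ (lt_of_le_not_ge h hfs)
        · exact h
  set k := Module.finrank ℚ s
  set t := s ⊔ Submodule.span ℚ {w} with ht
  have hli : LinearIndependent ℚ fun a => fun c =>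
      ((Matrix.of (Matrix.vecCons v (latticeBasis s)) a c : ℤ) : ℚ) := by
    have : (fun a => fun c => ((Matrix.of (Matrix.vecCons v (latticeBasis s)) a c : ℤ) : ℚ)) =
        Fin.cons w fun a => fun c => (latticeBasis s a c : ℚ) := by
      ext a c
      refine Fin.cases ?_ (fun a => ?_) a <;> rfl
    rw [this, linearIndependent_finCons]
    refine ⟨linearIndependent_latticeBasis s, fun h => hws ?_⟩
    exact Submodule.span_le.2 (Set.range_subset_iff.2 (latticeBasis_mem s)) h
  have hmem (a) : (fun c => ((Matrix.of (Matrix.vecCons v (latticeBasis s)) a c : ℤ) : ℚ)) ∈ t := by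
    refine Fin.cases ?_ (fun a => ?_) a
    · exact Submodule.mem_sup_right (Submodule.mem_span_singleton_self w)
    · exact Submodule.mem_sup_left (latticeBasis_mem s a)
  have hrank : Module.finrank ℚ t = k + 1 := by
    refine le_antisymm ?_ ?_
    · refine (Submodule.finrank_add_le_finrank_add_finrank _ _).trans ?_
      rw [finrank_span_singleton hw0]
    · have := Submodule.finrank_mono (Submodule.span_le.2 (Set.range_subset_iff.2 hmem))
      rwa [finrank_span_eq_card hli, Fintype.card_fin] at this
  have hkn : k ≤ n := by
    have := Submodule.finrank_lt (s := s) (fun h => hws (h ▸ Submodule.mem_top))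
    rw [Module.finrank_fin_fun] at this
    exact Nat.le_of_lt_succ this
  have h1 : ε ≤ (k + 1) ^ 2 * Q⁻¹ * ‖v‖ * ‖scaledEval m x v‖ * covol Q m (latticeBasis s) x :=
    (hge t (Set.mem_univ _) hcomp).trans ((covol_latticeBasis_le hQ.le hrank _ hli hmem x).trans
      (covol_vecCons_le hQ _ v x))
  have h2 : ε ≤ (n + 1) ^ 2 * Q⁻¹ * ‖v‖ := by
    refine h1.trans ?_
    have hkn' : (k : ℝ) ≤ n := by exact_mod_cast hkn
    have h0 : 0 ≤ covol Q m (latticeBasis s) x := covol_nonneg hQ.le _ x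
    calc _ ≤ ((n : ℝ) + 1) ^ 2 * Q⁻¹ * ‖v‖ * 1 * 1 := by gcongr
      _ = _ := by ring
  rw [div_mul_eq_mul_div, div_le_iff₀ (by positivity)]
  calc ε * Q ≤ (n + 1) ^ 2 * Q⁻¹ * ‖v‖ * Q := mul_le_mul_of_nonneg_right h2 hQ.le
    _ = _ := by field_simp

end RationalSubspaces

section GeometryOfNumbers

variable {p : ℕ} [Fact p.Prime] {n : ℕ} {Q : ℝ} {m : Fin (n + 1) → ℕ}

lemma scaledEval_sub (x : ℚ_[p]) (v w : Fin (n + 1) → ℤ) :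
    scaledEval m x (v - w) = scaledEval m x v - scaledEval m x w := by
  rw [scaledEval, scaledEval, scaledEval, ← Matrix.sub_vecMul]
  congr 1
  ext c
  simp

lemma norm_zpow_mul_le_one_iff (k : ℕ) (y : ℚ_[p]) :
    ‖(p : ℚ_[p]) ^ (-(k : ℤ)) * y‖ ≤ 1 ↔ ‖y‖ ≤ (p : ℝ) ^ (-(k : ℤ)) := by
  have hp : (0 : ℝ) < p := prime_cast_pos
  rw [norm_mul, Padic.norm_p_zpow, neg_neg, zpow_neg, zpow_natCast, ← le_div_iff₀' (by positivity),
    one_div]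

lemma coe_aeval_padicInt (x : ℤ_[p]) (P : ℤ[X]) :
    ((aeval x P : ℤ_[p]) : ℚ_[p]) = aeval (x : ℚ_[p]) P := by
  rw [aeval_def, aeval_def]
  exact hom_eval₂ P (algebraMap ℤ ℤ_[p]) (PadicInt.Coe.ringHom (p := p)) x

/-- The Hasse derivatives at `x` of the polynomial with coefficient vector `v`, reduced modulo
the powers `p ^ m i`. -/
noncomputable def hasseResidue (m : Fin (n + 1) → ℕ) (x : ℤ_[p]) (v : Fin (n + 1) → ℤ)
    (i : Fin (n + 1)) : ZMod (p ^ m i) :=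
  PadicInt.toZModPow (m i) (aeval x (hasseDeriv (i : ℕ) (polyOfCoeffs v)))

lemma norm_scaledEval_sub_le_one {x : ℤ_[p]} {v w : Fin (n + 1) → ℤ}
    (h : hasseResidue m x v = hasseResidue m x w) :
    ‖scaledEval m (x : ℚ_[p]) (v - w)‖ ≤ 1 := by
  refine (pi_norm_le_iff_of_nonneg zero_le_one).2 fun i => ?_
  rw [scaledEval_sub, Pi.sub_apply, scaledEval_apply, scaledEval_apply, ← mul_sub,
    norm_zpow_mul_le_one_iff, ← coe_aeval_padicInt, ← coe_aeval_padicInt, ← PadicInt.coe_sub,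
    ← PadicInt.norm_def, PadicInt.norm_le_pow_iff_mem_span_pow, ← PadicInt.ker_toZModPow,
    RingHom.mem_ker, map_sub, sub_eq_zero]
  exact congrFun h i

lemma abs_natCast_sub_lt_of_div_eq {a b s : ℕ} (hs : 0 < s) (h : a / s = b / s) :
    |(a : ℤ) - b| < s := by
  have h1 := Nat.div_add_mod a s
  have h2 := Nat.div_add_mod b s
  have h3 := Nat.mod_lt a hs
  have h4 := Nat.mod_lt b hs
  rw [h] at h1
  rw [abs_lt]
  constructor <;> lia

/-- A pigeonhole argument producing an integer vector all of whose coordinates, except possibly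
one, are small. -/
lemma exists_ne_zero_norm_scaledEval_le (x : ℤ_[p]) (j : Fin (n + 1)) {N s : ℕ} (hs : 0 < s)
    (h : (∏ i, p ^ m i) * (N / s + 1) ^ n < (N + 1) ^ (n + 1)) :
    ∃ d : Fin (n + 1) → ℤ, d ≠ 0 ∧ ‖scaledEval m (x : ℚ_[p]) d‖ ≤ 1 ∧ (∀ i, |d i| ≤ N) ∧
      ∀ i, i ≠ j → |d i| < s := by
  have hp : 0 < p := (Fact.out : p.Prime).pos
  have (i : Fin (n + 1)) : NeZero (p ^ m i) := ⟨(pow_pos hp _).ne'⟩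
  let f : (Fin (n + 1) → Fin (N + 1)) →
      (∀ i, ZMod (p ^ m i)) × ({i : Fin (n + 1) // i ≠ j} → Fin (N / s + 1)) := fun z =>
    (hasseResidue m x fun c => ((z c : ℕ) : ℤ),
      fun i => ⟨(z i : ℕ) / s, Nat.lt_succ_of_le (Nat.div_le_div_right (z i).is_le)⟩)
  obtain ⟨z, z', hne, heq⟩ := Fintype.exists_ne_map_eq_of_card_lt f (by
    simpa [Fintype.card_pi, ZMod.card, Fintype.card_subtype_compl] using h)
  refine ⟨(fun c => ((z c : ℕ) : ℤ)) - fun c => ((z' c : ℕ) : ℤ), ?_,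
    norm_scaledEval_sub_le_one (congrArg Prod.fst heq), fun i => ?_, fun i hi => ?_⟩
  · rw [sub_ne_zero]
    refine fun h => hne (funext fun c => Fin.ext ?_)
    exact_mod_cast congrFun h c
  · have h1 := (z i).is_le
    have h2 := (z' i).is_le
    rw [Pi.sub_apply, abs_le]
    constructor <;> lia
  · have := congrFun (congrArg Prod.snd heq) ⟨i, hi⟩
    exact abs_natCast_sub_lt_of_div_eq hs (congrArg Fin.val this)

lemma span_norm_scaledEval_le_eq_top (hQ : 0 < Q)
    (hm : ∏ i, (p : ℝ) ^ m i ≤ (p * Q) ^ (n + 1)) (x : ℤ_[p]) {ε : ℝ} (hε : 0 < ε)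
    (hmin : ∀ v : Fin (n + 1) → ℤ, v ≠ 0 → ‖scaledEval m (x : ℚ_[p]) v‖ ≤ 1 → ε * Q ≤ ‖v‖) :
    Submodule.span ℚ {w | ∃ v : Fin (n + 1) → ℤ, ‖scaledEval m (x : ℚ_[p]) v‖ ≤ 1 ∧
      ‖v‖ ≤ (p : ℝ) ^ (n + 1) * ((n + 1) / ε + 1) ^ n * Q ∧ w = fun c => (v c : ℚ)} = ⊤ := by
  have hp : (1 : ℝ) ≤ p := by exact_mod_cast (Fact.out : p.Prime).one_le
  set R : ℝ := (p : ℝ) ^ (n + 1) * ((n + 1) / ε + 1) ^ n with hR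
  have hR1 : 1 ≤ R := one_le_mul_of_one_le_of_one_le (one_le_pow₀ hp)
    (one_le_pow₀ (by linarith [show 0 ≤ ((n : ℝ) + 1) / ε by positivity]))
  by_contra hne
  obtain ⟨u, hu0, hu⟩ := Submodule.exists_le_ker_of_lt_top _ (lt_top_iff_ne_top.2 hne)
  obtain ⟨j, hj⟩ := Finite.exists_max fun i => |u (Pi.single i 1)|
  have huw (w : Fin (n + 1) → ℚ) : u w = ∑ i, w i * u (Pi.single i 1) := by
    conv_lhs => rw [← (Pi.basisFun ℚ (Fin (n + 1))).sum_repr w]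
    simp only [map_sum, map_smul, Pi.basisFun_repr, Pi.basisFun_apply, smul_eq_mul]
  have huj : 0 < |u (Pi.single j 1)| := by
    refine (abs_nonneg _).lt_of_ne fun h0 => hu0 (LinearMap.ext fun w => ?_)
    have hz (i) : u (Pi.single i 1) = 0 := abs_nonpos_iff.1 ((hj i).trans h0.ge)
    rw [huw, LinearMap.zero_apply]
    exact Finset.sum_eq_zero fun i _ => by rw [hz, mul_zero]
  set s : ℕ := ⌊ε * Q / (n + 1)⌋₊ + 1 with hs
  have hsQ : ε * Q / (n + 1) < s := by
    rw [hs]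
    exact_mod_cast Nat.lt_floor_add_one (ε * Q / (n + 1))
  have hs0 : (0 : ℝ) < s := by positivity
  set N : ℕ := ⌊R * Q⌋₊ with hN
  have hNR : (N : ℝ) ≤ R * Q := Nat.floor_le (by positivity)
  obtain ⟨d, hd0, hdx, hdN, hds⟩ := exists_ne_zero_norm_scaledEval_le (m := m) x j
    (Nat.cast_pos.1 hs0) (N := N) (by
      have h1 : (((N / s : ℕ) : ℝ) + 1) ≤ R * ((n + 1) / ε + 1) := by
        have h2 : ((N / s : ℕ) : ℝ) ≤ R * ((n + 1) / ε) := by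
          refine Nat.cast_div_le.trans ?_
          rw [div_le_iff₀ hs0]
          calc (N : ℝ) ≤ R * Q := hNR
            _ = R * ((n + 1) / ε) * (ε * Q / (n + 1)) := by field_simp
            _ ≤ _ := by gcongr
        linarith
      have h3 : (∏ i, (p : ℝ) ^ m i) * (((N / s : ℕ) : ℝ) + 1) ^ n < ((N : ℝ) + 1) ^ (n + 1) := by
        calc _ ≤ (p * Q) ^ (n + 1) * (R * ((n + 1) / ε + 1)) ^ n := by gcongr
          _ = (R * Q) ^ (n + 1) := by
            have h4 : (R * Q) ^ (n + 1) = R ^ n * (R * Q ^ (n + 1)) := by ring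
            rw [h4, mul_pow, mul_pow R]
            nth_rewrite 3 [hR]
            ring
          _ < _ := by
            gcongr
            exact Nat.lt_floor_add_one _
      exact_mod_cast h3)
  have hdj : u (fun c => (d c : ℚ)) = 0 := by
    refine hu (Submodule.subset_span ⟨d, hdx, ?_, rfl⟩)
    refine le_trans ((pi_norm_le_iff_of_nonneg (Nat.cast_nonneg N)).2 fun i => ?_) hNR
    rw [Int.norm_eq_abs]
    exact_mod_cast hdN i
  have hs1 : ((s - 1 : ℤ) : ℝ) ≤ ε * Q / (n + 1) := by
    rw [hs]
    push_cast
    rw [add_sub_cancel_right]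
    exact Nat.floor_le (by positivity)
  have hdjle : |d j| ≤ n * (s - 1 : ℤ) := by
    rw [huw, ← Finset.add_sum_erase _ _ (Finset.mem_univ j), add_eq_zero_iff_eq_neg] at hdj
    have h1 : |(d j : ℚ)| * |u (Pi.single j 1)| ≤ (n * (s - 1 : ℤ)) * |u (Pi.single j 1)| := by
      rw [← abs_mul, hdj, abs_neg]
      refine (Finset.abs_sum_le_sum_abs _ _).trans ?_
      calc _ ≤ ∑ i ∈ Finset.univ.erase j, ((s - 1 : ℤ) : ℚ) * |u (Pi.single j 1)| := by
            refine Finset.sum_le_sum fun i hi => ?_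
            rw [abs_mul]
            refine mul_le_mul ?_ (hj i) (abs_nonneg _) ?_
            · have := hds i (Finset.ne_of_mem_erase hi)
              have : |d i| ≤ s - 1 := by lia
              exact_mod_cast this
            · have : (0 : ℤ) ≤ s - 1 := by lia
              exact_mod_cast this
        _ = _ := by
            rw [Finset.sum_const, Finset.card_erase_of_mem (Finset.mem_univ j), Finset.card_univ,
              Fintype.card_fin, nsmul_eq_mul, Nat.add_sub_cancel, mul_assoc]
    exact_mod_cast le_of_mul_le_mul_right h1 huj
  have hlt : ε * Q * n / (n + 1) < ε * Q := by
    rw [div_lt_iff₀ (by positivity)]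
    nlinarith [mul_pos hε hQ]
  refine absurd (hmin d hd0 hdx) (not_le.2 (lt_of_le_of_lt ?_ hlt))
  refine (pi_norm_le_iff_of_nonneg (by positivity)).2 fun i => ?_
  have hi : |d i| ≤ n * (s - 1 : ℤ) := by
    by_cases hij : i = j
    · exact hij ▸ hdjle
    · have hn : 0 < n := by
        by_contra hn
        exact hij (Fin.ext (by lia))
      have := hds i hij
      nlinarith
  have hi' : |(d i : ℝ)| ≤ n * ((s - 1 : ℤ) : ℝ) := by exact_mod_cast hi
  rw [Int.norm_eq_abs]
  refine hi'.trans ?_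
  calc (n : ℝ) * ((s - 1 : ℤ) : ℝ) ≤ n * (ε * Q / (n + 1)) := by gcongr
    _ = _ := by ring

end GeometryOfNumbers

section Construction

variable {p : ℕ} [Fact p.Prime] {n : ℕ} {m : Fin (n + 1) → ℕ}

/-- There is an integer vector in a prescribed residue class modulo `N` whose scaled Hasse
derivatives at `x` are all units. -/
lemma exists_norm_scaledEval_eq_one (m : Fin (n + 1) → ℕ) (x : ℤ_[p]) {N : ℕ}
    (hN : p.Coprime N) (b : Fin (n + 1) → ℤ) :
    ∃ z : Fin (n + 1) → ℤ, ∀ i, ‖scaledEval m (x : ℚ_[p]) (fun c => b c + N * z c) i‖ = 1 := by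
  let f : (Fin (n + 1) → ℤ_[p]) → Fin (n + 1) → ℚ_[p] := fun y =>
    Matrix.vecMul (fun c => ((b c + N * y c : ℤ_[p]) : ℚ_[p])) (scaledHasse m x)
  have hf : Continuous f := by
    refine Continuous.matrix_vecMul (continuous_pi fun c => ?_) continuous_const
    exact continuous_subtype_val.comp
      (continuous_const.add (continuous_const.mul (continuous_apply c)))
  have hopen : IsOpen {y | ∀ i, f y i ∈ Metric.sphere (0 : ℚ_[p]) 1} := by
    simp only [Set.ofPred_forall]
    refine isOpen_iInter_of_finite fun i => ?_
    exact (IsUltrametricDist.isOpen_sphere 0 one_ne_zero).preimage ((continuous_apply i).comp hf)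
  have hNu : IsUnit (N : ℤ_[p]) := by
    rw [PadicInt.isUnit_iff, PadicInt.norm_def, PadicInt.coe_natCast]
    exact (Padic.norm_natCast_eq_one_iff).2 hN
  obtain ⟨w, hw⟩ := hNu
  let G : ℤ_[p][X] := ∑ i : Fin (n + 1), C ((p : ℤ_[p]) ^ m i) * X ^ (i : ℕ)
  let F : ℤ_[p][X] := taylor (-x) G
  have hG (i : Fin (n + 1)) : G.coeff i = (p : ℤ_[p]) ^ m i := by
    simp only [G, finsetSum_coeff, coeff_C_mul, coeff_X_pow, Fin.val_inj]
    simp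
  have hFd : F.natDegree ≤ n := by
    rw [natDegree_taylor]
    refine natDegree_sum_le_of_forall_le _ _ fun i _ => ?_
    exact (natDegree_C_mul_X_pow_le _ _).trans i.is_le
  have hF : F = ∑ c : Fin (n + 1), C (F.coeff c) * X ^ (c : ℕ) := by
    conv_lhs => rw [F.as_sum_range_C_mul_X_pow' (Nat.lt_succ_of_le hFd)]
    rw [Finset.sum_range]
  have hFx (i : Fin (n + 1)) : ∑ c : Fin (n + 1), F.coeff c * aeval x (hasseMatrix n c i) =
      (p : ℤ_[p]) ^ m i := by
    have h1 : (taylor x F).coeff i = (p : ℤ_[p]) ^ m i := by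
      rw [taylor_taylor, add_neg_cancel, taylor_zero, hG]
    rw [← h1, taylor_coeff]
    conv_rhs => rw [hF]
    rw [map_sum, eval_finsetSum]
    refine Finset.sum_congr rfl fun c _ => ?_
    rw [C_mul_X_pow_eq_monomial, hasseDeriv_monomial, eval_monomial, hasseMatrix, Matrix.of_apply,
      map_mul, map_pow, aeval_X, aeval_C, algebraMap_int_eq, eq_intCast, Int.cast_natCast]
    ring
  have hne : {y | ∀ i, f y i ∈ Metric.sphere (0 : ℚ_[p]) 1}.Nonempty := by
    refine ⟨fun c => (w⁻¹ : ℤ_[p]ˣ) * (F.coeff c - b c), fun i => ?_⟩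
    have : f (fun c => (w⁻¹ : ℤ_[p]ˣ) * (F.coeff c - b c)) i = 1 := by
      have hp : (p : ℚ_[p]) ≠ 0 := Nat.cast_ne_zero.2 (Fact.out : p.Prime).ne_zero
      have := congrArg (fun z : ℤ_[p] => (p : ℚ_[p]) ^ (-(m i : ℤ)) * (z : ℚ_[p])) (hFx i)
      simp only [f, ← hw, Units.mul_inv_cancel_left, add_sub_cancel, Matrix.vecMul, dotProduct,
        scaledHasse, Matrix.of_apply]
      rw [PadicInt.coe_pow, PadicInt.coe_natCast, zpow_neg, zpow_natCast,
        inv_mul_cancel₀ (pow_ne_zero _ hp), PadicInt.coe_sum, Finset.mul_sum] at this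
      rw [← this]
      refine Finset.sum_congr rfl fun c _ => ?_
      rw [PadicInt.coe_mul, coe_aeval_padicInt, mul_left_comm, zpow_neg, zpow_natCast]
    rw [this]
    simp
  obtain ⟨z, hz⟩ := (DenseRange.piMap fun _ : Fin (n + 1) =>
    PadicInt.denseRange_intCast (p := p)).exists_mem_open hopen hne
  refine ⟨z, fun i => ?_⟩
  have := hz i
  rw [mem_sphere_zero_iff_norm] at this
  refine Eq.trans (congrArg norm ?_) this
  simp [f, scaledEval]

/-- Reduction of an integer vector modulo a full lattice, followed by translations by the basis
vectors, produces an independent family of bounded vectors. -/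
lemma exists_linearIndependent_translates (w : Fin (n + 1) → Fin (n + 1) → ℤ)
    (hw : LinearIndependent ℚ fun l => fun c => (w l c : ℚ)) (t : Fin (n + 1) → ℤ) {R : ℝ}
    (hR : ∀ l, ‖w l‖ ≤ R) :
    ∃ z : Fin (n + 1) → Fin (n + 1) → ℤ,
      (LinearIndependent ℚ fun l => fun c => ((t + ∑ j, z l j • w j) c : ℚ)) ∧
      ∀ l, ‖t + ∑ j, z l j • w j‖ ≤ (n + 2) * R := by
  have htop : (fun c => (t c : ℚ)) ∈ Submodule.span ℚ (Set.range fun l => fun c => (w l c : ℚ)) := by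
    rw [hw.span_eq_top_of_card_eq_finrank' (by simp)]
    trivial
  obtain ⟨a, ha⟩ := (Submodule.mem_span_range_iff_exists_fun ℚ).1 htop
  have ha' (c) : (t c : ℚ) = ∑ j, a j * w j c := by
    have := congrFun ha c
    simpa using this.symm
  let z : Fin (n + 1) → Fin (n + 1) → ℤ := fun l j => (if j = l then 1 else 0) - ⌊a j⌋
  have hz (l c) : ((t + ∑ j, z l j • w j) c : ℚ) = w l c + ∑ j, Int.fract (a j) * w j c := by
    have : (w l c : ℚ) = ∑ j, (if j = l then 1 else 0) * (w j c : ℚ) := by simp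
    rw [this, Pi.add_apply, Finset.sum_apply, Int.cast_add, ha', Int.cast_sum,
      ← Finset.sum_add_distrib, ← Finset.sum_add_distrib]
    refine Finset.sum_congr rfl fun j _ => ?_
    rw [← Int.self_sub_floor, Pi.smul_apply, smul_eq_mul, Int.cast_mul]
    simp only [z]
    push_cast
    ring
  refine ⟨z, ?_, fun l => ?_⟩
  · rw [Fintype.linearIndependent_iff] at hw ⊢
    intro g hg
    have key := hw (fun j => g j + (∑ l, g l) * Int.fract (a j)) ?_
    · have hsum : (∑ l, g l) * (1 + ∑ j, Int.fract (a j)) = 0 := by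
        rw [mul_add, mul_one, Finset.mul_sum, ← Finset.sum_add_distrib]
        exact Finset.sum_eq_zero fun j _ => key j
      have hpos : 0 ≤ ∑ j, Int.fract (a j) := Finset.sum_nonneg fun j _ => Int.fract_nonneg _
      have h0 : ∑ l, g l = 0 := (mul_eq_zero.1 hsum).resolve_right (by positivity)
      intro l
      simpa [h0] using key l
    · ext c
      have := congrFun hg c
      simp only [Finset.sum_apply, Pi.smul_apply, smul_eq_mul, hz, Pi.zero_apply] at this ⊢
      rw [← this]
      simp only [add_mul, mul_add, Finset.sum_add_distrib, Finset.sum_mul, Finset.mul_sum]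
      congr 1
      rw [Finset.sum_comm]
      simp only [mul_assoc]
  · have hR0 : 0 ≤ R := (norm_nonneg _).trans (hR l)
    refine (pi_norm_le_iff_of_nonneg (by positivity)).2 fun c => ?_
    have hwc (j) : |(w j c : ℝ)| ≤ R := by
      have := (norm_le_pi_norm (w j) c).trans (hR j)
      rwa [Int.norm_eq_abs] at this
    have hz' : ((t + ∑ j, z l j • w j) c : ℝ) =
        w l c + ∑ j, ((Int.fract (a j) : ℚ) : ℝ) * w j c := by
      have := congrArg (Rat.cast : ℚ → ℝ) (hz l c)
      push_cast at this ⊢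
      exact this
    rw [Int.norm_eq_abs, hz']
    refine (abs_add_le _ _).trans ?_
    have : |∑ j, ((Int.fract (a j) : ℚ) : ℝ) * w j c| ≤ (n + 1) * R := by
      refine (Finset.abs_sum_le_sum_abs _ _).trans ?_
      refine (Finset.sum_le_card_nsmul _ _ R fun j _ => ?_).trans (by simp)
      rw [abs_mul, abs_of_nonneg (by exact_mod_cast Int.fract_nonneg _)]
      refine (mul_le_of_le_one_left (abs_nonneg _) ?_).trans (hwc j)
      exact_mod_cast (Int.fract_lt_one _).le
    linarith [hwc l]

lemma polyOfCoeffs_coeff {P : ℤ[X]} (hP : P.natDegree ≤ n) :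
    polyOfCoeffs (fun c : Fin (n + 1) => P.coeff c) = P := by
  conv_rhs => rw [P.as_sum_range_C_mul_X_pow' (Nat.lt_succ_of_le hP)]
  rw [Finset.sum_range, polyOfCoeffs]

lemma norm_coeff_eq_polyHeight {P : ℤ[X]} (hP : P.natDegree = n) :
    ‖fun c : Fin (n + 1) => P.coeff c‖ = polyHeight P := by
  refine le_antisymm ((pi_norm_le_iff_of_nonneg (Nat.cast_nonneg _)).2 fun c => ?_) ?_
  · rw [Int.norm_eq_abs, ← Int.cast_abs, Int.abs_eq_natAbs, Int.cast_natCast, Nat.cast_le]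
    exact Finset.le_sup (f := fun i => (P.coeff i).natAbs)
      (Finset.mem_range.2 (hP.symm ▸ c.is_lt))
  · obtain ⟨i, hi, h⟩ := Finset.exists_mem_eq_sup (Finset.range (P.natDegree + 1)) (by simp)
      fun i => (P.coeff i).natAbs
    rw [polyHeight, h]
    have := norm_le_pi_norm (fun c : Fin (n + 1) => P.coeff c)
      ⟨i, hP ▸ Finset.mem_range.1 hi⟩
    rwa [Int.norm_eq_abs, ← Int.cast_abs, Int.abs_eq_natAbs, Int.cast_natCast] at this

end Construction

section Irreducibility

variable {p : ℕ} [Fact p.Prime] {n : ℕ} {m : Fin (n + 1) → ℕ}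

lemma irreducible_map_of_eisenstein {P : ℤ[X]} (hP : P.IsPrimitive) {q : ℕ} (hq : q.Prime)
    (hd : 0 < P.natDegree) (hlead : ¬(q : ℤ) ∣ P.leadingCoeff)
    (hdvd : ∀ c < P.natDegree, (q : ℤ) ∣ P.coeff c) (h0 : ¬(q : ℤ) ^ 2 ∣ P.coeff 0) :
    Irreducible (P.map (Int.castRingHom ℚ)) := by
  rw [← IsPrimitive.Int.irreducible_iff_irreducible_map_cast hP]
  refine irreducible_of_eisenstein_criterion (P := Ideal.span {(q : ℤ)})
    ((Ideal.span_singleton_prime (by exact_mod_cast hq.ne_zero)).2 (Nat.prime_iff_prime_int.1 hq))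
    (by rwa [Ideal.mem_span_singleton]) (fun c hc => ?_) (natDegree_pos_iff_degree_pos.1 hd)
    (by rwa [Ideal.span_singleton_pow, Ideal.mem_span_singleton]) hP
  exact Ideal.mem_span_singleton.2 (hdvd c (coe_lt_degree.1 hc))

/-- The primitive part of a polynomial that is of Eisenstein type at `q`, and whose Hasse
derivatives at `x` have prescribed absolute values. -/
lemma exists_isPrimitive_irreducible (hn : n ≠ 0) (hm : m (Fin.last n) = 0) {x : ℚ_[p]} {q : ℕ}
    (hq : q.Prime) {u : Fin (n + 1) → ℤ} (hu : ∀ i, ‖scaledEval m x u i‖ = 1)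
    (hlast : ¬(q : ℤ) ∣ u (Fin.last n)) (hdvd : ∀ c, c ≠ Fin.last n → (q : ℤ) ∣ u c)
    (h0 : ¬(q : ℤ) ^ 2 ∣ u 0) :
    ∃ (P : ℤ[X]) (g : ℤ), P.IsPrimitive ∧ Irreducible (P.map (Int.castRingHom ℚ)) ∧
      P.natDegree = n ∧ g ≠ 0 ∧ (∀ c : Fin (n + 1), u c = g * P.coeff c) ∧
      ∀ i : Fin (n + 1),
        ‖aeval x (hasseDeriv (i : ℕ) P)‖ = (p : ℝ) ^ (-(m i : ℤ)) := by
  have hp : (0 : ℝ) < p := prime_cast_pos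
  set U : ℤ[X] := polyOfCoeffs u with hU
  have hUn : U.coeff n = u (Fin.last n) := coeff_polyOfCoeffs u (Fin.last n)
  have hun : u (Fin.last n) ≠ 0 := fun h => hlast (h ▸ dvd_zero _)
  have hUd : U.natDegree = n :=
    le_antisymm (natDegree_polyOfCoeffs_le u) (le_natDegree_of_ne_zero (hUn.trans_ne hun))
  have hU0 : U ≠ 0 := fun h => hun (by rw [← hUn, h, coeff_zero])
  have hPd : U.primPart.natDegree = n := (natDegree_primPart U).trans hUd
  have hcoeff (c : Fin (n + 1)) : u c = U.content * U.primPart.coeff c := by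
    rw [← coeff_polyOfCoeffs u c, ← hU, ← coeff_C_mul, ← eq_C_content_mul_primPart]
  have hg0 : U.content ≠ 0 := content_eq_zero_iff.not.2 hU0
  have hUx (i : Fin (n + 1)) : ‖aeval x (hasseDeriv (i : ℕ) U)‖ = (p : ℝ) ^ (-(m i : ℤ)) := by
    have := hu i
    rw [scaledEval_apply, norm_mul, Padic.norm_p_zpow, neg_neg] at this
    rw [zpow_neg]
    exact eq_inv_of_mul_eq_one_right this
  have hg1 : ‖((U.content : ℤ) : ℚ_[p])‖ = 1 := by
    have hUlast : hasseDeriv n U = C (u (Fin.last n)) := by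
      rw [hU, ← hUn, ← hU]
      ext k
      rw [hasseDeriv_coeff, coeff_C]
      split_ifs with h
      · simp [h]
      · rw [coeff_eq_zero_of_natDegree_lt (by lia), mul_zero]
    have h1 := hUx (Fin.last n)
    rw [Fin.val_last, hUlast, aeval_C, hm, algebraMap_int_eq, eq_intCast, hcoeff, Int.cast_mul,
      norm_mul] at h1
    refine le_antisymm (Padic.norm_int_le_one _) ?_
    calc (1 : ℝ) = _ := by simpa using h1.symm
      _ ≤ _ := mul_le_of_le_one_right (norm_nonneg _) (Padic.norm_int_le_one _)
  have hqp : Prime (q : ℤ) := Nat.prime_iff_prime_int.1 hq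
  have hqg : ¬(q : ℤ) ∣ U.content := fun h =>
    hlast (hcoeff (Fin.last n) ▸ h.mul_right _)
  refine ⟨U.primPart, U.content, U.isPrimitive_primPart, ?_, hPd, hg0, hcoeff, fun i => ?_⟩
  · refine irreducible_map_of_eisenstein U.isPrimitive_primPart hq (by lia) ?_ (fun c hc => ?_) ?_
    · rw [leadingCoeff, hPd]
      exact fun h => hlast (hcoeff (Fin.last n) ▸ h.mul_left _)
    · rw [hPd] at hc
      have h1 := hdvd ⟨c, by lia⟩ (by simp [Fin.ext_iff, hc.ne])
      rw [hcoeff] at h1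
      exact (hqp.dvd_or_dvd h1).resolve_left hqg
    · intro h
      exact h0 (hcoeff 0 ▸ h.mul_left _)
  · rw [← hUx i]
    conv_rhs => rw [U.eq_C_content_mul_primPart]
    rw [← smul_eq_C_mul, map_smul, map_zsmul, zsmul_eq_mul, norm_mul, hg1, one_mul]

/-- From independent short lattice vectors to independent irreducible polynomials. -/
lemma exists_irreducible_linearIndependent (hn : n ≠ 0) (hm : m (Fin.last n) = 0) (x : ℤ_[p])
    (v : Fin (n + 1) → Fin (n + 1) → ℤ)
    (hind : LinearIndependent ℚ fun l => fun c => (v l c : ℚ))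
    (hv : ∀ l, ‖scaledEval m (x : ℚ_[p]) (v l)‖ ≤ 1) {R : ℝ} (hR : ∀ l, ‖v l‖ ≤ R) :
    ∃ P : Fin (n + 1) → ℤ[X],
      (∀ l, (P l).IsPrimitive ∧ Irreducible ((P l).map (Int.castRingHom ℚ)) ∧
        (P l).natDegree = n ∧ (polyHeight (P l) : ℝ) ≤ (n + 2) * (9 * p * R) ∧
        ∀ i : Fin (n + 1),
          ‖aeval (x : ℚ_[p]) (hasseDeriv (i : ℕ) (P l))‖ = (p : ℝ) ^ (-(m i : ℤ))) ∧
      LinearIndependent ℚ fun l => fun c : Fin (n + 1) => ((P l).coeff c : ℚ) := by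
  have hp : (1 : ℝ) < p := one_lt_prime_cast
  obtain ⟨q, hq, hqp, hq3⟩ : ∃ q : ℕ, q.Prime ∧ p.Coprime q ∧ q ≤ 3 := by
    rcases eq_or_ne p 2 with h | h
    · exact ⟨3, Nat.prime_three, by rw [h]; decide, le_rfl⟩
    · exact ⟨2, Nat.prime_two, (Nat.coprime_primes Fact.out Nat.prime_two).2 h, by lia⟩
  have hqp' : Prime (q : ℤ) := Nat.prime_iff_prime_int.1 hq
  let b : Fin (n + 1) → ℤ := fun c => if c = 0 then q else if c = Fin.last n then 1 else 0
  obtain ⟨y, hy⟩ := exists_norm_scaledEval_eq_one m x (hqp.pow_right 2) b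
  set t : Fin (n + 1) → ℤ := fun c => b c + (q ^ 2 : ℕ) * y c with ht
  let w : Fin (n + 1) → Fin (n + 1) → ℤ := fun l => ((p * q ^ 2 : ℕ) : ℤ) • v l
  have hpq : (p * q ^ 2 : ℕ) ≠ 0 :=
    mul_ne_zero (Fact.out : p.Prime).ne_zero (pow_ne_zero 2 hq.ne_zero)
  have hw : LinearIndependent ℚ fun l => fun c => (w l c : ℚ) := by
    have hunit : IsUnit ((p * q ^ 2 : ℕ) : ℚ) := (Nat.cast_ne_zero.2 hpq).isUnit
    have := hind.units_smul fun _ => hunit.unit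
    convert this using 2 with l
    ext c
    simp [w, Units.smul_def]
  have hwR (l) : ‖w l‖ ≤ 9 * p * R := by
    rw [norm_smul, Int.norm_natCast]
    refine mul_le_mul ?_ (hR l) (norm_nonneg _) (by positivity)
    have : (q : ℝ) ≤ 3 := by exact_mod_cast hq3
    have hq9 : (q : ℝ) ^ 2 ≤ 9 := by nlinarith [(Nat.cast_nonneg q : (0 : ℝ) ≤ q)]
    push_cast
    nlinarith
  obtain ⟨z, hzind, hzR⟩ := exists_linearIndependent_translates w hw t hwR
  set u : Fin (n + 1) → Fin (n + 1) → ℤ := fun l => t + ∑ j, z l j • w j with hu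
  have hub (l c) : ∃ k : ℤ, u l c = b c + q ^ 2 * k := by
    refine ⟨y c + p * ∑ j, z l j * v j c, ?_⟩
    simp only [hu, ht, w, Pi.add_apply, Finset.sum_apply, Pi.smul_apply, smul_eq_mul,
      Finset.mul_sum, mul_add]
    push_cast
    rw [add_assoc]
    congr 2
    exact Finset.sum_congr rfl fun j _ => by ring
  have hux (l i) : ‖scaledEval m (x : ℚ_[p]) (u l) i‖ = 1 := by
    let f : (Fin (n + 1) → ℤ) →+ (Fin (n + 1) → ℚ_[p]) :=
      AddMonoidHom.ofMapSub (scaledEval m (x : ℚ_[p])) (scaledEval_sub (x : ℚ_[p]))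
    have hfw (j) : ‖f (w j) i‖ ≤ ‖(p : ℚ_[p])‖ := by
      have hfv : ‖f (v j) i‖ ≤ 1 := (norm_le_pi_norm _ i).trans (hv j)
      rw [map_zsmul, Pi.smul_apply, zsmul_eq_mul, Int.cast_natCast, Nat.cast_mul, mul_assoc,
        norm_mul, norm_mul]
      exact mul_le_of_le_one_right (norm_nonneg _)
        (mul_le_one₀ (IsUltrametricDist.norm_natCast_le_one _ _) (norm_nonneg _) hfv)
    have hsum : ‖∑ j, z l j • f (w j) i‖ < 1 := by
      refine lt_of_le_of_lt ?_ (Padic.norm_p_lt_one (p := p))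
      refine IsUltrametricDist.norm_sum_le_of_forall_le_of_nonneg (norm_nonneg _) fun j _ => ?_
      rw [zsmul_eq_mul, norm_mul]
      exact (mul_le_of_le_one_left (norm_nonneg _) (Padic.norm_int_le_one _)).trans (hfw j)
    have hsplit : scaledEval m (x : ℚ_[p]) (u l) i =
        scaledEval m (x : ℚ_[p]) t i + ∑ j, z l j • f (w j) i := by
      change f (u l) i = f t i + _
      simp only [hu, map_add, map_sum, map_zsmul, Pi.add_apply, Finset.sum_apply, Pi.smul_apply]
    rw [hsplit, Padic.add_eq_max_of_ne (by rw [hy]; exact hsum.ne'), hy, max_eq_left hsum.le]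
  have hlast0 : Fin.last n ≠ 0 := by
    rw [Ne, Fin.last_eq_zero_iff]
    exact hn
  choose P g hPprim hPirr hPdeg hg hPu hPx using fun l =>
    exists_isPrimitive_irreducible hn hm hq (hux l)
      (by
        obtain ⟨k, hk⟩ := hub l (Fin.last n)
        simp only [b, hlast0, if_false, if_true] at hk
        rw [hk, Int.dvd_add_left (Dvd.intro _ (by rw [pow_two, mul_assoc]))]
        exact hqp'.not_dvd_one)
      (fun c hc => by
        obtain ⟨k, hk⟩ := hub l c
        simp only [b, hc, if_false] at hk
        rw [hk]
        refine dvd_add ?_ (Dvd.intro _ (by rw [pow_two, mul_assoc]))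
        split_ifs <;> simp)
      (by
        obtain ⟨k, hk⟩ := hub l 0
        simp only [b, if_true] at hk
        rw [hk, Int.dvd_add_left (dvd_mul_right _ _)]
        intro h
        rw [pow_two] at h
        have := (mul_dvd_mul_iff_left hqp'.ne_zero).1 (h.trans (mul_one (q : ℤ)).symm.dvd)
        exact hqp'.not_dvd_one this)
  refine ⟨P, fun l => ⟨hPprim l, hPirr l, hPdeg l, ?_, hPx l⟩, ?_⟩
  · rw [← norm_coeff_eq_polyHeight (hPdeg l)]
    refine le_trans ?_ (hzR l)
    refine (pi_norm_le_iff_of_nonneg (norm_nonneg _)).2 fun c => ?_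
    refine le_trans ?_ (norm_le_pi_norm (u l) c)
    rw [hPu l c, norm_mul]
    refine le_mul_of_one_le_left (norm_nonneg _) ?_
    rw [Int.norm_eq_abs]
    exact_mod_cast Int.one_le_abs (hg l)
  · have hgu (l) : IsUnit ((g l : ℤ) : ℚ) := (Int.cast_ne_zero.2 (hg l)).isUnit
    have := hzind.units_smul fun l => (hgu l).unit⁻¹
    convert this using 2 with l
    ext c
    have h1 := hPu l c
    simp only [hu] at h1
    have hgl : ((g l : ℤ) : ℚ) ≠ 0 := Int.cast_ne_zero.2 (hg l)
    simp only [Pi.smul_apply', Pi.smul_apply, h1, Units.smul_def]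
    simp [hgl]

end Irreducibility

section KeyLemma

variable {p : ℕ} [Fact p.Prime] {n : ℕ}

/-- The polynomials attached to a point at which the flag of covolumes is marked. -/
lemma exists_polynomials_of_isMarked {Q ε : ℝ} {m : Fin (n + 1) → ℕ} (hn : n ≠ 0) (hQ : 0 < Q)
    (hε : 0 < ε) (hlast : m (Fin.last n) = 0) (hm : ∏ i, (p : ℝ) ^ m i ≤ (p * Q) ^ (n + 1))
    (x : ℤ_[p])
    (hx : IsMarked (fun (V : Submodule ℚ (Fin (n + 1) → ℚ)) x => covol Q m (latticeBasis V) x) ε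
      Set.univ (x : ℚ_[p])) :
    ∃ P : Fin (n + 1) → ℤ[X],
      (∀ l, (P l).IsPrimitive ∧ Irreducible ((P l).map (Int.castRingHom ℚ)) ∧
        (P l).natDegree = n ∧ ε / (n + 1) ^ 2 * Q ≤ polyHeight (P l) ∧
        (polyHeight (P l) : ℝ) ≤
          (n + 2) * (9 * p * (p ^ (n + 1) * ((n + 1) / (ε / (n + 1) ^ 2) + 1) ^ n)) * Q ∧
        ∀ i : Fin (n + 1),
          ‖aeval (x : ℚ_[p]) (hasseDeriv (i : ℕ) (P l))‖ = (p : ℝ) ^ (-(m i : ℤ))) ∧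
      LinearIndependent ℚ fun l => fun c : Fin (n + 1) => ((P l).coeff c : ℚ) := by
  set ε' : ℝ := ε / (n + 1) ^ 2 with hε'
  have hε'0 : 0 < ε' := by positivity
  have hmin : ∀ v : Fin (n + 1) → ℤ, v ≠ 0 → ‖scaledEval m (x : ℚ_[p]) v‖ ≤ 1 →
      ε' * Q ≤ ‖v‖ := fun v hv0 hv => mul_le_norm_of_isMarked hQ hx hv0 hv
  have hspan := span_norm_scaledEval_le_eq_top hQ hm x hε'0 hmin
  obtain ⟨f, hf, -, hind⟩ := Submodule.exists_fun_fin_finrank_span_eq ℚ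
    {w | ∃ v : Fin (n + 1) → ℤ, ‖scaledEval m (x : ℚ_[p]) v‖ ≤ 1 ∧
      ‖v‖ ≤ (p : ℝ) ^ (n + 1) * ((n + 1) / ε' + 1) ^ n * Q ∧ w = fun c => (v c : ℚ)}
  have hcard : n + 1 = Module.finrank ℚ (Submodule.span ℚ
      {w | ∃ v : Fin (n + 1) → ℤ, ‖scaledEval m (x : ℚ_[p]) v‖ ≤ 1 ∧
      ‖v‖ ≤ (p : ℝ) ^ (n + 1) * ((n + 1) / ε' + 1) ^ n * Q ∧ w = fun c => (v c : ℚ)}) := by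
    rw [hspan, finrank_top, Module.finrank_fin_fun]
  choose v hv hvR hvf using fun l => hf (Fin.cast hcard l)
  have hvind : LinearIndependent ℚ fun l => fun c => (v l c : ℚ) := by
    have := hind.comp _ (Fin.cast_injective hcard)
    rwa [show f ∘ Fin.cast hcard = fun l c => (v l c : ℚ) from funext hvf] at this
  obtain ⟨P, hP, hPind⟩ := exists_irreducible_linearIndependent hn hlast x v hvind hv hvR
  refine ⟨P, fun l => ?_, hPind⟩
  obtain ⟨h1, h2, h3, h4, h5⟩ := hP l
  refine ⟨h1, h2, h3, ?_, h4.trans_eq (by ring), h5⟩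
  rw [← norm_coeff_eq_polyHeight h3]
  refine hmin _ (fun h => ?_) ((pi_norm_le_iff_of_nonneg zero_le_one).2 fun i => ?_)
  · have h0 : (P l).coeff n = 0 := congrFun h (Fin.last n)
    rw [← h3, coeff_natDegree, leadingCoeff_eq_zero] at h0
    exact hn (by rw [← h3, h0, natDegree_zero])
  · rw [scaledEval_apply, norm_zpow_mul_le_one_iff, polyOfCoeffs_coeff h3.le, h5]

lemma exists_pow_inv_le_lt {ξ : ℝ} (h0 : 0 < ξ) (h1 : ξ ≤ 1) :
    ∃ m : ℕ, ((p : ℝ) ^ m)⁻¹ ≤ ξ ∧ ξ < p * ((p : ℝ) ^ m)⁻¹ := by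
  have hp : (1 : ℝ) < p := one_lt_prime_cast
  obtain ⟨k, hk1, hk2⟩ := exists_mem_Ico_zpow h0 hp
  obtain ⟨m, rfl⟩ : ∃ m : ℕ, k = -m := by
    have hk : k ≤ 0 := (zpow_le_one_iff_right₀ hp).1 (hk1.trans h1)
    exact ⟨k.natAbs, by lia⟩
  rw [zpow_neg, zpow_natCast] at hk1
  rw [zpow_add_one₀ (by positivity), zpow_neg, zpow_natCast, mul_comm] at hk2
  exact ⟨m, hk1, hk2⟩

lemma exists_closedBall_eq_padicBall (a : ℚ_[p]) {r : ℝ} (hr : 0 < r) :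
    ∃ l : ℤ, {x : ℚ_[p] | ‖x - a‖ ≤ r} = padicBall a l := by
  obtain ⟨k, hk1, hk2⟩ := exists_mem_Ico_zpow hr (one_lt_prime_cast (p := p))
  refine ⟨-k, Set.ext fun x => ?_⟩
  rw [mem_padicBall, neg_neg, Set.mem_ofPred_eq]
  refine ⟨fun h => ?_, fun h => h.trans hk1⟩
  exact (Padic.norm_le_pow_iff_norm_lt_pow_add_one _ _).2 (h.trans_lt hk2)

/-- Outside a set of small measure, the flag of covolumes is marked. -/
lemma measure_not_isMarked_covol_le (μ : Measure ℚ_[p]) [μ.IsAddHaarMeasure] {Q : ℝ} (hQ : 0 < Q)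
    (m : Fin (n + 1) → ℕ) (j : ℕ) (a : ℚ_[p]) (l : ℤ)
    (h : ∀ k (A : Matrix (Fin k) (Fin (n + 1)) ℤ),
      (LinearIndependent ℚ fun b => fun c => (A b c : ℚ)) →
        ∃ y ∈ padicBall a l, 1 ≤ covol Q m A y) :
    μ {x ∈ padicBall a l |
        ¬IsMarked (fun (V : Submodule ℚ (Fin (n + 1) → ℚ)) x => covol Q m (latticeBasis V) x)
          ((p : ℝ) ^ (-(j * ((n + 1) * n : ℕ) : ℤ))) Set.univ x} ≤
      nondivergenceConst p (n + 2) * (((n + 1) * n : ℕ) * (p : ENNReal)⁻¹ ^ j) *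
        μ (padicBall a l) := by
  have hrk (V : Submodule ℚ (Fin (n + 1) → ℚ)) : Module.finrank ℚ V ≤ n + 1 := by
    simpa using Submodule.finrank_le V
  have hmono : StrictMono fun V : Submodule ℚ (Fin (n + 1) → ℚ) => Module.finrank ℚ V :=
    fun V W hVW => Submodule.finrank_lt_finrank_of_lt hVW
  have hε : (p : ℝ) ^ (-(j * ((n + 1) * n : ℕ) : ℤ)) ≤ 1 :=
    zpow_le_one_of_nonpos₀ one_lt_prime_cast.le (by
      rw [neg_nonpos]
      positivity)
  exact measure_not_isMarked_le μ
    (ψ := fun (V : Submodule ℚ (Fin (n + 1) → ℚ)) x => covol Q m (latticeBasis V) x) hmono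
    (fun V => continuous_covol _) hε
    (fun V b k hy => measure_covol_lt_le μ hQ _ (hrk V) b k j hy.choose_spec.1 hy.choose_spec.2)
    (n + 2) Set.univ (Finset.range (n + 2)) (Finset.card_range _)
    (fun V _ => Finset.mem_range.2 (Nat.lt_succ_of_le (hrk V))) a l
    fun V _ => h _ _ (linearIndependent_latticeBasis V)

lemma exists_nondivergenceConst_mul_le (p : ℕ) [Fact p.Prime] (k d : ℕ) {δ : ℝ} (hδ : 0 < δ) :
    ∃ j : ℕ, nondivergenceConst p k * (d * (p : ENNReal)⁻¹ ^ j) ≤ ENNReal.ofReal δ := by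
  have hp : (p : ENNReal)⁻¹ < 1 :=
    ENNReal.inv_lt_one.2 (by exact_mod_cast (Fact.out : p.Prime).one_lt)
  have h1 : Filter.Tendsto (fun j : ℕ => nondivergenceConst p k * (d * (p : ENNReal)⁻¹ ^ j))
      Filter.atTop (nhds 0) := by
    have h2 := ENNReal.Tendsto.const_mul (a := (d : ENNReal))
      (ENNReal.tendsto_pow_atTop_nhds_zero_of_lt_one hp) (Or.inr (ENNReal.natCast_ne_top d))
    rw [mul_zero] at h2
    have h3 := ENNReal.Tendsto.const_mul (a := nondivergenceConst p k) h2
      (Or.inr (nondivergenceConst_ne_top p k))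
    rwa [mul_zero] at h3
  exact (h1.eventually_le_const (ENNReal.ofReal_pos.2 hδ)).exists

end KeyLemma

/-- **Key Lemma.** Let `n ≥ 2`, `p` a prime, `v > 0` and `0 < κ < 1`. There
are positive constants `δ₀, C₁, C₂` depending only on `n`, `p` and `κ` such that: for every
ball `B = B(x₀, r) ⊆ ℤ_p` (with `0 ≤ r ≤ 1`) there is `Q₀` such that for every `Q ≥ Q₀` and
all parameters `0 < ξ₀ ≤ ⋯ ≤ ξ_{n−1} ≤ ξ_n = 1` with `∏ ξ_i = Q^{−(n+1)}` and
`ξ₀ ≤ Q^{−1−v}`, there is a measurable `G_B ⊆ B` with `μ(G_B) ≥ κ μ(B)` such that every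
`x ∈ G_B` admits `n+1` primitive polynomials `P₀, …, P_n ∈ ℤ[X]`, irreducible over `ℚ`, of
degree `n`, with `C₁ Q ≤ H(P_l) ≤ C₂ Q`, linearly independent coefficient vectors over `ℚ`,
and `δ₀ ξ_i ≤ |(1/i!) P_l⁽ⁱ⁾(x)|_p ≤ ξ_i` for all `0 ≤ i ≤ n`, `0 ≤ l ≤ n`.

Here `μ` is the Haar measure on `ℚ_p` normalized so that `μ(ℤ_p) = 1`. -/
theorem stmt7 (p : ℕ) [Fact p.Prime] (n : ℕ) (hn : 2 ≤ n)
    (κ : ℝ) (hκ0 : 0 < κ) (hκ1 : κ < 1)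
    (μ : Measure ℚ_[p]) [μ.IsAddHaarMeasure]
    (hμ : μ {x : ℚ_[p] | ‖x‖ ≤ 1} = 1) :
    ∃ δ₀ C₁ C₂ : ℝ, 0 < δ₀ ∧ 0 < C₁ ∧ 0 < C₂ ∧
      ∀ v : ℝ, 0 < v →
      ∀ (x₀ : ℤ_[p]) (r : ℝ), 0 ≤ r → r ≤ 1 →
      ∃ Q₀ : ℝ, ∀ Q : ℝ, Q₀ ≤ Q →
      ∀ ξ : ℕ → ℝ, 0 < ξ 0 → (∀ i < n, ξ i ≤ ξ (i + 1)) → ξ n = 1 →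
        (∏ i ∈ Finset.range (n + 1), ξ i) = Q ^ (-((n : ℝ) + 1)) →
        ξ 0 ≤ Q ^ (-1 - v) →
        ∃ G : Set ℚ_[p], G ⊆ {x : ℚ_[p] | ‖x - (x₀ : ℚ_[p])‖ ≤ r} ∧ MeasurableSet G ∧
          ENNReal.ofReal κ * μ {x : ℚ_[p] | ‖x - (x₀ : ℚ_[p])‖ ≤ r} ≤ μ G ∧
          ∀ x ∈ G, ∃ P : Fin (n + 1) → Polynomial ℤ,
            (∀ l : Fin (n + 1),
              (P l).IsPrimitive ∧
              Irreducible ((P l).map (Int.castRingHom ℚ)) ∧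
              (P l).natDegree = n ∧
              C₁ * Q ≤ (polyHeight (P l) : ℝ) ∧ (polyHeight (P l) : ℝ) ≤ C₂ * Q ∧
              ∀ i ≤ n,
                δ₀ * ξ i ≤ ‖Polynomial.aeval x (Polynomial.hasseDeriv i (P l))‖ ∧
                ‖Polynomial.aeval x (Polynomial.hasseDeriv i (P l))‖ ≤ ξ i) ∧
            LinearIndependent ℚ
              (fun l : Fin (n + 1) => fun j : Fin (n + 1) => ((P l).coeff j : ℚ)) := by
  have hp1 : (1 : ℝ) < p := one_lt_prime_cast
  have hn0 : n ≠ 0 := by lia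
  obtain ⟨j, hj⟩ := exists_nondivergenceConst_mul_le p (n + 2) ((n + 1) * n) (sub_pos.2 hκ1)
  set ε : ℝ := (p : ℝ) ^ (-(j * ((n + 1) * n : ℕ) : ℤ)) with hε
  have hε0 : 0 < ε := zpow_pos prime_cast_pos _
  refine ⟨(p : ℝ)⁻¹, ε / (n + 1) ^ 2,
    (n + 2) * (9 * p * (p ^ (n + 1) * ((n + 1) / (ε / (n + 1) ^ 2) + 1) ^ n)),
    by positivity, by positivity, by positivity, fun v _ x₀ r hr0 hr1 => ?_⟩
  rcases hr0.eq_or_lt with rfl | hr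
  · have hball : {x : ℚ_[p] | ‖x - (x₀ : ℚ_[p])‖ ≤ 0} = {(x₀ : ℚ_[p])} := by
      ext x
      simp [sub_eq_zero]
    refine ⟨0, fun Q _ ξ _ _ _ _ _ => ⟨∅, Set.empty_subset _, MeasurableSet.empty, ?_, by simp⟩⟩
    rw [hball, measure_singleton, mul_zero]
    exact zero_le
  obtain ⟨l, hl⟩ := exists_closedBall_eq_padicBall (x₀ : ℚ_[p]) hr
  obtain ⟨Q₀, hQ₀, hcovol⟩ := exists_one_le_covol (x₀ : ℚ_[p]) l hn0
  refine ⟨Q₀, fun Q hQ ξ hξ0 hξ hξn hprod _ => ?_⟩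
  have hQ0 : 0 < Q := by linarith
  have hmono : Monotone fun i => ξ (min i n) := by
    refine monotone_nat_of_le_succ fun i => ?_
    rcases lt_or_ge i n with h | h
    · rw [min_eq_left h.le, min_eq_left h]
      exact hξ i h
    · rw [min_eq_right h, min_eq_right (h.trans i.le_succ)]
  have hξpos (i : ℕ) : 0 < ξ (min i n) := by
    refine hξ0.trans_le ?_
    simpa using hmono i.zero_le
  have hξle (i : ℕ) : ξ (min i n) ≤ 1 := by
    have := hmono (min_le_right i n)
    simpa [hξn] using this
  have hξeq (i : Fin (n + 1)) : ξ (min i n) = ξ i := by rw [min_eq_left i.is_le]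
  have hprod' : ∏ i ∈ Finset.range (n + 1), ξ i = (Q ^ (n + 1))⁻¹ := by
    rw [hprod, Real.rpow_neg hQ0.le, ← Real.rpow_natCast, Nat.cast_add_one]
  choose m hm1 hm2 using fun i : Fin (n + 1) =>
    exists_pow_inv_le_lt (p := p) (hξpos i) (hξle i)
  have hlast : m (Fin.last n) = 0 := by
    have := hm2 (Fin.last n)
    rw [hξeq, Fin.val_last, hξn, ← div_eq_mul_inv, one_lt_div (by positivity)] at this
    nth_rewrite 2 [← pow_one (p : ℝ)] at this
    exact Nat.lt_one_iff.1 ((pow_lt_pow_iff_right₀ hp1).1 this)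
  have hmQ : ∏ i, (p : ℝ) ^ m i ≤ (p * Q) ^ (n + 1) := by
    calc ∏ i, (p : ℝ) ^ m i ≤ ∏ i : Fin (n + 1), p * (ξ i)⁻¹ := by
          refine Finset.prod_le_prod (fun i _ => by positivity) fun i _ => ?_
          have h1 := hm2 i
          have h2 := hξpos i
          rw [hξeq] at h1 h2
          rw [← div_eq_mul_inv, lt_div_iff₀ (by positivity)] at h1
          rw [← div_eq_mul_inv, le_div_iff₀ h2, mul_comm]
          exact h1.le
      _ = (p * Q) ^ (n + 1) := by
          rw [Finset.prod_mul_distrib, Finset.prod_const, Finset.card_univ, Fintype.card_fin,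
            Finset.prod_inv_distrib, ← Finset.prod_range, hprod', inv_inv, mul_pow]
  set bad : Set ℚ_[p] := {x ∈ padicBall (x₀ : ℚ_[p]) l |
    ¬IsMarked (fun (V : Submodule ℚ (Fin (n + 1) → ℚ)) x => covol Q m (latticeBasis V) x) ε
      Set.univ x} with hbad
  have hμbad : μ bad ≤ ENNReal.ofReal (1 - κ) * μ (padicBall (x₀ : ℚ_[p]) l) := by
    refine (measure_not_isMarked_covol_le μ hQ0 m j (x₀ : ℚ_[p]) l ?_).trans
      (mul_le_mul_left hj _)
    refine hcovol Q hQ (fun i => ξ (min i n)) hξpos hmono (by simpa using hξn) ?_ m hm1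
    rw [← hprod']
    exact Finset.prod_congr rfl fun i hi =>
      by rw [min_eq_left (Nat.lt_succ_iff.1 (Finset.mem_range.1 hi))]
  have hfin : μ (padicBall (x₀ : ℚ_[p]) l) ≠ ⊤ := (measure_padicBall_lt_top μ _ _).ne
  rw [hl]
  refine ⟨padicBall (x₀ : ℚ_[p]) l \ toMeasurable μ bad, Set.sdiff_subset,
    (isOpen_padicBall _ _).measurableSet.diff (measurableSet_toMeasurable _ _), ?_, ?_⟩
  · refine le_trans ?_ le_measure_sdiff
    rw [measure_toMeasurable]
    refine ENNReal.le_sub_of_add_le_right (hμbad.trans_lt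
      (ENNReal.mul_lt_top ENNReal.ofReal_lt_top hfin.lt_top)).ne ?_
    refine (add_le_add_right hμbad _).trans_eq ?_
    rw [← add_mul, ← ENNReal.ofReal_add hκ0.le (sub_nonneg.2 hκ1.le), add_sub_cancel,
      ENNReal.ofReal_one, one_mul]
  · rintro x ⟨hxB, hxG⟩
    have hmarked := not_not.1 fun h => hxG (subset_toMeasurable μ bad ⟨hxB, h⟩)
    have hx1 : ‖x‖ ≤ 1 := by
      rw [← hl, Set.mem_ofPred_eq] at hxB
      rw [← sub_add_cancel x (x₀ : ℚ_[p])]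
      exact (IsUltrametricDist.norm_add_le_max _ _).trans (max_le (hxB.trans hr1) x₀.2)
    obtain ⟨P, hP, hPind⟩ :=
      exists_polynomials_of_isMarked hn0 hQ0 hε0 hlast hmQ ⟨x, hx1⟩ hmarked
    refine ⟨P, fun a => ?_, hPind⟩
    obtain ⟨h1, h2, h3, h4, h5, h6⟩ := hP a
    refine ⟨h1, h2, h3, h4, h5, fun i hi => ?_⟩
    have h7 : ‖aeval x (hasseDeriv i (P a))‖ = _ := h6 ⟨i, Nat.lt_succ_of_le hi⟩
    have h8 := hm1 ⟨i, Nat.lt_succ_of_le hi⟩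
    have h9 := hm2 ⟨i, Nat.lt_succ_of_le hi⟩
    rw [hξeq] at h8 h9
    rw [h7, zpow_neg, zpow_natCast]
    refine ⟨?_, h8⟩
    rw [inv_mul_le_iff₀ prime_cast_pos]
    exact h9.le
end

section
/- Let n ≥ 2, Q > 1, 0 < v ≤ 1, and let ξ₀, …, ξ_n be positive reals with 0 < ξ₀ ≤ ξ₁ ≤ ⋯ ≤ ξ_n = 1, ∏_{i=0}^{n} ξ_i = Q^{−(n+1)}, and ξ₀ ≤ Q^{−1−v}. Then for every 1 ≤ k ≤ n, ∏_{i=0}^{k−1} (Q ξ_i)^{−1} ≥ Q^{v}. (This is the statement that the products d|g_i|_p with |g_i|_p = δ/ξ_i and d = 1/(δQ) satisfy ∏_{i=0}^{k−1} d|g_i|_p ≥ Q^v.) -/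
/-- Let `n ≥ 2`, `Q > 1`, `0 < v ≤ 1`, and let `ξ₀, …, ξ_n` be positive reals
with `ξ₀ ≤ ξ₁ ≤ ⋯ ≤ ξ_n = 1`, `∏_{i=0}^{n} ξ_i = Q^{−(n+1)}` and `ξ₀ ≤ Q^{−1−v}`. Then for
every `1 ≤ k ≤ n`, `∏_{i=0}^{k−1} (Q ξ_i)⁻¹ ≥ Q^v`. -/
theorem stmt10 (n : ℕ) (hn : 2 ≤ n) (Q v : ℝ) (hQ : 1 < Q) (hv0 : 0 < v) (hv1 : v ≤ 1)
    (ξ : ℕ → ℝ) (hpos : 0 < ξ 0)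
    (hmono : ∀ i < n, ξ i ≤ ξ (i + 1)) (hlast : ξ n = 1)
    (hprod : ∏ i ∈ Finset.range (n + 1), ξ i = Q ^ (-((n : ℝ) + 1)))
    (hfirst : ξ 0 ≤ Q ^ (-(1 + v))) :
    ∀ k, 1 ≤ k → k ≤ n → Q ^ v ≤ ∏ i ∈ Finset.range k, (Q * ξ i)⁻¹ := by
  have hQ0 : 0 < Q := by linarith
  have hξ : ∀ i ≤ n, 0 < ξ i := by
    intro i
    induction i with
    | zero => exact fun _ => hpos
    | succ i ih => exact fun h => (ih (by omega)).trans_le (hmono i (by omega))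
  have ha : ∀ k ≤ n, 0 < ∏ i ∈ Finset.range k, (Q * ξ i)⁻¹ := fun k hk =>
    Finset.prod_pos fun i hi => by
      have := hξ i (by have := Finset.mem_range.mp hi; omega)
      positivity
  have up : ∀ k, 1 ≤ k → k ≤ n → Q * ξ k ≤ 1 → Q ^ v ≤ ∏ i ∈ Finset.range k, (Q * ξ i)⁻¹ := by
    intro k hk
    induction k, hk using Nat.le_induction with
    | base =>
      intro _ _
      rw [Finset.prod_range_one, le_inv_comm₀ (by positivity) (by positivity)]
      calc Q * ξ 0 ≤ Q * Q ^ (-(1 + v)) := by gcongr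
        _ = (Q ^ v)⁻¹ := by
          rw [neg_add, Real.rpow_add hQ0, Real.rpow_neg hQ0.le, Real.rpow_neg hQ0.le,
            Real.rpow_one]
          field_simp
    | succ k _ ih =>
      intro hkn hle
      have hk0 := hξ k (by omega)
      have hk1 : Q * ξ k ≤ 1 :=
        (mul_le_mul_of_nonneg_left (hmono k (by omega)) hQ0.le).trans hle
      rw [Finset.prod_range_succ]
      exact (ih (by omega) hk1).trans <| le_mul_of_one_le_right (ha k (by omega)).le
        ((one_le_inv₀ (by positivity)).mpr hk1)
  have htop : ∏ i ∈ Finset.range n, (Q * ξ i)⁻¹ = Q := by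
    rw [Finset.prod_range_succ, hlast, mul_one] at hprod
    rw [Finset.prod_inv_distrib, Finset.prod_mul_distrib, hprod, Finset.prod_const,
      Finset.card_range, Real.rpow_neg hQ0.le, Real.rpow_add hQ0, Real.rpow_one,
      Real.rpow_natCast]
    field_simp
  have down : ∀ k ≤ n, 1 < Q * ξ k → Q ≤ ∏ i ∈ Finset.range k, (Q * ξ i)⁻¹ := by
    intro k hk
    induction hk using Nat.decreasingInduction with
    | self => exact fun _ => htop.ge
    | of_succ k hk ih =>
      intro hlt
      have h := ih (hlt.trans_le (mul_le_mul_of_nonneg_left (hmono k hk) hQ0.le))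
      rw [Finset.prod_range_succ] at h
      exact h.trans <| mul_le_of_le_one_right (ha k hk.le).le (inv_le_one_of_one_le₀ hlt.le)
  intro k hk hkn
  rcases le_or_gt (Q * ξ k) 1 with h | h
  · exact up k hk hkn h
  · calc Q ^ v ≤ Q ^ (1 : ℝ) := Real.rpow_le_rpow_of_exponent_le hQ.le hv1
      _ = Q := Real.rpow_one Q
      _ ≤ _ := down k hkn h
end
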